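/- There exist constants ᾱ ∈ (0,1) and C > 0 depending only on λ and Λ such that the following holds. Let u ∈ C²(B̄₁), B₁ ⊂ ℝ², be a classical solution of F(D²u) = 0 in B₁ with u = g on ∂B₁, where F is of class C¹, uniformly elliptic with constants λ, Λ, F(0) = 0, and ‖g‖_{C^{2,ᾱ}(∂B₁)} ≤ 1. Then for every x₀ ∈ B̄₁ there exists a quadratic polynomial P_{x₀} such that |u(x) − P_{x₀}(x)| ≤ C|x − x₀|^{2+ᾱ} for all x ∈ B̄₁ and |DP_{x₀}(x₀)| + |D²P_{x₀}| ≤ C. -/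

import Mathlib

open Metric Set Real
open scoped Classical

noncomputable section

abbrev E2 : Type := EuclideanSpace ℝ (Fin 2)
abbrev Mat2 : Type := Matrix (Fin 2) (Fin 2) ℝ

/-- `‖A⁺‖`: the sum of the positive parts of the eigenvalues of a symmetric matrix `A`. -/
noncomputable def posNorm (A : Mat2) : ℝ :=
  if h : A.IsHermitian then ∑ i, max (h.eigenvalues i) 0 else 0

/-- `‖A⁻‖`: the sum of the negative parts of the eigenvalues of a symmetric matrix `A`. -/
noncomputable def negNorm (A : Mat2) : ℝ :=
  if h : A.IsHermitian then ∑ i, max (-(h.eigenvalues i)) 0 else 0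

/-- A norm on 2×2 matrices: sum of absolute values of entries. -/
noncomputable def matNorm (A : Mat2) : ℝ := ∑ i, ∑ j, |A i j|

/-- `F` is uniformly elliptic with constants `0 < lam ≤ Lam`:
`F M - F N ≤ Lam ‖(M-N)⁺‖ - lam ‖(M-N)⁻‖` for all symmetric `M, N`. -/
def UniformlyElliptic (lam Lam : ℝ) (F : Mat2 → ℝ) : Prop :=
  ∀ M N : Mat2, M.IsHermitian → N.IsHermitian →
    F M - F N ≤ Lam * posNorm (M - N) - lam * negNorm (M - N)

/-- The Hessian matrix `D²u(x)` of `u : ℝ² → ℝ` at `x`. -/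
noncomputable def hess (u : E2 → ℝ) (x : E2) : Mat2 :=
  Matrix.of fun i j =>
    fderiv ℝ (fun y => fderiv ℝ u y (EuclideanSpace.single j 1)) x (EuclideanSpace.single i 1)

/-- `sup_s |u|`, the `L^∞` norm of `u` on `s`. -/
noncomputable def supAbs (u : E2 → ℝ) (s : Set E2) : ℝ := ⨆ x ∈ s, |u x|

/-- The point `(cos t, sin t)` on the unit circle `∂B₁`. -/
noncomputable def circPt (t : ℝ) : E2 :=
  (EuclideanSpace.equiv (Fin 2) ℝ).symm ![Real.cos t, Real.sin t]

/-- The trace of `g` on the unit circle, as a `2π`-periodic function on `ℝ`. -/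
noncomputable def onCircle (g : E2 → ℝ) : ℝ → ℝ := fun t => g (circPt t)

/-- `g ∈ C^{2,α}(∂B₁)`, via the arclength parametrization `t ↦ (cos t, sin t)`. -/
def MemHolderCircle (α : ℝ) (g : E2 → ℝ) : Prop :=
  ContDiff ℝ 2 (onCircle g) ∧
    ∃ H : ℝ, ∀ s t : ℝ,
      |deriv (deriv (onCircle g)) s - deriv (deriv (onCircle g)) t| ≤ H * |s - t| ^ α

/-- The `C^{2,α}` norm of `g` on the unit circle `∂B₁`. -/
noncomputable def holderNormCircle (α : ℝ) (g : E2 → ℝ) : ℝ :=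
  (⨆ t : ℝ, |onCircle g t|) + (⨆ t : ℝ, |deriv (onCircle g) t|) +
    (⨆ t : ℝ, |deriv (deriv (onCircle g)) t|) +
    ⨆ p : ℝ × ℝ,
      if p.1 ≠ p.2 then
        |deriv (deriv (onCircle g)) p.1 - deriv (deriv (onCircle g)) p.2| / |p.1 - p.2| ^ α
      else 0

noncomputable def vecNorm (v : Fin 2 → ℝ) : ℝ := Real.sqrt (∑ i, (v i) ^ 2)

/-- A quadratic polynomial on ℝ², `P(x) = a + b·x + ½ xᵀQx` with `Q = D²P` symmetric. -/
structure QuadPoly where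
  a : ℝ
  b : Fin 2 → ℝ
  Q : Mat2
  symm : Q.IsHermitian

noncomputable def QuadPoly.eval (P : QuadPoly) (x : E2) : ℝ :=
  P.a + (∑ i, P.b i * x i) + (1 / 2) * ∑ i, ∑ j, P.Q i j * x i * x j

/-- The gradient `DP(x) = b + Qx` of a quadratic polynomial. -/
noncomputable def QuadPoly.grad (P : QuadPoly) (x : E2) : Fin 2 → ℝ :=
  fun i => P.b i + ∑ j, P.Q i j * x j

namespace PW
open Filter MeasureTheory
open scoped Topology

/-- the functional `z ↦ p z₁ + q z₂` -/
def LL (p q : ℝ) : ℝ × ℝ →L[ℝ] ℝ :=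
  p • ContinuousLinearMap.fst ℝ ℝ ℝ + q • ContinuousLinearMap.snd ℝ ℝ ℝ

@[simp] lemma LL_apply (p q : ℝ) (z : ℝ × ℝ) : LL p q z = p * z.1 + q * z.2 := by
  simp [LL]

/-- algebraic ellipticity of a symmetric matrix -/
def SK (K a b c : ℝ) : Prop := a ^ 2 + 2 * b ^ 2 + c ^ 2 ≤ K * (b ^ 2 - a * c)

/-- iterated integral on the square -/
def II (r : ℝ) (f : ℝ × ℝ → ℝ) : ℝ := ∫ x in -r..r, ∫ y in -r..r, f (x, y)

lemma cont_inner {f : ℝ × ℝ → ℝ} (hf : Continuous f) (a b : ℝ) :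
    Continuous fun x => ∫ y in a..b, f (x, y) :=
  intervalIntegral.continuous_parametric_intervalIntegral_of_continuous'
    (f := fun x y => f (x, y)) (by simpa [Function.uncurry_def] using hf) a b

lemma cont_x {f : ℝ × ℝ → ℝ} (hf : Continuous f) (x : ℝ) : Continuous fun y => f (x, y) := by
  fun_prop

lemma cont_y {f : ℝ × ℝ → ℝ} (hf : Continuous f) (y : ℝ) : Continuous fun x => f (x, y) := by
  fun_prop

lemma II_add {f g : ℝ × ℝ → ℝ} (hf : Continuous f) (hg : Continuous g) (r : ℝ) :
    II r (fun X => f X + g X) = II r f + II r g := by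
  unfold II
  rw [← intervalIntegral.integral_add ((cont_inner hf _ _).intervalIntegrable _ _)
    ((cont_inner hg _ _).intervalIntegrable _ _)]
  congr 1; ext x
  exact intervalIntegral.integral_add ((cont_x hf x).intervalIntegrable _ _)
    ((cont_x hg x).intervalIntegrable _ _)

lemma II_sub {f g : ℝ × ℝ → ℝ} (hf : Continuous f) (hg : Continuous g) (r : ℝ) :
    II r (fun X => f X - g X) = II r f - II r g := by
  unfold II
  rw [← intervalIntegral.integral_sub ((cont_inner hf _ _).intervalIntegrable _ _)
    ((cont_inner hg _ _).intervalIntegrable _ _)]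
  congr 1; ext x
  exact intervalIntegral.integral_sub ((cont_x hf x).intervalIntegrable _ _)
    ((cont_x hg x).intervalIntegrable _ _)

lemma II_mul (c : ℝ) (f : ℝ × ℝ → ℝ) (r : ℝ) :
    II r (fun X => c * f X) = c * II r f := by
  unfold II
  simp [intervalIntegral.integral_const_mul]

lemma II_const (c : ℝ) (r : ℝ) : II r (fun _ => c) = 4 * r ^ 2 * c := by
  unfold II
  simp; ring

lemma II_mono {f g : ℝ × ℝ → ℝ} (hf : Continuous f) (hg : Continuous g) {r : ℝ} (hr : 0 ≤ r)
    (h : ∀ x ∈ Icc (-r) r, ∀ y ∈ Icc (-r) r, f (x, y) ≤ g (x, y)) : II r f ≤ II r g := by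
  unfold II
  apply intervalIntegral.integral_mono_on (by linarith)
    ((cont_inner hf _ _).intervalIntegrable _ _) ((cont_inner hg _ _).intervalIntegrable _ _)
  intro x hx
  apply intervalIntegral.integral_mono_on (by linarith)
    ((cont_x hf x).intervalIntegrable _ _) ((cont_x hg x).intervalIntegrable _ _)
  intro y hy
  exact h x hx y hy

lemma swap_cont {f : ℝ × ℝ → ℝ} (hf : Continuous f) (a b c d : ℝ) (hcd : c ≤ d) (hab : a ≤ b) :
    ∫ x in a..b, ∫ y in c..d, f (x, y) = ∫ y in c..d, ∫ x in a..b, f (x, y) := by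
  have := @intervalIntegral_integral_swap ℝ ℝ _ (volume.restrict (Ioc c d)) _ _ _ a b
    (fun x y => f (x, y)) (by
      rw [Measure.prod_restrict]
      have : IntegrableOn f (uIcc a b ×ˢ Icc c d) (volume.prod volume) :=
        hf.continuousOn.integrableOn_compact (isCompact_uIcc.prod isCompact_Icc)
      exact this.mono_set (prod_mono uIoc_subset_uIcc Ioc_subset_Icc_self))
  simp only [intervalIntegral.integral_of_le hcd]
  exact this

lemma II_swap {f : ℝ × ℝ → ℝ} (hf : Continuous f) {r : ℝ} (hr : 0 ≤ r) :
    II r f = ∫ y in -r..r, ∫ x in -r..r, f (x, y) :=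
  swap_cont hf _ _ _ _ (by linarith) (by linarith)

/-- `C¹` data -/
structure C1 (p p1 p2 : ℝ × ℝ → ℝ) : Prop where
  h : ∀ X, HasFDerivAt p (LL (p1 X) (p2 X)) X
  c1 : Continuous p1
  c2 : Continuous p2

lemma C1.cont {p p1 p2 : ℝ × ℝ → ℝ} (h : C1 p p1 p2) : Continuous p :=
  continuous_iff_continuousAt.2 fun X => (h.h X).continuousAt

lemma hasDerivAt_x {p : ℝ × ℝ → ℝ} {a b : ℝ} {x y : ℝ} (h : HasFDerivAt p (LL a b) (x, y)) :
    HasDerivAt (fun x => p (x, y)) a x := by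
  have h1 : HasDerivAt (fun x : ℝ => (x, y)) ((1 : ℝ), (0 : ℝ)) x :=
    (hasDerivAt_id x).prodMk (hasDerivAt_const x y)
  have := HasFDerivAt.comp_hasDerivAt x h h1
  simpa [Function.comp_def] using this

lemma hasDerivAt_y {p : ℝ × ℝ → ℝ} {a b : ℝ} {x y : ℝ} (h : HasFDerivAt p (LL a b) (x, y)) :
    HasDerivAt (fun y => p (x, y)) b y := by
  have h1 : HasDerivAt (fun y : ℝ => (x, y)) ((0 : ℝ), (1 : ℝ)) y :=
    (hasDerivAt_const y x).prodMk (hasDerivAt_id y)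
  have := HasFDerivAt.comp_hasDerivAt y h h1
  simpa [Function.comp_def] using this

lemma C1.ftc_x {p p1 p2 : ℝ × ℝ → ℝ} (h : C1 p p1 p2) (a b y : ℝ) :
    ∫ x in a..b, p1 (x, y) = p (b, y) - p (a, y) :=
  intervalIntegral.integral_eq_sub_of_hasDerivAt
    (fun x _ => hasDerivAt_x (h.h (x, y))) ((cont_y h.c1 y).intervalIntegrable _ _)

lemma C1.ftc_y {p p1 p2 : ℝ × ℝ → ℝ} (h : C1 p p1 p2) (a b x : ℝ) :
    ∫ y in a..b, p2 (x, y) = p (x, b) - p (x, a) :=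
  intervalIntegral.integral_eq_sub_of_hasDerivAt
    (fun y _ => hasDerivAt_y (h.h (x, y))) ((cont_x h.c2 x).intervalIntegrable _ _)

lemma C1.mul {p p1 p2 q q1 q2 : ℝ × ℝ → ℝ} (hp : C1 p p1 p2) (hq : C1 q q1 q2) :
    C1 (fun X => p X * q X) (fun X => p1 X * q X + p X * q1 X)
      (fun X => p2 X * q X + p X * q2 X) := by
  have cp := hp.cont
  have cq := hq.cont
  have := hp.c1; have := hp.c2; have := hq.c1; have := hq.c2
  refine ⟨fun X => ?_, by fun_prop, by fun_prop⟩
  have := (hp.h X).mul (hq.h X)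
  refine this.congr_fderiv ?_
  ext <;> simp [LL] <;> ring

lemma C1.sub_const {p p1 p2 : ℝ × ℝ → ℝ} (hp : C1 p p1 p2) (k : ℝ) :
    C1 (fun X => p X - k) p1 p2 :=
  ⟨fun X => (hp.h X).sub_const k, hp.c1, hp.c2⟩

/-- Steklov mean in the first variable. -/
lemma steklov_x {q q1 q2 : ℝ × ℝ → ℝ} (hq : C1 q q1 q2) {h : ℝ} (hh : h ≠ 0) (x y : ℝ) :
    ∫ s in (0:ℝ)..1, q1 (x + h * s, y) = (q (x + h, y) - q (x, y)) / h := by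
  have : ∀ s ∈ uIcc (0:ℝ) 1, HasDerivAt (fun s => q (x + h * s, y) / h) (q1 (x + h * s, y)) s := by
    intro s _
    have h1 : HasDerivAt (fun s : ℝ => x + h * s) h s := by
      simpa using ((hasDerivAt_id s).const_mul h).const_add x
    have h2 := (hasDerivAt_x (hq.h (x + h * s, y)))
    have h3 := (h2.comp s h1).div_const h
    simp only [Function.comp_def] at h3
    rwa [mul_div_assoc, div_self hh, mul_one] at h3
  rw [intervalIntegral.integral_eq_sub_of_hasDerivAt this]
  · simp; ring
  · have := hq.c1
    apply Continuous.intervalIntegrable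
    fun_prop

lemma steklov_d {q2 : ℝ × ℝ → ℝ} (hq : Continuous q2) {h : ℝ} (hh : h ≠ 0) (x y : ℝ) :
    HasDerivAt (fun x => ∫ s in (0:ℝ)..1, q2 (x + h * s, y))
      ((q2 (x + h, y) - q2 (x, y)) / h) x := by
  have e : ∀ x, ∫ s in (0:ℝ)..1, q2 (x + h * s, y)
      = h⁻¹ * ((∫ t in (0:ℝ)..(x + h), q2 (t, y)) - ∫ t in (0:ℝ)..x, q2 (t, y)) := by
    intro x
    have := intervalIntegral.integral_comp_add_mul (fun t => q2 (t, y)) hh x (a := 0) (b := 1)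
    rw [this]
    simp only [smul_eq_mul, mul_zero, add_zero, mul_one]
    rw [intervalIntegral.integral_interval_sub_left] <;>
    exact (cont_y hq y).intervalIntegrable _ _
  simp_rw [e]
  have d : ∀ x, HasDerivAt (fun x => ∫ t in (0:ℝ)..x, q2 (t, y)) (q2 (x, y)) x := fun x =>
    intervalIntegral.integral_hasDerivAt_right ((cont_y hq y).intervalIntegrable _ _)
      ((cont_y hq y).stronglyMeasurableAtFilter _ _) (cont_y hq y).continuousAt
  have d2 := (d (x + h)).comp_add_const x h
  have := (d2.sub (d x)).const_mul h⁻¹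
  rw [div_eq_inv_mul]
  exact this

/-- the Jacobian identity for `C¹` functions. -/
lemma jacobian {p p1 p2 q q1 q2 : ℝ × ℝ → ℝ} (hp : C1 p p1 p2) (hq : C1 q q1 q2) {r : ℝ}
    (hr : 0 ≤ r) :
    II r (fun X => p1 X * q2 X - p2 X * q1 X) =
      (∫ y in -r..r, (p (r, y) * q2 (r, y) - p (-r, y) * q2 (-r, y))) -
      ∫ x in -r..r, (p (x, r) * q1 (x, r) - p (x, -r) * q1 (x, -r)) := by
  have cp := hp.cont
  have cq := hq.cont
  have cp1 := hp.c1; have cp2 := hp.c2; have cq1 := hq.c1; have cq2 := hq.c2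
  -- Steklov functions, jointly continuous
  let A : ℝ → ℝ × ℝ → ℝ := fun h X => ∫ s in (0:ℝ)..1, q1 (X.1 + h * s, X.2)
  let B : ℝ → ℝ × ℝ → ℝ := fun h X => ∫ s in (0:ℝ)..1, q2 (X.1 + h * s, X.2)
  have cA : Continuous fun z : ℝ × (ℝ × ℝ) => A z.1 z.2 :=
    intervalIntegral.continuous_parametric_intervalIntegral_of_continuous'
      (f := fun (z : ℝ × (ℝ × ℝ)) s => q1 (z.2.1 + z.1 * s, z.2.2))
      (by simp only [Function.uncurry_def]; fun_prop) 0 1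
  have cB : Continuous fun z : ℝ × (ℝ × ℝ) => B z.1 z.2 :=
    intervalIntegral.continuous_parametric_intervalIntegral_of_continuous'
      (f := fun (z : ℝ × (ℝ × ℝ)) s => q2 (z.2.1 + z.1 * s, z.2.2))
      (by simp only [Function.uncurry_def]; fun_prop) 0 1
  have cA' : ∀ h, Continuous (A h) := fun h => cA.comp (by fun_prop : Continuous fun X : ℝ × ℝ => (h, X))
  have cB' : ∀ h, Continuous (B h) := fun h => cB.comp (by fun_prop : Continuous fun X : ℝ × ℝ => (h, X))
  let L : ℝ → ℝ := fun h => II r (fun X => p1 X * B h X - p2 X * A h X)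
  let M : ℝ → ℝ := fun h => (∫ y in -r..r, (p (r, y) * B h (r, y) - p (-r, y) * B h (-r, y))) -
      ∫ x in -r..r, (p (x, r) * A h (x, r) - p (x, -r) * A h (x, -r))
  have key : ∀ h, h ≠ 0 → L h = M h := by
    intro h hh
    let D : ℝ × ℝ → ℝ := fun X => (q2 (X.1 + h, X.2) - q2 X) / h
    have cD : Continuous D := by fun_prop
    have eq : (fun X => p1 X * B h X - p2 X * A h X) =
        fun X => (p1 X * B h X + p X * D X) - (p2 X * A h X + p X * D X) := by
      ext X; ring
    have cb := cB' h
    have ca := cA' h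
    show II r _ = _
    rw [eq, II_sub (by fun_prop) (by fun_prop)]
    congr 1
    · rw [II_swap (by fun_prop) hr]
      congr 1; ext y
      rw [intervalIntegral.integral_eq_sub_of_hasDerivAt (f := fun x => p (x, y) * B h (x, y))]
      · intro x _
        exact (hasDerivAt_x (hp.h (x, y))).mul (steklov_d cq2 hh x y)
      · apply Continuous.intervalIntegrable; fun_prop
    · unfold II
      congr 1; ext x
      rw [intervalIntegral.integral_eq_sub_of_hasDerivAt (f := fun y => p (x, y) * A h (x, y))]
      · intro y _
        refine (hasDerivAt_y (hp.h (x, y))).mul ?_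
        have e : (fun y => A h (x, y)) = fun y => (q (x + h, y) - q (x, y)) / h := by
          ext y; exact steklov_x hq hh x y
        rw [e]
        exact ((hasDerivAt_y (hq.h (x + h, y))).sub (hasDerivAt_y (hq.h (x, y)))).div_const h
      · apply Continuous.intervalIntegrable; fun_prop
  have cL : Continuous L := by
    apply intervalIntegral.continuous_parametric_intervalIntegral_of_continuous'
      (f := fun (h : ℝ) x => ∫ y in -r..r, (p1 (x, y) * B h (x, y) - p2 (x, y) * A h (x, y)))
    apply intervalIntegral.continuous_parametric_intervalIntegral_of_continuous'
      (f := fun (z : ℝ × ℝ) y => (p1 (z.2, y) * B z.1 (z.2, y) - p2 (z.2, y) * A z.1 (z.2, y)))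
    have e1 : Continuous fun z : (ℝ × ℝ) × ℝ => B z.1.1 (z.1.2, z.2) :=
      cB.comp (by fun_prop : Continuous fun z : (ℝ × ℝ) × ℝ => (z.1.1, (z.1.2, z.2)))
    have e2 : Continuous fun z : (ℝ × ℝ) × ℝ => A z.1.1 (z.1.2, z.2) :=
      cA.comp (by fun_prop : Continuous fun z : (ℝ × ℝ) × ℝ => (z.1.1, (z.1.2, z.2)))
    simp only [Function.uncurry_def]
    fun_prop
  have cM : Continuous M := by
    apply Continuous.sub
    · apply intervalIntegral.continuous_parametric_intervalIntegral_of_continuous'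
        (f := fun (h : ℝ) y => (p (r, y) * B h (r, y) - p (-r, y) * B h (-r, y)))
      have e1 : ∀ k, Continuous fun z : ℝ × ℝ => B z.1 (k, z.2) := fun k =>
        cB.comp (by fun_prop : Continuous fun z : ℝ × ℝ => (z.1, (k, z.2)))
      have e2 := e1 r
      have e3 := e1 (-r)
      simp only [Function.uncurry_def]
      fun_prop
    · apply intervalIntegral.continuous_parametric_intervalIntegral_of_continuous'
        (f := fun (h : ℝ) x => (p (x, r) * A h (x, r) - p (x, -r) * A h (x, -r)))
      have e1 : ∀ k, Continuous fun z : ℝ × ℝ => A z.1 (z.2, k) := fun k =>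
        cA.comp (by fun_prop : Continuous fun z : ℝ × ℝ => (z.1, (z.2, k)))
      have e2 := e1 r
      have e3 := e1 (-r)
      simp only [Function.uncurry_def]
      fun_prop
  have LM : L = M := Continuous.ext_on (dense_compl_singleton (0:ℝ)) cL cM (fun h hh => key h hh)
  have A0 : ∀ X, A 0 X = q1 X := fun X => by simp [A]
  have B0 : ∀ X, B 0 X = q2 X := fun X => by simp [B]
  have := congrFun LM 0
  simp only [L, M, A0, B0] at this
  exact this

end PW

namespace PW
open Filter MeasureTheory
open scoped Topology

/-- global `C²` data -/
structure J2 (w p q a b c : ℝ × ℝ → ℝ) : Prop where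
  w : C1 w p q
  p : C1 p a b
  q : C1 q b c

lemma C1.II_x {g g1 g2 : ℝ × ℝ → ℝ} (h : C1 g g1 g2) {r : ℝ} (hr : 0 ≤ r)
    (h0 : ∀ y, g (r, y) = 0) (h1 : ∀ y, g (-r, y) = 0) : II r g1 = 0 := by
  rw [II_swap h.c1 hr]
  simp [h.ftc_x, h0, h1]

lemma C1.II_y {g g1 g2 : ℝ × ℝ → ℝ} (h : C1 g g1 g2) {r : ℝ}
    (h0 : ∀ x, g (x, r) = 0) (h1 : ∀ x, g (x, -r) = 0) : II r g2 = 0 := by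
  unfold II
  simp [h.ftc_y, h0, h1]

lemma C1.of_prod {f f' g g' : ℝ → ℝ} (hf : ∀ x, HasDerivAt f (f' x) x)
    (hg : ∀ x, HasDerivAt g (g' x) x) (cf : Continuous f') (cg : Continuous g') :
    C1 (fun X => f X.1 * g X.2) (fun X => f' X.1 * g X.2) (fun X => f X.1 * g' X.2) := by
  have cf0 : Continuous f := continuous_iff_continuousAt.2 fun x => (hf x).continuousAt
  have cg0 : Continuous g := continuous_iff_continuousAt.2 fun x => (hg x).continuousAt
  refine ⟨fun X => ?_, by fun_prop, by fun_prop⟩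
  have h1 := (hf X.1).comp_hasFDerivAt X (hasFDerivAt_fst (𝕜 := ℝ) (p := X))
  have h2 := (hg X.2).comp_hasFDerivAt X (hasFDerivAt_snd (𝕜 := ℝ) (p := X))
  refine (h1.mul h2).congr_fderiv ?_
  ext <;> simp [LL] <;> ring

lemma e_d (x : ℝ) : HasDerivAt (fun x : ℝ => (1 - x ^ 2) ^ 4) (-8 * x * (1 - x ^ 2) ^ 3) x := by
  have := (((hasDerivAt_id x).pow 2).const_sub 1).pow 4
  refine this.congr_deriv ?_
  simp; ring

lemma e_d2 (x : ℝ) : HasDerivAt (fun x : ℝ => -8 * x * (1 - x ^ 2) ^ 3)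
    (-8 * (1 - x ^ 2) ^ 3 + 48 * x ^ 2 * (1 - x ^ 2) ^ 2) x := by
  have := ((hasDerivAt_id x).const_mul (-8)).mul ((((hasDerivAt_id x).pow 2).const_sub 1).pow 3)
  refine this.congr_deriv ?_
  simp; ring

lemma z_d (x : ℝ) : HasDerivAt (fun x : ℝ => (1 - x ^ 2) ^ 2) (-4 * x * (1 - x ^ 2)) x := by
  have := (((hasDerivAt_id x).pow 2).const_sub 1).pow 2
  refine this.congr_deriv ?_
  simp; ring

lemma amgm_aux {K η f ηxy ηxx ηyy ζ ζx ζy p q a b c w s : ℝ} (hK : 1 ≤ K)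
    (hs : 0 ≤ s) (hζ : ζ = s ^ 2) (hη : η = ζ ^ 2)
    (hf : f = a ^ 2 + 2 * b ^ 2 + c ^ 2) (hsk : f ≤ K * (b ^ 2 - a * c)) (hw : |w| ≤ 1)
    (h1 : |ηxy| ≤ 64 * ζ) (h2 : |ηxx| ≤ 64 * ζ) (h3 : |ηyy| ≤ 64 * ζ)
    (h4 : |ζx| ≤ 4 * s) (h5 : |ζy| ≤ 4 * s) :
    η * f ≤ 2 * (128 * K * ((ζx * w * p + ζ * p ^ 2 + ζ * w * a) +
      (ζy * w * q + ζ * q ^ 2 + ζ * w * c) + 16 + 128 * K) -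
      K * (η * (a * c - b ^ 2) - ηxy * p * q + ηxx * q ^ 2 / 2 + ηyy * p ^ 2 / 2)) := by
  have hζ0 : 0 ≤ ζ := by rw [hζ]; positivity
  have hη0 : 0 ≤ η := by rw [hη]; positivity
  have hw' := abs_le.1 hw
  have A1 : η * f ≤ K * (η * (b ^ 2 - a * c)) := by
    have := mul_le_mul_of_nonneg_left hsk hη0
    linarith
  have B1 : -(ηxy * p * q) ≤ 32 * ζ * (p ^ 2 + q ^ 2) := by
    have e : |ηxy * p * q| ≤ 64 * ζ * ((p ^ 2 + q ^ 2) / 2) := by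
      rw [mul_assoc, abs_mul]
      apply mul_le_mul h1 _ (abs_nonneg _) (by positivity)
      rw [abs_le]; constructor <;> nlinarith [sq_nonneg (p - q), sq_nonneg (p + q)]
    have := (abs_le.1 e).1
    linarith
  have B2 : ηxx * q ^ 2 / 2 ≤ 32 * ζ * q ^ 2 := by
    have := mul_le_mul_of_nonneg_right (abs_le.1 h2).2 (sq_nonneg q); linarith
  have B3 : ηyy * p ^ 2 / 2 ≤ 32 * ζ * p ^ 2 := by
    have := mul_le_mul_of_nonneg_right (abs_le.1 h3).2 (sq_nonneg p); linarith
  have lin : ∀ ζx p : ℝ, |ζx| ≤ 4 * s → -(ζx * w * p) ≤ ζ * p ^ 2 / 2 + 8 := by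
    intro ζx p h
    have e : |ζx * w * p| ≤ 4 * s * 1 * |p| := by
      rw [abs_mul, abs_mul]; gcongr
    have := (abs_le.1 e).1
    have h3 := sq_nonneg (s * |p| - 4)
    have h4 := sq_abs p
    have h5 : (s * |p|) ^ 2 = ζ * p ^ 2 := by rw [mul_pow, h4, hζ]
    nlinarith
  have C1 := lin ζx p h4
  have C2 := lin ζy q h5
  have C3 : -(ζ * w * a + ζ * w * c) ≤ η * f / (256 * K) + 128 * K := by
    have e : |ζ * w * (a + c)| ≤ ζ * 1 * |a + c| := by
      rw [abs_mul, abs_mul, abs_of_nonneg hζ0]; gcongr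
    have h1 := (abs_le.1 e).1
    have h2 : (ζ * |a + c|) ^ 2 ≤ 2 * (η * f) := by
      rw [mul_pow, sq_abs, hη, hf]
      have : (a + c) ^ 2 ≤ 2 * (a ^ 2 + 2 * b ^ 2 + c ^ 2) := by nlinarith [sq_nonneg (a - c), sq_nonneg b]
      nlinarith [sq_nonneg ζ, mul_le_mul_of_nonneg_left this (sq_nonneg ζ)]
    have h3 : ζ * |a + c| ≤ (ζ * |a + c|) ^ 2 / (512 * K) + 128 * K := by
      have := sq_nonneg (ζ * |a + c| - 256 * K)
      rw [← sub_nonneg]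
      have e : (ζ * |a + c|) ^ 2 / (512 * K) + 128 * K - ζ * |a + c| =
        (ζ * |a + c| - 256 * K) ^ 2 / (512 * K) := by
        field_simp; ring
      rw [e]; positivity
    have h4 : (ζ * |a + c|) ^ 2 / (512 * K) ≤ 2 * (η * f) / (512 * K) := by gcongr
    have h5 : 2 * (η * f) / (512 * K) = η * f / (256 * K) := by field_simp; ring
    linarith
  have D : 128 * K * (η * f / (256 * K)) = η * f / 2 := by field_simp; ring
  have D2 := mul_le_mul_of_nonneg_left C3 (by positivity : 0 ≤ 128 * K)
  rw [mul_add, D] at D2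
  have D3 := mul_le_mul_of_nonneg_left (add_le_add C1 C2) (by positivity : 0 ≤ 128 * K)
  have D4 := mul_le_mul_of_nonneg_left (add_le_add (add_le_add B1 B2) B3) (by positivity : 0 ≤ K)
  linarith

lemma II_comb {φ1 φ2 φ3 φ4 φ5 φ6 : ℝ × ℝ → ℝ} (c1 : Continuous φ1) (c2 : Continuous φ2)
    (c3 : Continuous φ3) (c4 : Continuous φ4) (c5 : Continuous φ5) (c6 : Continuous φ6)
    (i1 : II 1 φ1 = 0) (i2 : II 1 φ2 = 0) (i3 : II 1 φ3 = 0) (i4 : II 1 φ4 = 0)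
    (i5 : II 1 φ5 = 0) (i6 : II 1 φ6 = 0) {K : ℝ} :
    II 1 (fun X => 256 * K * (φ5 X + φ6 X) - 2 * K * ((φ1 X - φ2 X) + (1/2) * (φ3 X + φ4 X))
      + 256 * K * (16 + 128 * K)) = 4 * (256 * K * (16 + 128 * K)) := by
  rw [II_add (by fun_prop) (by fun_prop), II_sub (by fun_prop) (by fun_prop), II_mul, II_mul,
      II_add c5 c6, II_add (by fun_prop) (by fun_prop), II_sub c1 c2, II_mul, II_add c3 c4, i1, i2, i3, i4, i5, i6,
      II_const]
  ring

lemma inner_nonneg {f : ℝ × ℝ → ℝ} (h0 : ∀ X, 0 ≤ f X) {a b : ℝ} (hr : a ≤ b) (x : ℝ) :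
    0 ≤ ∫ y in a..b, f (x, y) :=
  intervalIntegral.integral_nonneg hr fun y _ => h0 _

lemma II_mono_r {f : ℝ × ℝ → ℝ} (hf : Continuous f) (h0 : ∀ X, 0 ≤ f X) {r R : ℝ} (hr : 0 ≤ r)
    (hR : r ≤ R) : II r f ≤ II R f := by
  unfold II
  calc _ ≤ ∫ x in -r..r, ∫ y in -R..R, f (x, y) := by
        apply intervalIntegral.integral_mono_on (by linarith)
          ((cont_inner hf _ _).intervalIntegrable _ _) ((cont_inner hf _ _).intervalIntegrable _ _)
        intro x _
        apply intervalIntegral.integral_mono_interval (by linarith) (by linarith) hR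
        · exact Eventually.of_forall fun y => h0 _
        · exact (cont_x hf x).intervalIntegrable _ _
    _ ≤ _ := by
        apply intervalIntegral.integral_mono_interval (by linarith) (by linarith) hR
        · exact Eventually.of_forall fun x => inner_nonneg h0 (by linarith) x
        · exact (cont_inner hf _ _).intervalIntegrable _ _

set_option maxHeartbeats 1000000 in
/-- interior energy estimate -/
lemma energy {w p q a b c : ℝ × ℝ → ℝ} (J : J2 w p q a b c) {K : ℝ} (hK : 1 ≤ K)
    (hsk : ∀ x ∈ Icc (-1 : ℝ) 1, ∀ y ∈ Icc (-1 : ℝ) 1, SK K (a (x, y)) (b (x, y)) (c (x, y)))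
    (hw : ∀ x ∈ Icc (-1 : ℝ) 1, ∀ y ∈ Icc (-1 : ℝ) 1, |w (x, y)| ≤ 1) :
    II (1 / 2) (fun X => a X ^ 2 + 2 * b X ^ 2 + c X ^ 2) ≤ 2000000 * K ^ 2 := by
  have ca := J.p.c1; have cb := J.p.c2; have cc := J.q.c2
  have cp := J.p.cont; have cq := J.q.cont; have cw := J.w.cont
  let e : ℝ → ℝ := fun x => (1 - x ^ 2) ^ 4
  let e1 : ℝ → ℝ := fun x => -8 * x * (1 - x ^ 2) ^ 3
  let e2 : ℝ → ℝ := fun x => -8 * (1 - x ^ 2) ^ 3 + 48 * x ^ 2 * (1 - x ^ 2) ^ 2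
  let k : ℝ → ℝ := fun x => (1 - x ^ 2) ^ 2
  let k1 : ℝ → ℝ := fun x => -4 * x * (1 - x ^ 2)
  have ce : Continuous e := by fun_prop
  have ce1 : Continuous e1 := by fun_prop
  have ce2 : Continuous e2 := by fun_prop
  have ck : Continuous k := by fun_prop
  have ck1 : Continuous k1 := by fun_prop
  have de : ∀ x, HasDerivAt e (e1 x) x := e_d
  have de1 : ∀ x, HasDerivAt e1 (e2 x) x := e_d2
  have dk : ∀ x, HasDerivAt k (k1 x) x := z_d
  have z0 : e 1 = 0 := by norm_num [e]
  have z0' : e (-1) = 0 := by norm_num [e]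
  have z1 : e1 1 = 0 := by norm_num [e1]
  have z1' : e1 (-1) = 0 := by norm_num [e1]
  have y0 : k 1 = 0 := by norm_num [k]
  have y0' : k (-1) = 0 := by norm_num [k]
  have Cη := C1.of_prod de de ce1 ce1
  have Cηx := C1.of_prod de1 de ce2 ce1
  have Cηy := C1.of_prod de de1 ce1 ce2
  have Cζ := C1.of_prod dk dk ck1 ck1
  have i1 := jacobian (Cη.mul J.p) J.q (zero_le_one)
  have i2 := ((Cηx.mul J.p).mul J.q).II_y (r := 1) (by simp [z0, z0', z1, z1']) (by simp [z0, z0', z1, z1'])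
  have i3 := ((Cηx.mul J.q).mul J.q).II_x (r := 1) zero_le_one (by simp [z0, z0', z1, z1']) (by simp [z0, z0', z1, z1'])
  have i4 := ((Cηy.mul J.p).mul J.p).II_y (r := 1) (by simp [z0, z0', z1, z1']) (by simp [z0, z0', z1, z1'])
  have i5 := ((Cζ.mul J.w).mul J.p).II_x (r := 1) zero_le_one (by simp [y0, y0']) (by simp [y0, y0'])
  have i6 := ((Cζ.mul J.w).mul J.q).II_y (r := 1) (by simp [y0, y0']) (by simp [y0, y0'])
  simp only [z0, z0', zero_mul, mul_zero, sub_self, intervalIntegral.integral_zero] at i1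
  set φ1 := (fun X : ℝ × ℝ => (e1 X.1 * e X.2 * p X + e X.1 * e X.2 * a X) * c X -
          (e X.1 * e1 X.2 * p X + e X.1 * e X.2 * b X) * b X) with hφ1
  set φ2 := (fun X : ℝ × ℝ => (e1 X.1 * e1 X.2 * p X + e1 X.1 * e X.2 * b X) * q X + e1 X.1 * e X.2 * p X * c X) with hφ2
  set φ3 := (fun X : ℝ × ℝ => (e2 X.1 * e X.2 * q X + e1 X.1 * e X.2 * b X) * q X + e1 X.1 * e X.2 * q X * b X) with hφ3
  set φ4 := (fun X : ℝ × ℝ => (e X.1 * e2 X.2 * p X + e X.1 * e1 X.2 * b X) * p X + e X.1 * e1 X.2 * p X * b X) with hφ4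
  set φ5 := (fun X : ℝ × ℝ => (k1 X.1 * k X.2 * w X + k X.1 * k X.2 * p X) * p X + k X.1 * k X.2 * w X * a X) with hφ5
  set φ6 := (fun X : ℝ × ℝ => (k X.1 * k1 X.2 * w X + k X.1 * k X.2 * q X) * q X + k X.1 * k X.2 * w X * c X) with hφ6
  have c1 : Continuous φ1 := by fun_prop
  have c2 : Continuous φ2 := by fun_prop
  have c3 : Continuous φ3 := by fun_prop
  have c4 : Continuous φ4 := by fun_prop
  have c5 : Continuous φ5 := by fun_prop
  have c6 : Continuous φ6 := by fun_prop
  have tot : II 1 (fun X => 256 * K * (φ5 X + φ6 X) - 2 * K * ((φ1 X - φ2 X) + (1/2) * (φ3 X + φ4 X))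
      + 256 * K * (16 + 128 * K)) = 4 * (256 * K * (16 + 128 * K)) := by
    exact II_comb c1 c2 c3 c4 c5 c6 i1 i2 i3 i4 i5 i6
  let f : ℝ × ℝ → ℝ := fun X => a X ^ 2 + 2 * b X ^ 2 + c X ^ 2
  have cf : Continuous f := by fun_prop
  have main : II 1 (fun X => e X.1 * e X.2 * f X) ≤ 4 * (256 * K * (16 + 128 * K)) := by
    rw [← tot]
    apply II_mono (by fun_prop) (by fun_prop) zero_le_one
    intro x hx y hy
    have hx2 : 0 ≤ 1 - x ^ 2 := by nlinarith [hx.1, hx.2]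
    have hy2 : 0 ≤ 1 - y ^ 2 := by nlinarith [hy.1, hy.2]
    have hx3 : 1 - x ^ 2 ≤ 1 := by nlinarith [sq_nonneg x]
    have hy3 : 1 - y ^ 2 ≤ 1 := by nlinarith [sq_nonneg y]
    have hx1 : |x| ≤ 1 := abs_le.2 hx
    have hy1 : |y| ≤ 1 := abs_le.2 hy
    have ak : ∀ t : ℝ, 0 ≤ 1 - t ^ 2 → |t| ≤ 1 → 1 - t ^ 2 ≤ 1 → |e2 t| ≤ 64 * k t := by
      intro t ht ht1 ht2
      have e0 : e2 t = (1 - t ^ 2) ^ 2 * (56 * t ^ 2 - 8) := by simp only [e2]; ring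
      have : |56 * t ^ 2 - 8| ≤ 64 := by
        rw [abs_le]; constructor <;> nlinarith [sq_nonneg t]
      rw [e0, abs_mul, abs_of_nonneg (by positivity : 0 ≤ (1 - t ^ 2) ^ 2), mul_comm]
      gcongr
    have ek : ∀ t : ℝ, 0 ≤ 1 - t ^ 2 → 1 - t ^ 2 ≤ 1 → e t ≤ k t := by
      intro t h1 h2
      exact pow_le_pow_of_le_one h1 h2 (by norm_num)
    have e1k : ∀ t : ℝ, 0 ≤ 1 - t ^ 2 → |t| ≤ 1 → 1 - t ^ 2 ≤ 1 → |e1 t| ≤ 8 * k t := by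
      intro t h1 h2 h3
      have : |e1 t| = 8 * |t| * (1 - t ^ 2) ^ 3 := by
        simp only [e1]; rw [abs_mul, abs_mul, abs_of_nonneg (by positivity : 0 ≤ (1 - t ^ 2) ^ 3)]; norm_num
      rw [this]
      have h5 : (1 - t ^ 2) ^ 3 ≤ k t := pow_le_pow_of_le_one h1 h3 (by norm_num)
      calc 8 * |t| * (1 - t ^ 2) ^ 3 ≤ 8 * 1 * k t := by gcongr
        _ = _ := by ring
    have k1k : ∀ t : ℝ, 0 ≤ 1 - t ^ 2 → |t| ≤ 1 → |k1 t| ≤ 4 * (1 - t ^ 2) := by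
      intro t h1 h2
      simp only [k1]; rw [abs_mul, abs_mul, abs_of_nonneg h1]; norm_num
      nlinarith
    have e0 : ∀ t, 0 ≤ e t := fun t => by simp only [e]; positivity
    have k0 : ∀ t, 0 ≤ k t := fun t => by simp only [k]; positivity
    have A := amgm_aux (K := K) (η := e x * e y) (f := f (x, y)) (ηxy := e1 x * e1 y) (ηxx := e2 x * e y)
      (ηyy := e x * e2 y) (ζ := k x * k y) (ζx := k1 x * k y) (ζy := k x * k1 y) (p := p (x, y))
      (q := q (x, y)) (a := a (x, y)) (b := b (x, y)) (c := c (x, y)) (w := w (x, y))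
      (s := (1 - x ^ 2) * (1 - y ^ 2)) hK (by positivity) (by simp only [k]; ring)
      (by simp only [e, k]; ring) rfl (hsk x hx y hy) (hw x hx y hy)
      (by rw [abs_mul]; nlinarith [mul_le_mul (e1k x hx2 hx1 hx3) (e1k y hy2 hy1 hy3) (abs_nonneg _) (by have := k0 x; positivity)])
      (by
        rw [abs_mul, abs_of_nonneg (e0 y)]
        have := mul_le_mul (ak x hx2 hx1 hx3) (ek y hy2 hy3) (e0 y) (by have := k0 x; positivity)
        linarith)
      (by
        rw [abs_mul, abs_of_nonneg (e0 x)]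
        have := mul_le_mul (ek x hx2 hx3) (ak y hy2 hy1 hy3) (abs_nonneg _) (k0 x)
        linarith)
      (by
        rw [abs_mul, abs_of_nonneg (k0 y)]
        have h1 : k y ≤ 1 - y ^ 2 := by simp only [k]; nlinarith
        have := mul_le_mul (k1k x hx2 hx1) h1 (k0 y) (by positivity)
        linarith)
      (by
        rw [abs_mul, abs_of_nonneg (k0 x)]
        have h1 : k x ≤ 1 - x ^ 2 := by simp only [k]; nlinarith
        have := mul_le_mul h1 (k1k y hy2 hy1) (abs_nonneg _) hx2
        linarith)
    refine A.trans (le_of_eq ?_)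
    simp only [hφ1, hφ2, hφ3, hφ4, hφ5, hφ6]
    ring
  have low : II (1 / 2) (fun X => e X.1 * e X.2 * f X) ≤ II 1 (fun X => e X.1 * e X.2 * f X) := by
    apply II_mono_r (by fun_prop) _ (by norm_num) (by norm_num)
    intro X
    simp only [e, f]; positivity
  have low2 : II (1 / 2) f ≤ II (1 / 2) (fun X => 10 * (e X.1 * e X.2 * f X)) := by
    apply II_mono cf (by fun_prop) (by norm_num)
    intro x hx y hy
    have hf : 0 ≤ f (x, y) := by simp only [f]; positivity
    have l : ∀ t ∈ Icc (-(1/2) : ℝ) (1/2), 81 / 256 ≤ e t := by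
      intro t ht
      have : 3 / 4 ≤ 1 - t ^ 2 := by nlinarith [ht.1, ht.2]
      have := pow_le_pow_left₀ (by norm_num) this 4
      simp only [e]
      refine le_trans ?_ this
      norm_num
    have := mul_le_mul (l x hx) (l y hy) (by norm_num) (by linarith [l x hx])
    nlinarith
  rw [II_mul] at low2
  have : 10 * (4 * (256 * K * (16 + 128 * K))) ≤ 2000000 * K ^ 2 := by nlinarith
  linarith

end PW

namespace PW
open Filter MeasureTheory
open scoped Topology

lemma cs1 {g : ℝ → ℝ} (hg : Continuous g) {s : ℝ} (hs : 0 < s) :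
    (∫ y in -s..s, g y) ^ 2 ≤ 2 * s * ∫ y in -s..s, g y ^ 2 := by
  set H := ∫ y in -s..s, g y with hH
  set m := H / (2 * s) with hm
  have h0 : 0 ≤ ∫ y in -s..s, (g y - m) ^ 2 :=
    intervalIntegral.integral_nonneg (by linarith) fun y _ => sq_nonneg _
  have e : ∫ y in -s..s, (g y - m) ^ 2 = (∫ y in -s..s, g y ^ 2) - 2 * m * H + 2 * s * m ^ 2 := by
    have : ∀ y, (g y - m) ^ 2 = (g y ^ 2 - 2 * m * g y) + m ^ 2 := fun y => by ring
    simp_rw [this]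
    rw [intervalIntegral.integral_add, intervalIntegral.integral_sub,
      intervalIntegral.integral_const_mul]
    · simp; ring
    all_goals apply Continuous.intervalIntegrable; fun_prop
  rw [e] at h0
  have hmH : 2 * s * m = H := by rw [hm]; field_simp
  have := mul_nonneg (by linarith : 0 ≤ 2 * s) h0
  nlinarith

lemma abs_sub_le_int {p p' h : ℝ → ℝ} (hp : ∀ x, HasDerivAt p (p' x) x) (cp : Continuous p')
    (ch : Continuous h) (hh : ∀ x, |p' x| ≤ h x) {s x y : ℝ} (hx : x ∈ Icc (-s) s)
    (hy : y ∈ Icc (-s) s) : |p x - p y| ≤ ∫ t in -s..s, h t := by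
  wlog hxy : y ≤ x generalizing x y
  · rw [abs_sub_comm]; exact this hy hx (by linarith)
  have e := intervalIntegral.integral_eq_sub_of_hasDerivAt (a := y) (b := x)
    (fun x _ => hp x) (cp.intervalIntegrable _ _)
  rw [← e]
  calc |∫ t in y..x, p' t| ≤ ∫ t in y..x, |p' t| :=
        intervalIntegral.abs_integral_le_integral_abs hxy
    _ ≤ ∫ t in y..x, h t := intervalIntegral.integral_mono_on hxy
        (cp.abs.intervalIntegrable _ _) (ch.intervalIntegrable _ _) fun t _ => hh t
    _ ≤ _ := intervalIntegral.integral_mono_interval hy.1 hxy hx.2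
        (Eventually.of_forall fun t => (abs_nonneg _).trans (hh t)) (ch.intervalIntegrable _ _)

lemma abs_int_mul_le {u v h : ℝ → ℝ} (cu : Continuous u) (cv : Continuous v) (ch : Continuous h)
    {s M : ℝ} (hs : 0 ≤ s) (hu : ∀ x ∈ Icc (-s) s, |u x| ≤ M) (hv : ∀ x, |v x| ≤ h x) :
    |∫ t in -s..s, u t * v t| ≤ M * ∫ t in -s..s, h t := by
  calc |∫ t in -s..s, u t * v t| ≤ ∫ t in -s..s, |u t * v t| :=
        intervalIntegral.abs_integral_le_integral_abs (by linarith)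
    _ ≤ ∫ t in -s..s, M * h t := by
        apply intervalIntegral.integral_mono_on (by linarith)
          ((cu.mul cv).abs.intervalIntegrable _ _) ((continuous_const.mul ch).intervalIntegrable _ _)
        intro t ht
        show |u t * v t| ≤ M * h t
        rw [abs_mul]
        exact mul_le_mul (hu t ht) (hv t) (abs_nonneg _) ((abs_nonneg _).trans (hu t ht))
    _ = _ := by rw [intervalIntegral.integral_const_mul]

lemma bdry {w p q a b c : ℝ × ℝ → ℝ} (J : J2 w p q a b c) {K s : ℝ} (hK : 1 ≤ K) (hs : 0 < s)
    (hsk : ∀ x ∈ Icc (-s) s, ∀ y ∈ Icc (-s) s, SK K (a (x, y)) (b (x, y)) (c (x, y))) :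
    II s (fun X => a X ^ 2 + 2 * b X ^ 2 + c X ^ 2) ≤ 24 * K * s *
      ∫ y in -s..s, ((fun X => a X ^ 2 + 2 * b X ^ 2 + c X ^ 2) (s, y) +
        (fun X => a X ^ 2 + 2 * b X ^ 2 + c X ^ 2) (-s, y) +
        (fun X => a X ^ 2 + 2 * b X ^ 2 + c X ^ 2) (y, s) +
        (fun X => a X ^ 2 + 2 * b X ^ 2 + c X ^ 2) (y, -s)) := by
  have ca := J.p.c1; have cb := J.p.c2; have cc := J.q.c2
  have cp := J.p.cont; have cq := J.q.cont
  let h : ℝ × ℝ → ℝ := fun X => |a X| + |b X| + |c X|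
  have ch : Continuous h := by fun_prop
  have ha : ∀ X, |a X| ≤ h X := fun X => by
    simp only [h]; linarith [abs_nonneg (b X), abs_nonneg (c X)]
  have hb : ∀ X, |b X| ≤ h X := fun X => by
    simp only [h]; linarith [abs_nonneg (a X), abs_nonneg (c X)]
  have hc : ∀ X, |c X| ≤ h X := fun X => by
    simp only [h]; linarith [abs_nonneg (b X), abs_nonneg (a X)]
  have h0 : ∀ X, 0 ≤ h X := fun X => (abs_nonneg _).trans (ha X)
  set p0 := p (s, s) with hp0
  let R := ∫ y in -s..s, h (s, y)
  let L := ∫ y in -s..s, h (-s, y)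
  let T := ∫ x in -s..s, h (x, s)
  let B := ∫ x in -s..s, h (x, -s)
  have R0 : 0 ≤ R := intervalIntegral.integral_nonneg (by linarith) fun y _ => h0 _
  have L0 : 0 ≤ L := intervalIntegral.integral_nonneg (by linarith) fun y _ => h0 _
  have T0 : 0 ≤ T := intervalIntegral.integral_nonneg (by linarith) fun y _ => h0 _
  have B0 : 0 ≤ B := intervalIntegral.integral_nonneg (by linarith) fun y _ => h0 _
  have ms : s ∈ Icc (-s) s := ⟨by linarith, le_rfl⟩
  have ms' : -s ∈ Icc (-s) s := ⟨le_rfl, by linarith⟩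
  have vy : ∀ k : ℝ, ∀ x ∈ Icc (-s) s, ∀ y ∈ Icc (-s) s, |p (k, x) - p (k, y)| ≤ ∫ t in -s..s, h (k, t) :=
    fun k x hx y hy => abs_sub_le_int (fun t => hasDerivAt_y (J.p.h (k, t))) (cont_x cb k)
      (cont_x ch k) (fun t => hb _) hx hy
  have vx : ∀ k : ℝ, ∀ x ∈ Icc (-s) s, ∀ y ∈ Icc (-s) s, |p (x, k) - p (y, k)| ≤ ∫ t in -s..s, h (t, k) :=
    fun k x hx y hy => abs_sub_le_int (fun t => hasDerivAt_x (J.p.h (t, k))) (cont_y ca k)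
      (cont_y ch k) (fun t => ha _) hx hy
  set H := R + L + T + B with hH
  have bR : ∀ y ∈ Icc (-s) s, |p (s, y) - p0| ≤ H := fun y hy => by
    have := vy s y hy s ms
    simp only [hH, hp0]; linarith
  have bT : ∀ y ∈ Icc (-s) s, |p (y, s) - p0| ≤ H := fun y hy => by
    have := vx s y hy s ms
    simp only [hH, hp0]; linarith
  have bL : ∀ y ∈ Icc (-s) s, |p (-s, y) - p0| ≤ H := fun y hy => by
    have h1 := vy (-s) y hy s ms
    have h2 := vx s (-s) ms' s ms
    have := abs_sub_le (p (-s, y)) (p (-s, s)) p0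
    simp only [hH, hp0] at *; linarith
  have bB : ∀ y ∈ Icc (-s) s, |p (y, -s) - p0| ≤ H := fun y hy => by
    have h1 := vx (-s) y hy s ms
    have h2 := vy s (-s) ms' s ms
    have := abs_sub_le (p (y, -s)) (p (s, -s)) p0
    simp only [hH, hp0] at *; linarith
  have jac := jacobian (J.p.sub_const p0) J.q hs.le
  have c1 : Continuous fun y => p (s, y) - p0 := by fun_prop
  have c2 : Continuous fun y => p (-s, y) - p0 := by fun_prop
  have c3 : Continuous fun y => p (y, s) - p0 := by fun_prop
  have c4 : Continuous fun y => p (y, -s) - p0 := by fun_prop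
  have e1 := abs_int_mul_le c1 (cont_x cc s) (cont_x ch s) hs.le bR (fun y => hc _)
  have e2 := abs_int_mul_le c2 (cont_x cc (-s)) (cont_x ch (-s)) hs.le bL (fun y => hc _)
  have e3 := abs_int_mul_le c3 (cont_y cb s) (cont_y ch s) hs.le bT (fun y => hb _)
  have e4 := abs_int_mul_le c4 (cont_y cb (-s)) (cont_y ch (-s)) hs.le bB (fun y => hb _)
  rw [intervalIntegral.integral_sub (by apply Continuous.intervalIntegrable; fun_prop)
    (by apply Continuous.intervalIntegrable; fun_prop), intervalIntegral.integral_sub (by apply Continuous.intervalIntegrable; fun_prop)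
    (by apply Continuous.intervalIntegrable; fun_prop)] at jac
  have E1 : -II s (fun X => a X * c X - b X * b X) ≤ H * H := by
    rw [jac]
    have := abs_le.1 e1
    have := abs_le.1 e2
    have := abs_le.1 e3
    have := abs_le.1 e4
    have : H * H = H * R + H * L + H * T + H * B := by rw [hH]; ring
    linarith
  have E2 : II s (fun X => a X ^ 2 + 2 * b X ^ 2 + c X ^ 2) ≤ K * (H * H) := by
    calc _ ≤ II s (fun X => (-K) * (a X * c X - b X * b X)) := by
          apply II_mono (by fun_prop) (by fun_prop) hs.le
          intro x hx y hy
          have := hsk x hx y hy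
          unfold SK at this
          linarith
      _ = K * -II s (fun X => a X * c X - b X * b X) := by rw [II_mul]; ring
      _ ≤ _ := by gcongr
  refine E2.trans ?_
  have Hg : H = ∫ y in -s..s, (h (s, y) + h (-s, y) + h (y, s) + h (y, -s)) := by
    rw [intervalIntegral.integral_add, intervalIntegral.integral_add, intervalIntegral.integral_add]
    all_goals apply Continuous.intervalIntegrable; fun_prop
  have cs := cs1 (g := fun y => (h (s, y) + h (-s, y) + h (y, s) + h (y, -s))) (by fun_prop) hs
  rw [← Hg] at cs
  have fin : ∫ y in -s..s, (h (s, y) + h (-s, y) + h (y, s) + h (y, -s)) ^ 2 ≤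
    ∫ y in -s..s, 12 * ((fun X => a X ^ 2 + 2 * b X ^ 2 + c X ^ 2) (s, y) +
        (fun X => a X ^ 2 + 2 * b X ^ 2 + c X ^ 2) (-s, y) +
        (fun X => a X ^ 2 + 2 * b X ^ 2 + c X ^ 2) (y, s) +
        (fun X => a X ^ 2 + 2 * b X ^ 2 + c X ^ 2) (y, -s)) := by
    apply intervalIntegral.integral_mono_on (by linarith)
      (by apply Continuous.intervalIntegrable; fun_prop) (by apply Continuous.intervalIntegrable; fun_prop)
    intro y _
    have h3 : ∀ X, h X ^ 2 ≤ 3 * (a X ^ 2 + 2 * b X ^ 2 + c X ^ 2) := by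
      intro X
      have e1 := sq_abs (a X)
      have e2 := sq_abs (b X)
      have e3 := sq_abs (c X)
      have d1 := sq_nonneg (|a X| - |b X|)
      have d2 := sq_nonneg (|a X| - |c X|)
      have d3 := sq_nonneg (|b X| - |c X|)
      have d4 := sq_nonneg (b X)
      simp only [h]
      linarith
    have q4 : ∀ x y z t : ℝ, (x + y + z + t) ^ 2 ≤ 4 * (x ^ 2 + y ^ 2 + z ^ 2 + t ^ 2) := by
      intro x y z t
      linarith [sq_nonneg (x - y), sq_nonneg (x - z), sq_nonneg (x - t), sq_nonneg (y - z), sq_nonneg (y - t), sq_nonneg (z - t)]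
    have := q4 (h (s, y)) (h (-s, y)) (h (y, s)) (h (y, -s))
    have := h3 (s, y)
    have := h3 (-s, y)
    have := h3 (y, s)
    have := h3 (y, -s)
    linarith
  rw [intervalIntegral.integral_const_mul] at fin
  have := mul_le_mul_of_nonneg_left (cs.trans (mul_le_mul_of_nonneg_left fin (by linarith : 0 ≤ 2 * s))) (by linarith : 0 ≤ K)
  linarith

/-- two-strip integration -/
lemma strip {g : ℝ → ℝ} (hg : Continuous g) (r R : ℝ) :
    ∫ s in r..R, (g s + g (-s)) = (∫ x in -R..R, g x) - ∫ x in -r..r, g x := by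
  have ii : ∀ a b, IntervalIntegrable g volume a b := fun a b => hg.intervalIntegrable _ _
  rw [intervalIntegral.integral_add (ii _ _) (by apply Continuous.intervalIntegrable; fun_prop),
    intervalIntegral.integral_comp_neg]
  have h1 := intervalIntegral.integral_add_adjacent_intervals (ii (-R) (-r)) (ii (-r) r)
  have h2 := intervalIntegral.integral_add_adjacent_intervals (ii (-R) r) (ii r R)
  linarith

lemma decay1 {f : ℝ × ℝ → ℝ} (cf : Continuous f) (f0 : ∀ X, 0 ≤ f X) {K r : ℝ} (hK : 1 ≤ K) (hr : 0 < r)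
    (hb : ∀ s ∈ Icc r (2 * r), II s f ≤ 24 * K * s * ∫ y in -s..s, (f (s, y) + f (-s, y) + f (y, s) + f (y, -s))) :
    II r f ≤ 96 * K * (II (2 * r) f - II r f) := by
  let F1 : ℝ → ℝ := fun x => ∫ y in -(2 * r)..(2 * r), f (x, y)
  let F2 : ℝ → ℝ := fun y => ∫ x in -(2 * r)..(2 * r), f (x, y)
  have c1 : Continuous F1 := cont_inner cf _ _
  have c2 : Continuous F2 := cont_inner (f := fun X => f (X.2, X.1)) (by fun_prop) _ _
  have key : ∀ s ∈ Icc r (2 * r), II r f ≤ 48 * K * r * ((F1 s + F1 (-s)) + (F2 s + F2 (-s))) := by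
    intro s hs
    have h1 : II r f ≤ II s f := II_mono_r cf f0 hr.le hs.1
    have h2 := hb s hs
    have h3 : ∫ y in -s..s, (f (s, y) + f (-s, y) + f (y, s) + f (y, -s)) ≤
        ∫ y in -(2 * r)..(2 * r), (f (s, y) + f (-s, y) + f (y, s) + f (y, -s)) := by
      apply intervalIntegral.integral_mono_interval (by linarith [hs.2]) (by linarith [hs.1]) hs.2
      · exact Eventually.of_forall fun y => by
          have := f0 (s, y); have := f0 (-s, y); have := f0 (y, s); have := f0 (y, -s)
          simp only [Pi.zero_apply]; linarith
      · apply Continuous.intervalIntegrable; fun_prop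
    have h4 : ∫ y in -(2 * r)..(2 * r), (f (s, y) + f (-s, y) + f (y, s) + f (y, -s)) =
        (F1 s + F1 (-s)) + (F2 s + F2 (-s)) := by
      rw [intervalIntegral.integral_add, intervalIntegral.integral_add, intervalIntegral.integral_add]
      · ring
      all_goals apply Continuous.intervalIntegrable; fun_prop
    rw [h4] at h3
    have p1 : 0 ≤ (F1 s + F1 (-s)) + (F2 s + F2 (-s)) := by
      have : ∀ x, 0 ≤ F1 x := fun x => intervalIntegral.integral_nonneg (by linarith) fun y _ => f0 _
      have h6 : ∀ x, 0 ≤ F2 x := fun x => intervalIntegral.integral_nonneg (by linarith) fun y _ => f0 _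
      linarith [this s, this (-s), h6 s, h6 (-s)]
    have hs0 : 0 < s := lt_of_lt_of_le hr hs.1
    calc II r f ≤ 24 * K * s * ((F1 s + F1 (-s)) + (F2 s + F2 (-s))) := by
          refine h1.trans (h2.trans ?_); gcongr
      _ ≤ 24 * K * (2 * r) * ((F1 s + F1 (-s)) + (F2 s + F2 (-s))) := by
          gcongr; exact hs.2
      _ = _ := by ring
  have int : r * II r f ≤ 48 * K * r * ((II (2 * r) f - ∫ x in -r..r, F1 x) +
      (II (2 * r) f - ∫ x in -r..r, F2 x)) := by
    have h := intervalIntegral.integral_mono_on (a := r) (b := 2 * r) (by linarith) (μ := volume)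
      (f := fun _ => II r f) (g := fun s => 48 * K * r * ((F1 s + F1 (-s)) + (F2 s + F2 (-s))))
      (by simp) (by apply Continuous.intervalIntegrable; fun_prop) key
    rw [intervalIntegral.integral_const_mul, intervalIntegral.integral_add, strip c1, strip c2] at h
    · have e1 : ∫ x in -(2 * r)..(2 * r), F1 x = II (2 * r) f := rfl
      have e2 : ∫ x in -(2 * r)..(2 * r), F2 x = II (2 * r) f :=
        (II_swap cf (by linarith : 0 ≤ 2 * r)).symm
      rw [e1, e2] at h
      simp only [intervalIntegral.integral_const, smul_eq_mul] at h
      calc _ = (2 * r - r) * II r f := by ring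
        _ ≤ _ := h
    all_goals apply Continuous.intervalIntegrable; fun_prop
  have l1 : II r f ≤ ∫ x in -r..r, F1 x := by
    apply intervalIntegral.integral_mono_on (by linarith)
      ((cont_inner cf _ _).intervalIntegrable _ _) (c1.intervalIntegrable _ _)
    intro x _
    apply intervalIntegral.integral_mono_interval (by linarith) (by linarith) (by linarith)
    · exact Eventually.of_forall fun y => f0 _
    · exact (cont_x cf x).intervalIntegrable _ _
  have l2 : II r f ≤ ∫ x in -r..r, F2 x := by
    rw [II_swap cf hr.le]
    apply intervalIntegral.integral_mono_on (by linarith)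
      ((cont_inner (f := fun X => f (X.2, X.1)) (by fun_prop) _ _).intervalIntegrable _ _) (c2.intervalIntegrable _ _)
    intro x _
    apply intervalIntegral.integral_mono_interval (by linarith) (by linarith) (by linarith)
    · exact Eventually.of_forall fun y => f0 _
    · exact (cont_y cf x).intervalIntegrable _ _
  have : r * II r f ≤ r * (96 * K * (II (2 * r) f - II r f)) := by
    refine int.trans ?_
    have : 0 ≤ 48 * K * r := by positivity
    nlinarith
  exact le_of_mul_le_mul_left this hr

/-- geometric decay to power decay -/
lemma decay2 {E : ℝ → ℝ} (h0 : ∀ r, 0 ≤ r → 0 ≤ E r) (hm : ∀ r s, 0 ≤ r → r ≤ s → E r ≤ E s) {γ M : ℝ}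
    (hM : E (1 / 2) ≤ M) (hγ : 0 < γ)
    (hd : ∀ r, 0 < r → r ≤ 1 / 4 → E r ≤ (2 : ℝ) ^ (-γ) * E (2 * r)) :
    ∀ r, 0 < r → r ≤ 1 / 2 → E r ≤ (4 : ℝ) ^ γ * M * r ^ γ := by
  have hM0 : 0 ≤ M := (h0 _ (by norm_num)).trans hM
  have step : ∀ n : ℕ, ∀ r, 0 < r → r ≤ 1 / 2 → (1 / 4) ≤ 2 ^ n * r → E r ≤ (4 : ℝ) ^ γ * M * r ^ γ := by
    intro n
    induction n with
    | zero =>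
      intro r hr hr2 h
      have h1 : 1 ≤ (4 * r) ^ γ := Real.one_le_rpow (by linarith) hγ.le
      rw [Real.mul_rpow (by norm_num) hr.le] at h1
      calc E r ≤ M := (hm r _ hr.le hr2).trans hM
        _ = M * 1 := by ring
        _ ≤ M * (4 ^ γ * r ^ γ) := by gcongr
        _ = _ := by ring
    | succ n ih =>
      intro r hr hr2 h
      by_cases h4 : r ≤ 1 / 4
      · have := ih (2 * r) (by linarith) (by linarith) (by rw [pow_succ] at h; linarith)
        calc E r ≤ (2 : ℝ) ^ (-γ) * E (2 * r) := hd r hr h4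
          _ ≤ (2 : ℝ) ^ (-γ) * ((4 : ℝ) ^ γ * M * (2 * r) ^ γ) := by gcongr
          _ = _ := by
            rw [Real.mul_rpow (by norm_num) hr.le, Real.rpow_neg (by norm_num)]
            have : (2 : ℝ) ^ γ ≠ 0 := by positivity
            field_simp
      · have h1 : 1 ≤ (4 * r) ^ γ := Real.one_le_rpow (by linarith) hγ.le
        rw [Real.mul_rpow (by norm_num) hr.le] at h1
        calc E r ≤ M := (hm r _ hr.le hr2).trans hM
          _ = M * 1 := by ring
          _ ≤ M * (4 ^ γ * r ^ γ) := by gcongr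
          _ = _ := by ring
  intro r hr hr2
  obtain ⟨n, hn⟩ := pow_unbounded_of_one_lt (1 / 4 / r) (by norm_num : (1 : ℝ) < 2)
  exact step n r hr hr2 (by rw [div_lt_iff₀ hr] at hn; exact hn.le)

/-- decay of the energy -/
lemma decay (K : ℝ) (hK : 1 ≤ K) : ∃ γ C : ℝ, 0 < γ ∧ γ ≤ 1 / 2 ∧ 0 < C ∧
    ∀ w p q a b c : ℝ × ℝ → ℝ, J2 w p q a b c →
    (∀ x ∈ Icc (-1 : ℝ) 1, ∀ y ∈ Icc (-1 : ℝ) 1, SK K (a (x, y)) (b (x, y)) (c (x, y))) →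
    (∀ x ∈ Icc (-1 : ℝ) 1, ∀ y ∈ Icc (-1 : ℝ) 1, |w (x, y)| ≤ 1) →
    ∀ r, 0 < r → r ≤ 1 / 2 → II r (fun X => a X ^ 2 + 2 * b X ^ 2 + c X ^ 2) ≤ C * r ^ (2 * γ) := by
  set L := Real.logb 2 (1 + 1 / (96 * K)) with hL
  have h1 : 1 < 1 + 1 / (96 * K) := by
    have : 0 < 1 / (96 * K) := by positivity
    linarith
  have L0 : 0 < L := Real.logb_pos (by norm_num) h1
  set γ := min (1 / 2) (L / 2) with hγ
  have γ0 : 0 < γ := by rw [hγ]; positivity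
  have γL : 2 * γ ≤ L := by have := min_le_right (1 / 2) (L / 2); linarith
  refine ⟨γ, 4 ^ (2 * γ) * (2000000 * K ^ 2), γ0, min_le_left _ _, by positivity, ?_⟩
  intro w p q a b c J hsk hw
  have ca := J.p.c1; have cb := J.p.c2; have cc := J.q.c2
  have cf : Continuous (fun X => a X ^ 2 + 2 * b X ^ 2 + c X ^ 2) := by fun_prop
  have f0 : ∀ X, 0 ≤ (fun X => a X ^ 2 + 2 * b X ^ 2 + c X ^ 2) X := fun X => by
    simp only; positivity
  apply decay2 (E := fun r => II r (fun X => a X ^ 2 + 2 * b X ^ 2 + c X ^ 2))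
  · intro r hr
    exact intervalIntegral.integral_nonneg (by linarith) fun x _ => inner_nonneg f0 (by linarith) x
  · intro r s hr hs
    exact II_mono_r cf f0 hr hs
  · exact energy J hK hsk hw
  · linarith
  · intro r hr hr4
    have := decay1 cf f0 hK hr (by
      intro s hs
      refine bdry J hK (hr.trans_le hs.1) ?_
      intro x hx y hy
      have := hs.2
      exact hsk x ⟨by linarith [hx.1], by linarith [hx.2]⟩ y ⟨by linarith [hy.1], by linarith [hy.2]⟩)
    have h2 : (2 : ℝ) ^ (2 * γ) ≤ 1 + 1 / (96 * K) := by
      calc (2 : ℝ) ^ (2 * γ) ≤ 2 ^ L := Real.rpow_le_rpow_of_exponent_le (by norm_num) γL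
        _ = _ := Real.rpow_logb (by norm_num) (by norm_num) (by linarith)
    have e0 : 0 ≤ II r (fun X => a X ^ 2 + 2 * b X ^ 2 + c X ^ 2) :=
      intervalIntegral.integral_nonneg (by linarith) fun x _ => inner_nonneg f0 (by linarith) x
    rw [Real.rpow_neg (by norm_num), ← div_eq_inv_mul, le_div_iff₀ (by positivity)]
    calc _ ≤ II r (fun X => a X ^ 2 + 2 * b X ^ 2 + c X ^ 2) * (1 + 1 / (96 * K)) := by gcongr
      _ ≤ _ := by
        have h5 : II r (fun X => a X ^ 2 + 2 * b X ^ 2 + c X ^ 2) / (96 * K) ≤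
          II (2 * r) (fun X => a X ^ 2 + 2 * b X ^ 2 + c X ^ 2) - II r (fun X => a X ^ 2 + 2 * b X ^ 2 + c X ^ 2) := by
          rw [div_le_iff₀ (by positivity)]; linarith
        have : II r (fun X => a X ^ 2 + 2 * b X ^ 2 + c X ^ 2) * (1 + 1 / (96 * K)) =
          II r (fun X => a X ^ 2 + 2 * b X ^ 2 + c X ^ 2) + II r (fun X => a X ^ 2 + 2 * b X ^ 2 + c X ^ 2) / (96 * K) := by ring
        linarith

end PW

namespace PW
open Filter MeasureTheory
open scoped Topology

lemma mixed {w p q a b : ℝ × ℝ → ℝ} (hw : C1 w p q) (hp : C1 p a b) {r x x' y y' : ℝ}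
    (hx : x ∈ Icc (-r) r) (hx' : x' ∈ Icc (-r) r) (hy : y ∈ Icc (-r) r) (hy' : y' ∈ Icc (-r) r) :
    |w (x, y) - w (x', y) - w (x, y') + w (x', y')| ≤ II r (fun X => |b X|) := by
  have cb := hp.c2
  have cp := hp.cont
  have := abs_sub_le_int (p := fun t => w (t, y) - w (t, y')) (p' := fun t => p (t, y) - p (t, y'))
    (h := fun t => ∫ s in -r..r, |b (t, s)|)
    (fun t => (hasDerivAt_x (hw.h (t, y))).sub (hasDerivAt_x (hw.h (t, y')))) (by fun_prop)
    (cont_inner (f := fun X => |b X|) (by fun_prop) _ _) (fun t =>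
      abs_sub_le_int (fun s => hasDerivAt_y (hp.h (t, s))) (cont_x cb t) (cont_x cb t).abs
        (fun s => le_rfl) hy hy') hx hx'
  unfold II
  refine le_trans (le_of_eq ?_) this
  congr 1; ring

lemma second_x {w p q a b : ℝ × ℝ → ℝ} (hw : C1 w p q) (hp : C1 p a b) {r x y : ℝ} (hr : 0 < r)
    (hx : x ∈ Icc (-r) r) (hy : y ∈ Icc (-r) r) :
    |w (x, y) - 2 * w (x / 2, y) + w (0, y)| ≤ 2 * II r (fun X => |b X|) + II r (fun X => |a X|) := by
  have ca := hp.c1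
  have hx2 : x / 2 ∈ Icc (-r) r := ⟨by linarith [hx.1], by linarith [hx.2]⟩
  have h0 : (0 : ℝ) ∈ Icc (-r) r := ⟨by linarith, by linarith⟩
  have caa : Continuous fun X => |a X| := by fun_prop
  set B := II r (fun X => |b X|)
  let D : ℝ → ℝ := fun y => w (x, y) - 2 * w (x / 2, y) + w (0, y)
  let Ay : ℝ → ℝ := fun y => ∫ t in -r..r, |a (t, y)|
  have cAy : Continuous Ay := cont_inner (f := fun X => |a (X.2, X.1)|) (by fun_prop) _ _
  have s1 : ∀ y', |D y'| ≤ r / 2 * Ay y' := by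
    intro y'
    have hd : ∀ t : ℝ, HasDerivAt (fun t => w (t + x / 2, y') - w (t, y')) (p (t + x / 2, y') - p (t, y')) t := by
      intro t
      exact ((hasDerivAt_x (hw.h (t + x / 2, y'))).comp_add_const t (x / 2)).sub (hasDerivAt_x (hw.h (t, y')))
    have := Convex.norm_image_sub_le_of_norm_hasDerivWithin_le (𝕜 := ℝ) (s := uIcc 0 (x / 2)) (C := Ay y') (x := 0) (y := x / 2)
      (fun t _ => (hd t).hasDerivWithinAt) (by
        intro t ht
        rw [Real.norm_eq_abs]
        have ht' : t ∈ Icc (-r) r := uIcc_subset_Icc h0 hx2 ht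
        have ht2 : t + x / 2 ∈ Icc (-r) r := by
          rcases le_total 0 (x / 2) with h | h
          · rw [uIcc_of_le h] at ht
            exact ⟨by linarith [ht'.1], by linarith [ht.2, hx.2]⟩
          · rw [uIcc_of_ge h] at ht
            exact ⟨by linarith [ht.1, hx.1], by linarith [ht'.2]⟩
        exact abs_sub_le_int (fun s => hasDerivAt_x (hp.h (s, y'))) (cont_y ca y') (cont_y ca y').abs
          (fun s => le_rfl) ht2 ht') (convex_uIcc _ _) left_mem_uIcc right_mem_uIcc
    rw [Real.norm_eq_abs, Real.norm_eq_abs] at this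
    have e : |D y'| = |w (x / 2 + x / 2, y') - w (x / 2, y') - (w (0 + x / 2, y') - w (0, y'))| := by
      simp only [D, zero_add, add_halves]; congr 1; ring
    rw [e]
    refine this.trans ?_
    have hA : 0 ≤ Ay y' := intervalIntegral.integral_nonneg (by linarith) fun _ _ => abs_nonneg _
    have : |x / 2 - 0| ≤ r / 2 := by
      rw [abs_le]; constructor <;> linarith [hx.1, hx.2]
    nlinarith
  have s2 : ∀ y' ∈ Icc (-r) r, |D y| ≤ 2 * B + r / 2 * Ay y' := by
    intro y' hy'
    have m1 := mixed hw hp hx hx2 hy hy'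
    have m2 := mixed hw hp hx2 h0 hy hy'
    have e : D y = (w (x, y) - w (x / 2, y) - w (x, y') + w (x / 2, y')) -
        (w (x / 2, y) - w (0, y) - w (x / 2, y') + w (0, y')) + D y' := by
      simp only [D]; ring
    rw [e]
    have := s1 y'
    have m1 := abs_le.1 m1
    have m2 := abs_le.1 m2
    have := abs_le.1 this
    rw [abs_le]; constructor <;> linarith
  have h := intervalIntegral.integral_mono_on (a := -r) (b := r) (by linarith) (μ := volume)
      (f := fun _ => |D y|) (g := fun y' => 2 * B + r / 2 * Ay y')
      (by simp) (by apply Continuous.intervalIntegrable; fun_prop) s2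
  rw [intervalIntegral.integral_add (by simp) (by apply Continuous.intervalIntegrable; fun_prop),
    intervalIntegral.integral_const_mul, intervalIntegral.integral_const_mul] at h
  have e : ∫ y in -r..r, Ay y = II r (fun X => |a X|) := (II_swap caa hr.le).symm
  rw [e] at h
  simp only [intervalIntegral.integral_const, smul_eq_mul] at h
  have hA : 0 ≤ II r (fun X => |a X|) :=
    intervalIntegral.integral_nonneg (by linarith) fun x _ => inner_nonneg (f := fun X => |a X|) (fun X => abs_nonneg _) (by linarith) x
  have : (2 * r) * |D y| ≤ (2 * r) * (2 * B + II r (fun X => |a X|)) := by nlinarith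
  exact le_of_mul_le_mul_left this (by linarith)

lemma C1.swap {p p1 p2 : ℝ × ℝ → ℝ} (h : C1 p p1 p2) :
    C1 (fun X => p (X.2, X.1)) (fun X => p2 (X.2, X.1)) (fun X => p1 (X.2, X.1)) := by
  have := h.c1; have := h.c2
  refine ⟨fun X => ?_, by fun_prop, by fun_prop⟩
  have h1 : HasFDerivAt (fun X : ℝ × ℝ => (X.2, X.1))
    ((ContinuousLinearMap.snd ℝ ℝ ℝ).prod (ContinuousLinearMap.fst ℝ ℝ ℝ)) X :=
    (hasFDerivAt_snd (p := X)).prodMk (hasFDerivAt_fst (p := X))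
  refine ((h.h (X.2, X.1)).comp X h1).congr_fderiv ?_
  ext <;> simp

lemma II_swap' {f : ℝ × ℝ → ℝ} (hf : Continuous f) {r : ℝ} (hr : 0 ≤ r) :
    II r (fun X => f (X.2, X.1)) = II r f := by
  rw [II_swap hf hr]; rfl

lemma II_abs_le {g f : ℝ × ℝ → ℝ} (hg : Continuous g) (hf : Continuous f) (hgf : ∀ X, g X ^ 2 ≤ f X)
    {r γ C : ℝ} (hr : 0 < r) (hE : II r f ≤ C * r ^ (2 * γ)) :
    II r (fun X => |g X|) ≤ (C + 4) * r ^ (1 + γ) := by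
  set τ := r ^ (1 - γ) with hτ
  have τ0 : 0 < τ := Real.rpow_pos_of_pos hr _
  have h1 : II r (fun X => |g X|) ≤ II r (fun X => τ * f X + 1 / τ) := by
    apply II_mono (by fun_prop) (by fun_prop) hr.le
    intro x _ y _
    have h1 := hgf (x, y)
    have h2 : |g (x, y)| ≤ τ * |g (x, y)| ^ 2 + 1 / τ := by
      rw [← sub_nonneg]
      have : τ * |g (x, y)| ^ 2 + 1 / τ - |g (x, y)| =
        ((τ * |g (x, y)| - 1 / 2) ^ 2 + 3 / 4) / τ := by field_simp; ring
      rw [this]; positivity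
    rw [sq_abs] at h2
    have := mul_le_mul_of_nonneg_left h1 τ0.le
    linarith
  rw [II_add (by fun_prop) (by fun_prop), II_mul, II_const] at h1
  have h2 : τ * (C * r ^ (2 * γ)) = C * r ^ (1 + γ) := by
    have : r ^ (1 + γ) = r ^ (1 - γ) * r ^ (2 * γ) := by rw [← Real.rpow_add hr]; congr 1; ring
    rw [this, hτ]; ring
  have h3 : r ^ 2 * (1 / τ) = r ^ (1 + γ) := by
    rw [hτ, one_div, ← Real.rpow_neg hr.le, ← Real.rpow_natCast, ← Real.rpow_add hr]; congr 1; push_cast; ring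
  have := mul_le_mul_of_nonneg_left hE τ0.le
  nlinarith

/-- doubling lemma -/
lemma doubling {φ : ℝ → ℝ} {T A γ : ℝ} (hγ : 0 < γ)
    (h : ∀ t, 0 < t → t ≤ T → |φ t - 2 * φ (t / 2)| ≤ A * t ^ (1 + γ))
    (h0 : Tendsto (fun t => φ t / t) (𝓝[>] 0) (𝓝 0)) :
    ∀ t, 0 < t → t ≤ T → |φ t| ≤ (1 / (1 - 2 ^ (-γ))) * A * t ^ (1 + γ) := by
  set θ : ℝ := 2 ^ (-γ) with hθ
  have θ1 : θ < 1 := Real.rpow_lt_one_of_one_lt_of_neg (by norm_num) (by linarith)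
  set C := 1 / (1 - θ) with hC
  have hCe : 1 + C * θ = C := by
    have : 1 - θ ≠ 0 := by linarith
    rw [hC]; field_simp; ring
  have ind : ∀ n : ℕ, ∀ t, 0 < t → t ≤ T → |φ t| ≤ C * A * t ^ (1 + γ) + 2 ^ n * |φ (t / 2 ^ n)| := by
    intro n
    induction n with
    | zero =>
      intro t ht hT
      have : 0 ≤ A * t ^ (1 + γ) := (abs_nonneg _).trans (h t ht hT)
      have hC0 : 0 ≤ C := by rw [hC]; apply div_nonneg zero_le_one; linarith
      simp; nlinarith
    | succ n ih =>
      intro t ht hT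
      have h1 := h t ht hT
      have h2 := ih (t / 2) (by linarith) (by linarith)
      have e : t / 2 / 2 ^ n = t / 2 ^ (n + 1) := by rw [pow_succ]; field_simp
      rw [e] at h2
      have h3 : (t / 2) ^ (1 + γ) = t ^ (1 + γ) * θ / 2 := by
        rw [Real.div_rpow ht.le (by norm_num), hθ, Real.rpow_add (by norm_num : (0:ℝ) < 2) 1 γ, Real.rpow_neg (by norm_num), Real.rpow_one]
        field_simp
      rw [h3] at h2
      have h4 : |φ t| ≤ |φ t - 2 * φ (t / 2)| + 2 * |φ (t / 2)| := by
        have := abs_add_le (φ t - 2 * φ (t / 2)) (2 * φ (t / 2))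
        rw [sub_add_cancel, abs_mul, abs_two] at this; exact this
      calc |φ t| ≤ A * t ^ (1 + γ) + 2 * (C * A * (t ^ (1 + γ) * θ / 2) + 2 ^ n * |φ (t / 2 ^ (n + 1))|) := by linarith
        _ = (1 + C * θ) * A * t ^ (1 + γ) + 2 ^ (n + 1) * |φ (t / 2 ^ (n + 1))| := by rw [pow_succ]; ring
        _ = _ := by rw [hCe]
  intro t ht hT
  have lim : Tendsto (fun n : ℕ => C * A * t ^ (1 + γ) + 2 ^ n * |φ (t / 2 ^ n)|) atTop (𝓝 (C * A * t ^ (1 + γ) + t * |0|)) := by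
    have l1 : Tendsto (fun n : ℕ => t / 2 ^ n) atTop (𝓝[>] 0) := by
      rw [tendsto_nhdsWithin_iff]
      refine ⟨?_, Eventually.of_forall fun n => by simp only [mem_Ioi]; positivity⟩
      have := (tendsto_pow_atTop_nhds_zero_of_lt_one (by norm_num : (0:ℝ) ≤ 1 / 2) (by norm_num)).const_mul t
      simp only [mul_zero] at this
      refine this.congr fun n => ?_
      rw [div_pow, one_pow]; ring
    have l2 := ((h0.comp l1).abs.const_mul t).const_add (C * A * t ^ (1 + γ))
    refine l2.congr fun n => ?_
    simp only [Function.comp]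
    rw [abs_div, abs_of_pos (by positivity : 0 < t / 2 ^ n)]
    field_simp
  have := ge_of_tendsto' lim (fun n => ind n t ht hT)
  simpa using this

/-- core interior theorem -/
theorem core (K : ℝ) (hK : 1 ≤ K) : ∃ γ C : ℝ, 0 < γ ∧ γ ≤ 1 / 2 ∧ 0 < C ∧
    ∀ w p q a b c : ℝ × ℝ → ℝ, J2 w p q a b c →
    (∀ x ∈ Icc (-1 : ℝ) 1, ∀ y ∈ Icc (-1 : ℝ) 1, SK K (a (x, y)) (b (x, y)) (c (x, y))) →
    (∀ x ∈ Icc (-1 : ℝ) 1, ∀ y ∈ Icc (-1 : ℝ) 1, |w (x, y)| ≤ 1) →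
    |p 0| ≤ C ∧ |q 0| ≤ C ∧
    ∀ z : ℝ × ℝ, ‖z‖ ≤ 1 / 2 → |w z - w 0 - (p 0 * z.1 + q 0 * z.2)| ≤ C * ‖z‖ ^ (1 + γ) := by
  obtain ⟨γ, C, hγ, hγ2, hC, H⟩ := decay K hK
  set A := 8 * (C + 4) with hA
  set M := (1 / (1 - (2:ℝ) ^ (-γ))) * A with hM
  have θ1 : (2:ℝ) ^ (-γ) < 1 := Real.rpow_lt_one_of_one_lt_of_neg (by norm_num) (by linarith)
  have M0 : 0 < M := by
    rw [hM]; apply mul_pos (by apply div_pos one_pos; linarith) (by positivity)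
  refine ⟨γ, 2 * M + 4, hγ, hγ2, by positivity, ?_⟩
  intro w p q a b c J hsk hw
  have ca := J.p.c1; have cb := J.p.c2; have cc := J.q.c2
  have cf : Continuous (fun X => a X ^ 2 + 2 * b X ^ 2 + c X ^ 2) := by fun_prop
  have E := H w p q a b c J hsk hw
  have sd : ∀ r, 0 < r → r ≤ 1 / 2 → ∀ x ∈ Icc (-r) r, ∀ y ∈ Icc (-r) r,
      |w (x, y) - 2 * w (x / 2, y / 2) + w (0, 0)| ≤ A * r ^ (1 + γ) := by
    intro r hr hr2 x hx y hy
    have ha := II_abs_le ca cf (fun X => by nlinarith [sq_nonneg (b X), sq_nonneg (c X)]) hr (E r hr hr2)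
    have hb := II_abs_le cb cf (fun X => by nlinarith [sq_nonneg (a X), sq_nonneg (c X), sq_nonneg (b X)]) hr (E r hr hr2)
    have hc := II_abs_le cc cf (fun X => by nlinarith [sq_nonneg (b X), sq_nonneg (a X)]) hr (E r hr hr2)
    have hx2 : x / 2 ∈ Icc (-r) r := ⟨by linarith [hx.1], by linarith [hx.2]⟩
    have hy2 : y / 2 ∈ Icc (-r) r := ⟨by linarith [hy.1], by linarith [hy.2]⟩
    have h0 : (0 : ℝ) ∈ Icc (-r) r := ⟨by linarith, by linarith⟩
    have s1 := second_x J.w J.p hr hx hy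
    have s2 := second_x J.w.swap J.q.swap hr hy h0
    rw [II_swap' (f := fun X => |b X|) (by fun_prop) hr.le, II_swap' (f := fun X => |c X|) (by fun_prop) hr.le] at s2
    have m := mixed J.w J.p hx2 h0 hy hy2
    simp only at s2
    have s1 := abs_le.1 s1
    have s2 := abs_le.1 s2
    have m := abs_le.1 m
    rw [hA, abs_le]
    constructor <;> nlinarith
  have c00 : w 0 = w (0, 0) := rfl
  have main : ∀ z : ℝ × ℝ, ‖z‖ ≤ 1 / 2 → |w z - w 0 - (p 0 * z.1 + q 0 * z.2)| ≤ M * ‖z‖ ^ (1 + γ) := by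
    intro z hz
    by_cases hz0 : z = 0
    · subst hz0; simp
      rw [Real.zero_rpow (by linarith)]; simp
    have nz : 0 < ‖z‖ := norm_pos_iff.2 hz0
    set e : ℝ × ℝ := ‖z‖⁻¹ • z with he
    have ne : ‖e‖ = 1 := by rw [he, norm_smul, norm_inv, norm_norm, inv_mul_cancel₀ nz.ne']
    have e1 : |e.1| ≤ 1 := by rw [← ne]; exact norm_fst_le e
    have e2 : |e.2| ≤ 1 := by rw [← ne]; exact norm_snd_le e
    have hze : ‖z‖ • e = z := by rw [he, smul_smul, mul_inv_cancel₀ nz.ne', one_smul]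
    let φ : ℝ → ℝ := fun t => w (t • e) - w 0 - t * (p 0 * e.1 + q 0 * e.2)
    have d := doubling (φ := φ) (T := 1 / 2) (A := A) hγ (by
      intro t ht hT
      have := sd t ht hT (t * e.1) (by rw [mem_Icc, ← abs_le, abs_mul, abs_of_pos ht]; nlinarith) (t * e.2)
        (by rw [mem_Icc, ← abs_le, abs_mul, abs_of_pos ht]; nlinarith)
      refine le_trans (le_of_eq ?_) this
      have h1 : t • e = (t * e.1, t * e.2) := rfl
      have h2 : (t / 2) • e = (t * e.1 / 2, t * e.2 / 2) := by
        ext <;> simp <;> ring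
      simp only [φ, h1, h2, c00]
      congr 1; ring) (by
      have hd : HasDerivAt φ 0 0 := by
        have h1 : HasDerivAt (fun t : ℝ => t • e) e 0 := by
          simpa using (hasDerivAt_id (0:ℝ)).smul_const e
        have h2 := HasFDerivAt.comp_hasDerivAt_of_eq (0:ℝ) (J.w.h 0) h1 (by simp)
        have h3 := (h2.sub_const (w 0)).sub ((hasDerivAt_id (0:ℝ)).mul_const (p 0 * e.1 + q 0 * e.2))
        refine h3.congr_deriv ?_
        simp
      have h4 := hd.tendsto_slope_zero_right
      have h5 : φ 0 = 0 := by simp [φ]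
      simp only [zero_add, h5, sub_zero, smul_eq_mul] at h4
      refine h4.congr fun t => ?_
      rw [div_eq_inv_mul]) ‖z‖ nz hz
    simp only [φ, hze] at d
    refine le_trans (le_of_eq ?_) d
    have h1 : z.1 = ‖z‖ * e.1 := by conv_lhs => rw [← hze]
                                    simp
    have h2 : z.2 = ‖z‖ * e.2 := by conv_lhs => rw [← hze]
                                    simp
    rw [h1, h2]; congr 1; ring
  have hw1 : ∀ z : ℝ × ℝ, ‖z‖ ≤ 1 / 2 → |w z| ≤ 1 := by
    intro z hz
    have h1 := abs_le.1 ((norm_fst_le z).trans hz)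
    have h2 := abs_le.1 ((norm_snd_le z).trans hz)
    exact hw z.1 ⟨by linarith [h1.1], by linarith [h1.2]⟩ z.2 ⟨by linarith [h2.1], by linarith [h2.2]⟩
  have gr : ∀ z : ℝ × ℝ, ‖z‖ ≤ 1 / 2 → |p 0 * z.1 + q 0 * z.2| ≤ 2 + M := by
    intro z hz
    have h1 := abs_le.1 (main z hz)
    have h2 := abs_le.1 (hw1 z hz)
    have h3 := abs_le.1 (hw1 0 (by simp))
    have h4 : ‖z‖ ^ (1 + γ) ≤ 1 := Real.rpow_le_one (norm_nonneg _) (by linarith) (by linarith)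
    have h5 : M * ‖z‖ ^ (1 + γ) ≤ M := by nlinarith
    rw [abs_le]; constructor <;> linarith
  refine ⟨?_, ?_, ?_⟩
  · have := gr (1/2, 0) (by simp [Prod.norm_def])
    simp [abs_mul] at this
    linarith
  · have := gr (0, 1/2) (by simp [Prod.norm_def])
    simp [abs_mul] at this
    linarith
  · intro z hz
    refine (main z hz).trans ?_
    gcongr; linarith

end PW

namespace PW
open Filter MeasureTheory
open scoped Topology

/-- `C²` data on an open set -/
structure JetOn (V : Set (ℝ × ℝ)) (w p q a b c : ℝ × ℝ → ℝ) : Prop where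
  w : ∀ X ∈ V, HasFDerivAt w (LL (p X) (q X)) X
  p : ∀ X ∈ V, HasFDerivAt p (LL (a X) (b X)) X
  q : ∀ X ∈ V, HasFDerivAt q (LL (b X) (c X)) X
  ca : ContinuousOn a V
  cb : ContinuousOn b V
  cc : ContinuousOn c V

lemma LL_ext {p q : ℝ} {f : ℝ × ℝ →L[ℝ] ℝ} (h1 : f (1, 0) = p) (h2 : f (0, 1) = q) : f = LL p q := by
  ext <;> simp [h1, h2]

lemma LL_inj {p q p' q' : ℝ} (h : LL p q = LL p' q') : p = p' ∧ q = q' := by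
  have h1 := DFunLike.congr_fun h (1, 0)
  have h2 := DFunLike.congr_fun h (0, 1)
  simp at h1 h2
  exact ⟨h1, h2⟩

lemma JetOn.mono {V V' : Set (ℝ × ℝ)} {w p q a b c : ℝ × ℝ → ℝ} (h : JetOn V w p q a b c)
    (hV : V' ⊆ V) : JetOn V' w p q a b c :=
  ⟨fun X hX => h.w X (hV hX), fun X hX => h.p X (hV hX), fun X hX => h.q X (hV hX),
    h.ca.mono hV, h.cb.mono hV, h.cc.mono hV⟩

lemma JetOn.contw {V : Set (ℝ × ℝ)} {w p q a b c : ℝ × ℝ → ℝ} (h : JetOn V w p q a b c) :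
    ContinuousOn w V := fun X hX => (h.w X hX).continuousAt.continuousWithinAt

lemma JetOn.lin {V : Set (ℝ × ℝ)} {w p q a b c w' p' q' a' b' c' : ℝ × ℝ → ℝ}
    (h : JetOn V w p q a b c) (h' : JetOn V w' p' q' a' b' c') (s t : ℝ) :
    JetOn V (fun X => s * w X + t * w' X) (fun X => s * p X + t * p' X) (fun X => s * q X + t * q' X)
      (fun X => s * a X + t * a' X) (fun X => s * b X + t * b' X) (fun X => s * c X + t * c' X) := by
  have key : ∀ {w w' : ℝ × ℝ → ℝ} {p q p' q' : ℝ} {X : ℝ × ℝ}, HasFDerivAt w (LL p q) X →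
      HasFDerivAt w' (LL p' q') X → HasFDerivAt (fun X => s * w X + t * w' X) (LL (s * p + t * p') (s * q + t * q')) X := by
    intro w w' p q p' q' X h1 h2
    refine ((h1.const_mul s).add (h2.const_mul t)).congr_fderiv ?_
    apply LL_ext <;> simp
  have := h.ca; have := h.cb; have := h.cc; have := h'.ca; have := h'.cb; have := h'.cc
  exact ⟨fun X hX => key (h.w X hX) (h'.w X hX), fun X hX => key (h.p X hX) (h'.p X hX),
    fun X hX => key (h.q X hX) (h'.q X hX), by fun_prop, by fun_prop, by fun_prop⟩

/-- composition with an affine map -/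
def aff (e f m11 m12 m21 m22 : ℝ) (z : ℝ × ℝ) : ℝ × ℝ :=
  (e + m11 * z.1 + m12 * z.2, f + m21 * z.1 + m22 * z.2)

lemma aff_cont (e f m11 m12 m21 m22 : ℝ) : Continuous (aff e f m11 m12 m21 m22) := by
  unfold aff; fun_prop

lemma hasFDerivAt_aff (e f m11 m12 m21 m22 : ℝ) {w : ℝ × ℝ → ℝ} {p q : ℝ} {z : ℝ × ℝ}
    (h : HasFDerivAt w (LL p q) (aff e f m11 m12 m21 m22 z)) :
    HasFDerivAt (fun z => w (aff e f m11 m12 m21 m22 z)) (LL (m11 * p + m21 * q) (m12 * p + m22 * q)) z := by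
  have h1 : HasFDerivAt (aff e f m11 m12 m21 m22) ((LL m11 m12).prod (LL m21 m22)) z := by
    have a1 : HasFDerivAt (fun z : ℝ × ℝ => e + m11 * z.1 + m12 * z.2) (LL m11 m12) z := by
      have := (((hasFDerivAt_fst (𝕜 := ℝ) (p := z)).const_mul m11).const_add e).add ((hasFDerivAt_snd (𝕜 := ℝ) (p := z)).const_mul m12)
      exact this
    have a2 : HasFDerivAt (fun z : ℝ × ℝ => f + m21 * z.1 + m22 * z.2) (LL m21 m22) z := by
      have := (((hasFDerivAt_fst (𝕜 := ℝ) (p := z)).const_mul m21).const_add f).add ((hasFDerivAt_snd (𝕜 := ℝ) (p := z)).const_mul m22)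
      exact this
    exact a1.prodMk a2
  refine (h.comp z h1).congr_fderiv ?_
  apply LL_ext <;> simp <;> ring

lemma JetOn.aff {V : Set (ℝ × ℝ)} {w p q a b c : ℝ × ℝ → ℝ} (h : JetOn V w p q a b c)
    (e f m11 m12 m21 m22 : ℝ) :
    JetOn (PW.aff e f m11 m12 m21 m22 ⁻¹' V) (fun z => w (PW.aff e f m11 m12 m21 m22 z))
      (fun z => m11 * p (PW.aff e f m11 m12 m21 m22 z) + m21 * q (PW.aff e f m11 m12 m21 m22 z))
      (fun z => m12 * p (PW.aff e f m11 m12 m21 m22 z) + m22 * q (PW.aff e f m11 m12 m21 m22 z))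
      (fun z => m11 ^ 2 * a (PW.aff e f m11 m12 m21 m22 z) + 2 * m11 * m21 * b (PW.aff e f m11 m12 m21 m22 z)
        + m21 ^ 2 * c (PW.aff e f m11 m12 m21 m22 z))
      (fun z => m11 * m12 * a (PW.aff e f m11 m12 m21 m22 z) + (m11 * m22 + m12 * m21) * b (PW.aff e f m11 m12 m21 m22 z)
        + m21 * m22 * c (PW.aff e f m11 m12 m21 m22 z))
      (fun z => m12 ^ 2 * a (PW.aff e f m11 m12 m21 m22 z) + 2 * m12 * m22 * b (PW.aff e f m11 m12 m21 m22 z)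
        + m22 ^ 2 * c (PW.aff e f m11 m12 m21 m22 z)) := by
  have ca := h.ca.comp (aff_cont e f m11 m12 m21 m22).continuousOn (mapsTo_preimage _ V)
  have cb := h.cb.comp (aff_cont e f m11 m12 m21 m22).continuousOn (mapsTo_preimage _ V)
  have cc := h.cc.comp (aff_cont e f m11 m12 m21 m22).continuousOn (mapsTo_preimage _ V)
  simp only [Function.comp_def] at ca cb cc
  refine ⟨fun X hX => hasFDerivAt_aff _ _ _ _ _ _ (h.w _ hX), fun X hX => ?_, fun X hX => ?_,
    ((continuousOn_const.mul ca).add (continuousOn_const.mul cb)).add (continuousOn_const.mul cc),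
    ((continuousOn_const.mul ca).add (continuousOn_const.mul cb)).add (continuousOn_const.mul cc),
    ((continuousOn_const.mul ca).add (continuousOn_const.mul cb)).add (continuousOn_const.mul cc)⟩
  · have h1 := (hasFDerivAt_aff _ _ _ _ _ _ (h.p _ hX)).const_mul m11
    have h2 := (hasFDerivAt_aff _ _ _ _ _ _ (h.q _ hX)).const_mul m21
    refine (h1.add h2).congr_fderiv ?_
    apply LL_ext <;> simp <;> ring
  · have h1 := (hasFDerivAt_aff _ _ _ _ _ _ (h.p _ hX)).const_mul m12
    have h2 := (hasFDerivAt_aff _ _ _ _ _ _ (h.q _ hX)).const_mul m22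
    refine (h1.add h2).congr_fderiv ?_
    apply LL_ext <;> simp <;> ring

/-- quadratic polynomials -/
lemma JetOn.quad (V : Set (ℝ × ℝ)) (k p q a b c : ℝ) :
    JetOn V (fun X => k + p * X.1 + q * X.2 + (a * X.1 ^ 2 / 2 + b * X.1 * X.2 + c * X.2 ^ 2 / 2))
      (fun X => p + a * X.1 + b * X.2) (fun X => q + b * X.1 + c * X.2)
      (fun _ => a) (fun _ => b) (fun _ => c) := by
  have f1 : ∀ X : ℝ × ℝ, HasFDerivAt (fun X : ℝ × ℝ => X.1) (LL 1 0) X := fun X =>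
    (hasFDerivAt_fst (𝕜 := ℝ) (p := X)).congr_fderiv (by apply LL_ext <;> simp)
  have f2 : ∀ X : ℝ × ℝ, HasFDerivAt (fun X : ℝ × ℝ => X.2) (LL 0 1) X := fun X =>
    (hasFDerivAt_snd (𝕜 := ℝ) (p := X)).congr_fderiv (by apply LL_ext <;> simp)
  refine ⟨fun X _ => ?_, fun X _ => ?_, fun X _ => ?_, continuousOn_const, continuousOn_const, continuousOn_const⟩
  · have h1 := ((((f1 X).pow 2).const_mul a).mul_const (1/2 : ℝ)).add (((f1 X).mul (f2 X)).const_mul b)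
    have h2 := h1.add ((((f2 X).pow 2).const_mul c).mul_const (1/2 : ℝ))
    have h3 := ((((f1 X).const_mul p).const_add k).add ((f2 X).const_mul q)).add h2
    refine (h3.congr_fderiv ?_).congr_of_eventuallyEq (Eventually.of_forall fun Y => ?_)
    · apply LL_ext <;> simp <;> ring
    · simp; ring
  · refine ((((f1 X).const_mul a).const_add p).add ((f2 X).const_mul b)).congr_fderiv ?_
    apply LL_ext <;> simp
  · refine ((((f1 X).const_mul b).const_add q).add ((f2 X).const_mul c)).congr_fderiv ?_
    apply LL_ext <;> simp

lemma JetOn.contDiffOn {V : Set (ℝ × ℝ)} (hV : IsOpen V) {w p q a b c : ℝ × ℝ → ℝ}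
    (h : JetOn V w p q a b c) : ContDiffOn ℝ 2 w V := by
  have lem : ∀ {n : ℕ} {w p q : ℝ × ℝ → ℝ}, (∀ X ∈ V, HasFDerivAt w (LL (p X) (q X)) X) →
      ContDiffOn ℝ n p V → ContDiffOn ℝ n q V → ContDiffOn ℝ (n + 1) w V := by
    intro n w p q hw hp hq
    rw [contDiffOn_succ_iff_fderiv_of_isOpen hV]
    refine ⟨fun X hX => (hw X hX).differentiableAt.differentiableWithinAt, by simp, ?_⟩
    have : ContDiffOn ℝ n (fun X => LL (p X) (q X)) V := by
      unfold LL
      exact (hp.smul contDiffOn_const).add (hq.smul contDiffOn_const)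
    exact this.congr fun X hX => (hw X hX).fderiv
  have hp := lem (n := 0) h.p (by simpa using h.ca) (by simpa using h.cb)
  have hq := lem (n := 0) h.q (by simpa using h.cb) (by simpa using h.cc)
  have := lem (n := 1) h.w (by simpa using hp) (by simpa using hq)
  norm_num at this
  exact this

def P1 (w : ℝ × ℝ → ℝ) (X : ℝ × ℝ) : ℝ := fderiv ℝ w X (1, 0)
def P2 (w : ℝ × ℝ → ℝ) (X : ℝ × ℝ) : ℝ := fderiv ℝ w X (0, 1)

lemma JetOn.of_contDiffOn {V : Set (ℝ × ℝ)} (hV : IsOpen V) {w : ℝ × ℝ → ℝ}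
    (h : ContDiffOn ℝ 2 w V) : JetOn V w (P1 w) (P2 w) (P1 (P1 w)) (P2 (P1 w)) (P2 (P2 w)) := by
  have h' : ContDiffOn ℝ (1 + 1) w V := by norm_num; exact h
  rw [contDiffOn_succ_iff_fderiv_of_isOpen hV] at h'
  obtain ⟨h1, -, h2⟩ := h'
  have hp : ContDiffOn ℝ (0 + 1) (P1 w) V := by
    norm_num; exact h2.clm_apply contDiffOn_const
  have hq : ContDiffOn ℝ (0 + 1) (P2 w) V := by
    norm_num; exact h2.clm_apply contDiffOn_const
  rw [contDiffOn_succ_iff_fderiv_of_isOpen hV] at hp hq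
  have sym : ∀ X ∈ V, P1 (P2 w) X = P2 (P1 w) X := by
    intro X hX
    have hs : IsSymmSndFDerivAt ℝ w X := (h.contDiffAt (hV.mem_nhds hX)).isSymmSndFDerivAt (by simp)
    have hd : DifferentiableAt ℝ (fderiv ℝ w) X := (h2.differentiableOn (by norm_num)).differentiableAt (hV.mem_nhds hX)
    have e1 : P1 (P2 w) X = fderiv ℝ (fderiv ℝ w) X (1, 0) (0, 1) := by
      unfold P1 P2
      rw [fderiv_clm_apply hd (differentiableAt_const _)]; simp
    have e2 : P2 (P1 w) X = fderiv ℝ (fderiv ℝ w) X (0, 1) (1, 0) := by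
      unfold P1 P2
      rw [fderiv_clm_apply hd (differentiableAt_const _)]; simp
    rw [e1, e2]
    exact hs.eq _ _
  have mk : ∀ {f : ℝ × ℝ → ℝ}, DifferentiableOn ℝ f V → ∀ X ∈ V, HasFDerivAt f (LL (P1 f X) (P2 f X)) X := by
    intro f hf X hX
    exact (hf.differentiableAt (hV.mem_nhds hX)).hasFDerivAt.congr_fderiv (LL_ext rfl rfl)
  refine ⟨mk h1, mk hp.1, fun X hX => ?_, ?_, ?_, ?_⟩
  · have := mk hq.1 X hX
    rwa [sym X hX] at this
  · exact hp.2.2.continuousOn.clm_apply continuousOn_const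
  · exact hp.2.2.continuousOn.clm_apply continuousOn_const
  · exact hq.2.2.continuousOn.clm_apply continuousOn_const

lemma JetOn.unique {V : Set (ℝ × ℝ)} (hV : IsOpen V) {w p q a b c w' p' q' a' b' c' : ℝ × ℝ → ℝ}
    (h : JetOn V w p q a b c) (h' : JetOn V w' p' q' a' b' c') (e : EqOn w w' V) :
    EqOn p p' V ∧ EqOn q q' V ∧ EqOn a a' V ∧ EqOn b b' V ∧ EqOn c c' V := by
  have key : ∀ {f g f1 f2 g1 g2 : ℝ × ℝ → ℝ}, (∀ X ∈ V, HasFDerivAt f (LL (f1 X) (f2 X)) X) →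
      (∀ X ∈ V, HasFDerivAt g (LL (g1 X) (g2 X)) X) → EqOn f g V → ∀ X ∈ V, f1 X = g1 X ∧ f2 X = g2 X := by
    intro f g f1 f2 g1 g2 hf hg e X hX
    have := (hf X hX).congr_of_eventuallyEq (e.symm.eventuallyEq_of_mem (hV.mem_nhds hX))
    exact LL_inj (this.unique (hg X hX))
  have k1 := key h.w h'.w e
  have ep : EqOn p p' V := fun X hX => (k1 X hX).1
  have eq : EqOn q q' V := fun X hX => (k1 X hX).2
  have k2 := key h.p h'.p ep
  have k3 := key h.q h'.q eq
  exact ⟨ep, eq, fun X hX => (k2 X hX).1, fun X hX => (k2 X hX).2, fun X hX => (k3 X hX).2⟩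

lemma SK.smul {K a b c : ℝ} (h : SK K a b c) (t : ℝ) : SK K (t * a) (t * b) (t * c) := by
  unfold SK at *
  have := mul_le_mul_of_nonneg_left h (sq_nonneg t)
  nlinarith

/-- `core` for functions which are only `C²` near the closed unit square -/
lemma core_loc {w p q a b c : ℝ × ℝ → ℝ} (h : JetOn (ball 0 2) w p q a b c) :
    ∃ w' p' q' a' b' c' : ℝ × ℝ → ℝ, J2 w' p' q' a' b' c' ∧ ∀ X ∈ closedBall (0 : ℝ × ℝ) 1,
      w' X = w X ∧ p' X = p X ∧ q' X = q X ∧ a' X = a X ∧ b' X = b X ∧ c' X = c X := by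
  let χ : ContDiffBump (0 : ℝ × ℝ) := ⟨5/4, 3/2, by norm_num, by norm_num⟩
  let W : ℝ × ℝ → ℝ := fun X => χ X * w X
  have hW : ContDiff ℝ 2 W := by
    rw [contDiff_iff_contDiffAt]
    intro X
    by_cases hX : X ∈ ball (0 : ℝ × ℝ) 2
    · exact (χ.contDiff.contDiffAt).mul ((h.contDiffOn isOpen_ball).contDiffAt (isOpen_ball.mem_nhds hX))
    · have : W =ᶠ[𝓝 X] fun _ => 0 := by
        have hX' : X ∈ (closedBall (0 : ℝ × ℝ) (3/2))ᶜ := by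
          simp only [mem_compl_iff, mem_closedBall, mem_ball, not_le, not_lt] at *
          linarith
        filter_upwards [isClosed_closedBall.isOpen_compl.mem_nhds hX'] with Y hY
        have : χ Y = 0 := χ.zero_of_le_dist (by
          simp only [mem_compl_iff, mem_closedBall, not_le] at hY
          exact hY.le)
        simp [W, this]
      exact contDiffAt_const.congr_of_eventuallyEq this
  have J := JetOn.of_contDiffOn isOpen_univ hW.contDiffOn
  refine ⟨W, _, _, _, _, _, ⟨⟨fun X => J.w X trivial, ?_, ?_⟩, ⟨fun X => J.p X trivial, ?_, ?_⟩, ⟨fun X => J.q X trivial, ?_, ?_⟩⟩, ?_⟩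
  · exact continuous_iff_continuousAt.2 fun X => (J.p X trivial).continuousAt
  · exact continuous_iff_continuousAt.2 fun X => (J.q X trivial).continuousAt
  · simpa using J.ca
  · simpa using J.cb
  · simpa using J.cb
  · simpa using J.cc
  · have e : EqOn W w (ball (0 : ℝ × ℝ) (5/4)) := by
      intro X hX
      have : χ X = 1 := χ.one_of_mem_closedBall (ball_subset_closedBall hX)
      simp [W, this]
    have u := JetOn.unique isOpen_ball (J.mono (subset_univ (ball (0 : ℝ × ℝ) (5/4)))) (h.mono (ball_subset_ball (by norm_num))) e
    intro X hX
    have hX' : X ∈ ball (0 : ℝ × ℝ) (5/4) := closedBall_subset_ball (by norm_num) hX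
    exact ⟨e hX', u.1 hX', u.2.1 hX', u.2.2.1 hX', u.2.2.2.1 hX', u.2.2.2.2 hX'⟩

/-- local interior theorem -/
theorem interior1 (K : ℝ) (hK : 1 ≤ K) : ∃ γ C : ℝ, 0 < γ ∧ γ ≤ 1 / 2 ∧ 0 < C ∧
    ∀ (w p q a b c : ℝ × ℝ → ℝ) (X0 : ℝ × ℝ) (ρ M : ℝ), 0 < ρ → 0 < M → JetOn (ball X0 ρ) w p q a b c →
    (∀ X ∈ ball X0 ρ, SK K (a X) (b X) (c X)) → (∀ X ∈ ball X0 ρ, |w X| ≤ M) →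
    |p X0| ≤ C * M / ρ ∧ |q X0| ≤ C * M / ρ ∧
    ∀ X : ℝ × ℝ, ‖X - X0‖ ≤ ρ / 4 →
      |w X - w X0 - (p X0 * (X.1 - X0.1) + q X0 * (X.2 - X0.2))| ≤ C * M * (‖X - X0‖ / ρ) ^ (1 + γ) := by
  obtain ⟨γ, C, hγ, hγ2, hC, H⟩ := core K hK
  refine ⟨γ, C * 4, hγ, hγ2, by positivity, ?_⟩
  intro w p q a b c X0 ρ M hρ hM J hsk hw
  let φ := PW.aff X0.1 X0.2 (ρ / 2) 0 0 (ρ / 2)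
  have hφ : ∀ z, φ z = X0 + (ρ / 2) • z := by
    intro z; ext <;> simp [φ, PW.aff]
  have hball : ball (0 : ℝ × ℝ) 2 ⊆ φ ⁻¹' ball X0 ρ := by
    intro z hz
    simp only [mem_preimage, hφ, mem_ball, dist_self_add_left, norm_smul, Real.norm_eq_abs, abs_of_pos (half_pos hρ)]
    simp at hz
    nlinarith
  have J1 := (J.aff X0.1 X0.2 (ρ / 2) 0 0 (ρ / 2)).mono hball
  have J2' := J1.lin J1 (1 / M) 0
  obtain ⟨w', p', q', a', b', c', hJ, hE⟩ := core_loc J2'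
  have mem : ∀ x ∈ Icc (-1:ℝ) 1, ∀ y ∈ Icc (-1:ℝ) 1, (x, y) ∈ closedBall (0 : ℝ × ℝ) 1 := by
    intro x hx y hy
    simp only [mem_closedBall, dist_zero_right, Prod.norm_def, Real.norm_eq_abs, sup_le_iff]
    exact ⟨abs_le.2 hx, abs_le.2 hy⟩
  have sub : closedBall (0 : ℝ × ℝ) 1 ⊆ ball 0 2 := closedBall_subset_ball (by norm_num)
  have := H w' p' q' a' b' c' hJ (by
    intro x hx y hy
    obtain ⟨-, -, -, h1, h2, h3⟩ := hE (x, y) (mem x hx y hy)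
    rw [h1, h2, h3]
    have := (hsk _ (hball (sub (mem x hx y hy)))).smul (1 / M * (ρ / 2) ^ 2)
    convert this using 1 <;> simp [φ] <;> ring) (by
    intro x hx y hy
    obtain ⟨h0, -⟩ := hE (x, y) (mem x hx y hy)
    rw [h0]
    have := hw _ (hball (sub (mem x hx y hy)))
    simp only [zero_mul, add_zero]
    rw [abs_mul, abs_of_pos (by positivity), one_div, ← div_eq_inv_mul, div_le_one hM]
    exact this)
  obtain ⟨h1, h2, h3⟩ := this
  obtain ⟨e0, ep, eq, -⟩ := hE 0 (by simp)
  have φ0 : PW.aff X0.1 X0.2 (ρ / 2) 0 0 (ρ / 2) 0 = X0 := by have := hφ 0; simpa [φ] using this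
  simp only [φ0] at e0 ep eq
  have ep' : p' 0 = ρ / (2 * M) * p X0 := by rw [ep]; field_simp; ring
  have eq' : q' 0 = ρ / (2 * M) * q X0 := by rw [eq]; field_simp; ring
  refine ⟨?_, ?_, ?_⟩
  · rw [ep', abs_mul, abs_of_pos (by positivity)] at h1
    rw [le_div_iff₀ hρ]
    have : ρ / (2 * M) * |p X0| * (2 * M) ≤ C * (2 * M) := by gcongr
    have e : ρ / (2 * M) * |p X0| * (2 * M) = |p X0| * ρ := by field_simp
    nlinarith
  · rw [eq', abs_mul, abs_of_pos (by positivity)] at h2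
    rw [le_div_iff₀ hρ]
    have : ρ / (2 * M) * |q X0| * (2 * M) ≤ C * (2 * M) := by gcongr
    have e : ρ / (2 * M) * |q X0| * (2 * M) = |q X0| * ρ := by field_simp
    nlinarith
  · intro X hX
    set z := (2 / ρ) • (X - X0) with hz
    have nz : ‖z‖ = 2 * (‖X - X0‖ / ρ) := by
      rw [hz, norm_smul, Real.norm_eq_abs, abs_of_pos (by positivity)]; ring
    have nz2 : ‖z‖ ≤ 1 / 2 := by
      rw [nz]
      have : ‖X - X0‖ / ρ ≤ 1 / 4 := by rw [div_le_iff₀ hρ]; linarith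
      linarith
    have hφz : PW.aff X0.1 X0.2 (ρ / 2) 0 0 (ρ / 2) z = X := by
      have := hφ z
      rw [hz, smul_smul] at this
      have e : ρ / 2 * (2 / ρ) = 1 := by field_simp
      rw [e, one_smul, add_sub_cancel] at this
      exact this
    have h4 := h3 z nz2
    obtain ⟨ez, -⟩ := hE z (by simp only [mem_closedBall, dist_zero_right]; linarith)
    simp only [hφz] at ez
    rw [ez, e0, ep', eq', nz, Real.mul_rpow (by norm_num) (by positivity)] at h4
    have e5 : (1 / M * w X + 0 * w X - (1 / M * w X0 + 0 * w X0) - (ρ / (2 * M) * p X0 * z.1 + ρ / (2 * M) * q X0 * z.2)) =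
       (1 / M) * (w X - w X0 - (p X0 * (X.1 - X0.1) + q X0 * (X.2 - X0.2))) := by
      simp only [hz, Prod.smul_fst, Prod.smul_snd, Prod.fst_sub, Prod.snd_sub, smul_eq_mul]
      field_simp; ring
    rw [e5, abs_mul, abs_of_pos (by positivity)] at h4
    have h6 : (2:ℝ) ^ (1 + γ) ≤ 4 := by
      calc (2:ℝ) ^ (1 + γ) ≤ 2 ^ (2:ℝ) := Real.rpow_le_rpow_of_exponent_le (by norm_num) (by linarith)
        _ = 4 := by norm_num
    set Y := (‖X - X0‖ / ρ) ^ (1 + γ)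
    have Y0 : 0 ≤ Y := by positivity
    have h7 : M * (1 / M * |w X - w X0 - (p X0 * (X.1 - X0.1) + q X0 * (X.2 - X0.2))|) ≤ M * (C * (4 * Y)) := by
      have : (2:ℝ) ^ (1 + γ) * Y ≤ 4 * Y := by gcongr
      exact mul_le_mul_of_nonneg_left (h4.trans (mul_le_mul_of_nonneg_left this hC.le)) hM.le
    have e8 : M * (1 / M * |w X - w X0 - (p X0 * (X.1 - X0.1) + q X0 * (X.2 - X0.2))|) = |w X - w X0 - (p X0 * (X.1 - X0.1) + q X0 * (X.2 - X0.2))| := by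
      field_simp
    rw [e8] at h7
    linarith

end PW

namespace PW
open Filter MeasureTheory
open scoped Topology

lemma JetOn.translate {V : Set (ℝ × ℝ)} {w p q a b c : ℝ × ℝ → ℝ} (h : JetOn V w p q a b c) (D : ℝ × ℝ) :
    JetOn ((fun X => X + D) ⁻¹' V) (fun X => w (X + D)) (fun X => p (X + D)) (fun X => q (X + D))
      (fun X => a (X + D)) (fun X => b (X + D)) (fun X => c (X + D)) := by
  have ct : ContinuousOn (fun X : ℝ × ℝ => X + D) ((fun X => X + D) ⁻¹' V) := by fun_prop
  exact ⟨fun X hX => (hasFDerivAt_comp_add_right D).2 (h.w _ hX), fun X hX => (hasFDerivAt_comp_add_right D).2 (h.p _ hX),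
    fun X hX => (hasFDerivAt_comp_add_right D).2 (h.q _ hX),
    h.ca.comp ct (mapsTo_preimage _ V), h.cb.comp ct (mapsTo_preimage _ V), h.cc.comp ct (mapsTo_preimage _ V)⟩

lemma hasDerivAt_line {w : ℝ × ℝ → ℝ} {p q : ℝ} {X D : ℝ × ℝ} {t : ℝ}
    (h : HasFDerivAt w (LL p q) (X + t • D)) : HasDerivAt (fun t : ℝ => w (X + t • D)) (p * D.1 + q * D.2) t := by
  have h1 : HasDerivAt (fun t : ℝ => X + t • D) D t := by
    have := ((hasDerivAt_id t).smul_const D).const_add X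
    simpa using this
  have := h.comp_hasDerivAt t h1
  exact this.congr_deriv (by simp)

lemma tendsto_dq {w : ℝ × ℝ → ℝ} {p q : ℝ} {X D : ℝ × ℝ} (h : HasFDerivAt w (LL p q) X) :
    Tendsto (fun t : ℝ => (w (X + t • D) - w X) / t) (𝓝[>] 0) (𝓝 (p * D.1 + q * D.2)) := by
  have h0 : HasDerivAt (fun t : ℝ => w (X + t • D)) (p * D.1 + q * D.2) 0 := hasDerivAt_line (by simpa using h)
  have := (hasDerivAt_iff_tendsto_slope_zero.1 h0).mono_left (nhdsWithin_mono 0 (fun t (ht : 0 < t) => ht.ne'))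
  refine this.congr fun t => ?_
  simp [div_eq_inv_mul]

/-- mean value theorem along a segment -/
lemma mvt_line {V : Set (ℝ × ℝ)} {w p q : ℝ × ℝ → ℝ} {X D : ℝ × ℝ}
    (h' : ∀ X ∈ V, HasFDerivAt w (LL (p X) (q X)) X) (hV : ∀ t ∈ Icc (0:ℝ) 1, X + t • D ∈ V) :
    ∃ t ∈ Ioo (0:ℝ) 1, w (X + D) - w X = p (X + t • D) * D.1 + q (X + t • D) * D.2 := by
  have h : ∀ t ∈ Icc (0:ℝ) 1, HasFDerivAt w (LL (p (X + t • D)) (q (X + t • D))) (X + t • D) :=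
    fun t ht => h' _ (hV t ht)
  obtain ⟨t, ht, h1⟩ := exists_hasDerivAt_eq_slope (fun t : ℝ => w (X + t • D)) (fun t => p (X + t • D) * D.1 + q (X + t • D) * D.2)
    (zero_lt_one) (fun t ht => (hasDerivAt_line (h t ht)).continuousAt.continuousWithinAt)
    (fun t ht => hasDerivAt_line (h t (Ioo_subset_Icc_self ht)))
  refine ⟨t, ht, ?_⟩
  rw [h1]; simp

lemma abs_fst_le (D : ℝ × ℝ) : |D.1| ≤ ‖D‖ := norm_fst_le D
lemma abs_snd_le (D : ℝ × ℝ) : |D.2| ≤ ‖D‖ := norm_snd_le D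

/-- interior expansion for solutions: first the expansion of a directional derivative -/
lemma interior2_aux {K γ C : ℝ} (hγ : 0 < γ) (hC : 0 < C)
    (H : ∀ (w p q a b c : ℝ × ℝ → ℝ) (X0 : ℝ × ℝ) (ρ M : ℝ), 0 < ρ → 0 < M → JetOn (ball X0 ρ) w p q a b c →
    (∀ X ∈ ball X0 ρ, SK K (a X) (b X) (c X)) → (∀ X ∈ ball X0 ρ, |w X| ≤ M) →
    |p X0| ≤ C * M / ρ ∧ |q X0| ≤ C * M / ρ ∧
    ∀ X : ℝ × ℝ, ‖X - X0‖ ≤ ρ / 4 →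
      |w X - w X0 - (p X0 * (X.1 - X0.1) + q X0 * (X.2 - X0.2))| ≤ C * M * (‖X - X0‖ / ρ) ^ (1 + γ))
    {w p q a b c : ℝ × ℝ → ℝ} {X0 : ℝ × ℝ} {ρ M : ℝ} (hρ : 0 < ρ) (hM : 0 < M) (J : JetOn (ball X0 ρ) w p q a b c)
    (h1 : ∀ X ∈ ball X0 ρ, SK K (a X) (b X) (c X))
    (h2 : ∀ X ∈ ball X0 ρ, ∀ Y ∈ ball X0 ρ, SK K (a X - a Y) (b X - b Y) (c X - c Y))
    (hw : ∀ X ∈ ball X0 ρ, |w X| ≤ M) {e : ℝ × ℝ} (he : ‖e‖ ≤ 1) :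
    |a X0 * e.1 + b X0 * e.2| ≤ 16 * C ^ 2 * M / ρ ^ 2 ∧ |b X0 * e.1 + c X0 * e.2| ≤ 16 * C ^ 2 * M / ρ ^ 2 ∧
    ∀ X : ℝ × ℝ, ‖X - X0‖ ≤ ρ / 16 →
      |(p X * e.1 + q X * e.2) - (p X0 * e.1 + q X0 * e.2) - ((a X0 * e.1 + b X0 * e.2) * (X.1 - X0.1) + (b X0 * e.1 + c X0 * e.2) * (X.2 - X0.2))|
        ≤ 4 * C ^ 2 * M / ρ * (4 * ‖X - X0‖ / ρ) ^ (1 + γ) := by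
  have grad : ∀ Y ∈ ball X0 (ρ / 2), |p Y| ≤ 2 * C * M / ρ ∧ |q Y| ≤ 2 * C * M / ρ := by
    intro Y hY
    have sub : ball Y (ρ / 2) ⊆ ball X0 ρ := ball_subset_ball' (by rw [mem_ball] at hY; linarith)
    obtain ⟨g1, g2, -⟩ := H w p q a b c Y (ρ / 2) M (by positivity) hM (J.mono sub) (fun X hX => h1 X (sub hX)) (fun X hX => hw X (sub hX))
    have : C * M / (ρ / 2) = 2 * C * M / ρ := by field_simp
    rw [this] at g1 g2
    exact ⟨g1, g2⟩
  have key : ∀ h, 0 < h → h < ρ / 4 → 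
      |(p (X0 + h • e) - p X0) / h| ≤ 16 * C ^ 2 * M / ρ ^ 2 ∧ |(q (X0 + h • e) - q X0) / h| ≤ 16 * C ^ 2 * M / ρ ^ 2 ∧
      ∀ X : ℝ × ℝ, ‖X - X0‖ ≤ ρ / 16 →
      |(w (X + h • e) - w X) / h - (w (X0 + h • e) - w X0) / h - ((p (X0 + h • e) - p X0) / h * (X.1 - X0.1) + (q (X0 + h • e) - q X0) / h * (X.2 - X0.2))|
        ≤ 4 * C ^ 2 * M / ρ * (4 * ‖X - X0‖ / ρ) ^ (1 + γ) := by
    intro h h0 h3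
    have tm : ∀ X ∈ ball X0 (ρ / 4), ∀ t ∈ Icc (0:ℝ) 1, X + t • (h • e) ∈ ball X0 (ρ / 2) := by
      intro X hX t ht
      rw [mem_ball] at *
      have n1 : ‖t • (h • e)‖ ≤ h := by
        rw [norm_smul, norm_smul, Real.norm_eq_abs, Real.norm_eq_abs, abs_of_pos h0, abs_of_nonneg ht.1]
        have : h * ‖e‖ ≤ h := by nlinarith [norm_nonneg e]
        nlinarith [ht.1, ht.2, mul_nonneg h0.le (norm_nonneg e)]
      calc dist (X + t • (h • e)) X0 ≤ dist (X + t • (h • e)) X + dist X X0 := dist_triangle _ _ _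
        _ < ρ / 2 := by rw [dist_self_add_left]; linarith
    have sub2 : ball X0 (ρ / 2) ⊆ ball X0 ρ := ball_subset_ball (by linarith)
    have sub : ball X0 (ρ / 4) ⊆ (fun X => X + h • e) ⁻¹' ball X0 ρ := by
      intro X hX
      have := sub2 (tm X hX 1 (by simp))
      simpa using this
    have sub4 : ball X0 (ρ / 4) ⊆ ball X0 ρ := ball_subset_ball (by linarith)
    have Jh := ((J.translate (h • e)).mono sub).lin (J.mono sub4) (1 / h) (-(1 / h))
    have := H _ _ _ _ _ _ X0 (ρ / 4) (4 * C * M / ρ) (by positivity) (by positivity) Jh (by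
        intro X hX
        have := (h2 _ (sub hX) _ (sub4 hX)).smul (1 / h)
        convert this using 1 <;> ring) (by
        intro X hX
        obtain ⟨t, ht, e1⟩ := mvt_line (X := X) (D := h • e) J.w
          (fun t ht => sub2 (tm X hX t ht))
        have e2 : 1 / h * w (X + h • e) + -(1 / h) * w X = p (X + t • h • e) * e.1 + q (X + t • h • e) * e.2 := by
          have : 1 / h * w (X + h • e) + -(1 / h) * w X = 1 / h * (w (X + h • e) - w X) := by ring
          rw [this, e1]
          simp only [Prod.smul_fst, Prod.smul_snd, smul_eq_mul]
          field_simp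
        rw [e2]
        obtain ⟨g1, g2⟩ := grad _ (tm X hX t (Ioo_subset_Icc_self ht))
        calc _ ≤ |p (X + t • h • e) * e.1| + |q (X + t • h • e) * e.2| := abs_add_le _ _
          _ ≤ 2 * C * M / ρ * 1 + 2 * C * M / ρ * 1 := by
            rw [abs_mul, abs_mul]
            have := (abs_fst_le e).trans he
            have := (abs_snd_le e).trans he
            gcongr
          _ = 4 * C * M / ρ := by ring)
    obtain ⟨g1, g2, g3⟩ := this
    have e0 : C * (4 * C * M / ρ) / (ρ / 4) = 16 * C ^ 2 * M / ρ ^ 2 := by field_simp; ring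
    rw [e0] at g1 g2
    refine ⟨?_, ?_, ?_⟩
    · convert g1 using 2; ring
    · convert g2 using 2; ring
    · intro X hX
      have := g3 X (by linarith)
      have e3 : ‖X - X0‖ / (ρ / 4) = 4 * ‖X - X0‖ / ρ := by field_simp
      have e4 : C * (4 * C * M / ρ) = 4 * C ^ 2 * M / ρ := by ring
      rw [e3, e4] at this
      convert this using 2; ring
  have ev : ∀ᶠ h : ℝ in 𝓝[>] 0, 0 < h ∧ h < ρ / 4 := Ioo_mem_nhdsGT (by positivity)
  have mX0 : X0 ∈ ball X0 ρ := mem_ball_self hρ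
  have tp := tendsto_dq (D := e) (J.p X0 mX0)
  have tq := tendsto_dq (D := e) (J.q X0 mX0)
  refine ⟨?_, ?_, ?_⟩
  · exact le_of_tendsto tp.abs (ev.mono fun h hh => (key h hh.1 hh.2).1)
  · exact le_of_tendsto tq.abs (ev.mono fun h hh => (key h hh.1 hh.2).2.1)
  · intro X hX
    have mX : X ∈ ball X0 ρ := by rw [mem_ball, dist_eq_norm]; linarith
    have tw := tendsto_dq (D := e) (J.w X mX)
    have tw0 := tendsto_dq (D := e) (J.w X0 mX0)
    exact le_of_tendsto ((tw.sub tw0).sub ((tp.mul_const (X.1 - X0.1)).add (tq.mul_const (X.2 - X0.2)))).abs (ev.mono fun h hh => (key h hh.1 hh.2).2.2 X hX)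

set_option maxHeartbeats 1000000 in
theorem interior2 (K : ℝ) (hK : 1 ≤ K) : ∃ γ C : ℝ, 0 < γ ∧ γ ≤ 1 / 2 ∧ 0 < C ∧
    ∀ (w p q a b c : ℝ × ℝ → ℝ) (X0 : ℝ × ℝ) (ρ M : ℝ), 0 < ρ → 0 < M → JetOn (ball X0 ρ) w p q a b c →
    (∀ X ∈ ball X0 ρ, SK K (a X) (b X) (c X)) →
    (∀ X ∈ ball X0 ρ, ∀ Y ∈ ball X0 ρ, SK K (a X - a Y) (b X - b Y) (c X - c Y)) →
    (∀ X ∈ ball X0 ρ, |w X| ≤ M) →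
    |p X0| ≤ C * M / ρ ∧ |q X0| ≤ C * M / ρ ∧ |a X0| ≤ C * M / ρ ^ 2 ∧ |b X0| ≤ C * M / ρ ^ 2 ∧ |c X0| ≤ C * M / ρ ^ 2 ∧
    ∀ X : ℝ × ℝ, ‖X - X0‖ ≤ ρ / 16 →
      |w X - (w X0 + (p X0 * (X.1 - X0.1) + q X0 * (X.2 - X0.2)) + (a X0 * (X.1 - X0.1) ^ 2 / 2
        + b X0 * (X.1 - X0.1) * (X.2 - X0.2) + c X0 * (X.2 - X0.2) ^ 2 / 2))| ≤ C * M * (‖X - X0‖ / ρ) ^ (2 + γ) := by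
  obtain ⟨γ, C, hγ, hγ2, hC, H⟩ := interior1 K hK
  refine ⟨γ, C + 128 * C ^ 2, hγ, hγ2, by positivity, ?_⟩
  intro w p q a b c X0 ρ M hρ hM J h1 h2 hw
  obtain ⟨g1, g2, -⟩ := H w p q a b c X0 ρ M hρ hM J h1 hw
  obtain ⟨x1, x2, x3⟩ := interior2_aux hγ hC H hρ hM J h1 h2 hw (e := (1, 0)) (by simp [Prod.norm_def])
  obtain ⟨y1, y2, y3⟩ := interior2_aux hγ hC H hρ hM J h1 h2 hw (e := (0, 1)) (by simp [Prod.norm_def])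
  simp only [mul_one, mul_zero, add_zero, zero_add] at x1 x2 x3 y1 y2 y3
  have m1 : C * M / ρ ≤ (C + 128 * C ^ 2) * M / ρ := by
    gcongr; nlinarith [sq_nonneg C]
  have m2 : 16 * C ^ 2 * M / ρ ^ 2 ≤ (C + 128 * C ^ 2) * M / ρ ^ 2 := by
    gcongr; nlinarith [sq_nonneg C]
  refine ⟨g1.trans m1, g2.trans m1, x1.trans m2, x2.trans m2, y2.trans m2, ?_⟩
  intro X hX
  set D := X - X0 with hD
  have JQ := JetOn.quad (ball X0 ρ) 0 (p X0 - a X0 * X0.1 - b X0 * X0.2) (q X0 - b X0 * X0.1 - c X0 * X0.2) (a X0) (b X0) (c X0)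
  have JD := J.lin JQ 1 (-1)
  have mem : ∀ t ∈ Icc (0:ℝ) 1, ‖t • D‖ ≤ ‖D‖ := by
    intro t ht
    rw [norm_smul, Real.norm_eq_abs, abs_of_nonneg ht.1]
    nlinarith [norm_nonneg D, ht.2]
  obtain ⟨t, ht, et⟩ := mvt_line (X := X0) (D := D) JD.w (fun t ht => by
    have := mem t ht
    rw [mem_ball, dist_self_add_left]; linarith)
  have XD : X0 + D = X := by rw [hD]; abel
  rw [XD] at et
  have mt := mem t (Ioo_subset_Icc_self ht)
  have u1 := x3 (X0 + t • D) (by rw [add_sub_cancel_left]; linarith)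
  have u2 := y3 (X0 + t • D) (by rw [add_sub_cancel_left]; linarith)
  rw [add_sub_cancel_left] at u1 u2
  set Em := 4 * C ^ 2 * M / ρ * (4 * ‖D‖ / ρ) ^ (1 + γ) with hEm
  have uE : 4 * C ^ 2 * M / ρ * (4 * ‖t • D‖ / ρ) ^ (1 + γ) ≤ Em := by
    rw [hEm]; gcongr
  replace u1 := u1.trans uE
  replace u2 := u2.trans uE
  have d1 : X.1 - X0.1 = D.1 := rfl
  have d2 : X.2 - X0.2 = D.2 := rfl
  have s1 : (X0 + t • D).1 = X0.1 + t * D.1 := rfl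
  have s2 : (X0 + t • D).2 = X0.2 + t * D.2 := rfl
  have x1' : X.1 = X0.1 + D.1 := by rw [← d1]; ring
  have x2' : X.2 = X0.2 + D.2 := by rw [← d2]; ring
  rw [s1, s2] at u1 u2 et
  rw [d1, d2]
  have e6 : w X - (w X0 + (p X0 * D.1 + q X0 * D.2) + (a X0 * D.1 ^ 2 / 2
        + b X0 * D.1 * D.2 + c X0 * D.2 ^ 2 / 2)) = 
      (p (X0 + t • D) - p X0 - (a X0 * (X0.1 + t * D.1 - X0.1) + b X0 * (X0.2 + t * D.2 - X0.2))) * D.1 +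
      (q (X0 + t • D) - q X0 - (b X0 * (X0.1 + t * D.1 - X0.1) + c X0 * (X0.2 + t * D.2 - X0.2))) * D.2 := by
    rw [x1', x2'] at et
    linear_combination et
  rw [e6]
  have f1 := abs_fst_le D
  have f2 := abs_snd_le D
  have e0 : 0 ≤ Em := (abs_nonneg _).trans u1
  have b1 : |(p (X0 + t • D) - p X0 - (a X0 * (X0.1 + t * D.1 - X0.1) + b X0 * (X0.2 + t * D.2 - X0.2))) * D.1 +
      (q (X0 + t • D) - q X0 - (b X0 * (X0.1 + t * D.1 - X0.1) + c X0 * (X0.2 + t * D.2 - X0.2))) * D.2| ≤ Em * ‖D‖ + Em * ‖D‖ := by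
    refine (abs_add_le _ _).trans ?_
    rw [abs_mul, abs_mul]
    gcongr
  refine b1.trans ?_
  set r := ‖D‖ / ρ with hr
  have r0 : 0 ≤ r := by positivity
  have e7 : Em * ‖D‖ = 4 * C ^ 2 * M * (4 * r) ^ (1 + γ) * r := by
    rw [hEm, hr]; 
    have : 4 * ‖D‖ / ρ = 4 * (‖D‖ / ρ) := by ring
    rw [this]; field_simp
  have e8 : (4 * r) ^ (1 + γ) ≤ 8 * r ^ (1 + γ) := by
    rw [Real.mul_rpow (by norm_num) r0]
    gcongr
    calc (4:ℝ) ^ (1 + γ) ≤ 4 ^ (3 / 2 : ℝ) := Real.rpow_le_rpow_of_exponent_le (by norm_num) (by linarith)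
      _ = (2 ^ (2:ℝ)) ^ (3 / 2 : ℝ) := by norm_num
      _ = 8 := by rw [← Real.rpow_mul (by norm_num)]; norm_num
  have e9 : r ^ (1 + γ) * r = r ^ (2 + γ) := by
    rw [show (2 + γ) = (1 + γ) + 1 by ring, Real.rpow_add_one' r0 (by linarith)]
  rw [e7]
  have e10 : 4 * C ^ 2 * M * (4 * r) ^ (1 + γ) * r ≤ 4 * C ^ 2 * M * (8 * r ^ (1 + γ)) * r := by gcongr
  have e11 : 4 * C ^ 2 * M * (8 * r ^ (1 + γ)) * r = 32 * C ^ 2 * M * r ^ (2 + γ) := by rw [← e9]; ring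
  have e12 : 0 ≤ r ^ (2 + γ) := by positivity
  have e13 : 0 ≤ M * r ^ (2 + γ) := by positivity
  have e14 := mul_nonneg hC.le e13
  have e15 := mul_nonneg (sq_nonneg C) e13
  linarith [e14, e15, e10, e11, show (C + 128 * C ^ 2) * M * r ^ (2 + γ) = C * (M * r ^ (2 + γ)) + 128 * (C ^ 2 * (M * r ^ (2 + γ))) by ring, show 32 * C ^ 2 * M * r ^ (2 + γ) = 32 * (C ^ 2 * (M * r ^ (2 + γ))) by ring]

end PW

namespace PW
open Filter MeasureTheory
open scoped Topology

lemma second_test {V : Set (ℝ × ℝ)} (hV : IsOpen V) {f p q a b c : ℝ × ℝ → ℝ} (J : JetOn V f p q a b c)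
    {Y : ℝ × ℝ} (hY : Y ∈ V) (hm : IsLocalMin f Y) (v1 v2 : ℝ) :
    0 ≤ a Y * v1 ^ 2 + 2 * b Y * v1 * v2 + c Y * v2 ^ 2 := by
  by_contra hneg
  push Not at hneg
  set D : ℝ × ℝ := (v1, v2) with hD
  have hg0 : LL (p Y) (q Y) = 0 := hm.hasFDerivAt_eq_zero (J.w Y hY)
  have hp0 : p Y = 0 := by have := DFunLike.congr_fun hg0 (1, 0); simpa using this
  have hq0 : q Y = 0 := by have := DFunLike.congr_fun hg0 (0, 1); simpa using this
  have t1 := tendsto_dq (D := D) (J.p Y hY)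
  have t2 := tendsto_dq (D := D) (J.q Y hY)
  have t3 := (t1.mul_const v1).add (t2.mul_const v2)
  have hlim : (a Y * D.1 + b Y * D.2) * v1 + (b Y * D.1 + c Y * D.2) * v2 < 0 := by
    simp only [hD]; nlinarith
  have ev := t3.eventually (gt_mem_nhds hlim)
  have cl : Continuous (fun t : ℝ => Y + t • D) := by fun_prop
  have c0 : Tendsto (fun t : ℝ => Y + t • D) (𝓝 0) (𝓝 Y) := by
    have := cl.tendsto 0; simpa using this
  have ev2 := c0.eventually (hm.and (hV.mem_nhds hY))
  obtain ⟨δ1, hδ1, H1⟩ := (mem_nhdsGT_iff_exists_Ioo_subset).1 ev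
  obtain ⟨δ2, hδ2, H2⟩ := Metric.eventually_nhds_iff.1 ev2
  simp only [mem_Ioi] at hδ1
  set t := min δ1 δ2 / 2 with ht
  have t0 : 0 < t := by positivity
  have tδ1 : t < δ1 := by have := min_le_left δ1 δ2; linarith
  have tδ2 : t < δ2 := by have := min_le_right δ1 δ2; linarith [lt_min hδ1 hδ2]
  obtain ⟨s, hs, e⟩ := mvt_line (X := Y) (D := t • D) J.w (by
    intro s hs
    rw [smul_smul]
    refine (H2 ?_).2
    rw [Real.dist_eq, sub_zero, abs_of_nonneg (mul_nonneg hs.1 t0.le)]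
    nlinarith [hs.1, hs.2])
  have st0 : 0 < s * t := mul_pos hs.1 t0
  have st1 : s * t < δ1 := by nlinarith [hs.1, hs.2]
  have k1 : 0 ≤ f (Y + t • D) - f Y := by
    have := (H2 (y := t) (by rw [Real.dist_eq, sub_zero, abs_of_pos t0]; exact tδ2)).1
    linarith
  have k2 := H1 ⟨st0, st1⟩
  simp only [mem_setOf_eq] at k2
  rw [hp0, hq0] at k2
  rw [smul_smul] at e
  have e2 : (t • D).1 = t * v1 := rfl
  have e3 : (t • D).2 = t * v2 := rfl
  rw [e2, e3] at e
  have e4 : f (Y + t • D) - f Y = (s * t * t) * ((p (Y + (s * t) • D) - 0) / (s * t) * v1 + (q (Y + (s * t) • D) - 0) / (s * t) * v2) := by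
    have s0 : s ≠ 0 := hs.1.ne'
    have t0' : t ≠ 0 := t0.ne'
    rw [e]; field_simp; ring
  have : (s * t * t) * ((p (Y + (s * t) • D) - 0) / (s * t) * v1 + (q (Y + (s * t) • D) - 0) / (s * t) * v2) < 0 :=
    mul_neg_of_pos_of_neg (by positivity) k2
  linarith

/-- approximable by functions whose Hessian satisfies `SK` -/
def Good (K : ℝ) (U : Set (ℝ × ℝ)) (w : ℝ × ℝ → ℝ) : Prop :=
  ∀ C ⊆ U, IsCompact C → ∀ ε > 0, ∃ V : Set (ℝ × ℝ), IsOpen V ∧ C ⊆ V ∧ ∃ w' p q a b c : ℝ × ℝ → ℝ,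
    JetOn V w' p q a b c ∧ (∀ X ∈ V, SK K (a X) (b X) (c X)) ∧ ∀ X ∈ C, |w X - w' X| < ε

lemma Good.affine {K : ℝ} {U : Set (ℝ × ℝ)} {w : ℝ × ℝ → ℝ} (h : Good K U w) (s k p q : ℝ) :
    Good K U (fun X => s * w X + (k + p * X.1 + q * X.2)) := by
  intro C hC hC2 ε hε
  obtain ⟨V, hV, hCV, w', p', q', a, b, c, J, hs, hw⟩ := h C hC hC2 (ε / (|s| + 1)) (by positivity)
  refine ⟨V, hV, hCV, _, _, _, _, _, _, J.lin (JetOn.quad V k p q 0 0 0) s 1, ?_, ?_⟩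
  · intro X hX
    have := (hs X hX).smul s
    simpa using this
  · intro X hX
    have h1 := hw X hX
    have e : s * w X + (k + p * X.1 + q * X.2) - (s * w' X + 1 * (k + p * X.1 + q * X.2 + (0 * X.1 ^ 2 / 2 + 0 * X.1 * X.2 + 0 * X.2 ^ 2 / 2)))
      = s * (w X - w' X) := by ring
    rw [e, abs_mul]
    rw [lt_div_iff₀ (by positivity)] at h1
    nlinarith [abs_nonneg s, abs_nonneg (w X - w' X)]

lemma Good.mono {K : ℝ} {U U' : Set (ℝ × ℝ)} {w : ℝ × ℝ → ℝ} (h : Good K U w) (hU : U' ⊆ U) : Good K U' w :=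
  fun C hC => h C (hC.trans hU)

lemma Good.congr {K : ℝ} {U : Set (ℝ × ℝ)} {w w' : ℝ × ℝ → ℝ} (h : Good K U w) (e : EqOn w w' U) : Good K U w' := by
  intro C hC hC2 ε hε
  obtain ⟨V, hV, hCV, w'', p', q', a, b, c, J, hs, hw⟩ := h C hC hC2 ε hε
  exact ⟨V, hV, hCV, w'', p', q', a, b, c, J, hs, fun X hX => by rw [← e (hC hX)]; exact hw X hX⟩

lemma JetOn.good {K : ℝ} {U : Set (ℝ × ℝ)} (hU : IsOpen U) {w p q a b c : ℝ × ℝ → ℝ} (J : JetOn U w p q a b c)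
    (hs : ∀ X ∈ U, SK K (a X) (b X) (c X)) : Good K U w :=
  fun C hC _ ε hε => ⟨U, hU, hC, w, p, q, a, b, c, J, hs, fun X _ => by simpa using hε⟩

/-- strict subsolution condition -/
def SubAt (K σ a b c : ℝ) : Prop := ∃ B e1 e2 : ℝ, 0 ≤ B ∧ e1 ^ 2 + e2 ^ 2 = 1 ∧
  (∀ v1 v2 : ℝ, -B * (v1 ^ 2 + v2 ^ 2) ≤ a * v1 ^ 2 + 2 * b * v1 * v2 + c * v2 ^ 2) ∧
  2 * K * B + σ ≤ a * e1 ^ 2 + 2 * b * e1 * e2 + c * e2 ^ 2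

lemma alg_diag {K B t r s : ℝ} (hK : 1 ≤ K) (hB : 0 ≤ B) (h : SK K t r s) (hd : r ^ 2 ≤ (t + B) * (s + B))
    (ht : 2 * K * B < t) : False := by
  unfold SK at h
  have h1 : t ^ 2 + s ^ 2 ≤ K * (B * (t + s) + B ^ 2) := by nlinarith [sq_nonneg r]
  have hKB : 0 ≤ K * B := by positivity
  nlinarith [sq_nonneg (s - K * B / 2), mul_nonneg hKB hKB, mul_pos (lt_of_le_of_lt (by linarith : 0 ≤ 2 * K * B) ht) (sub_pos.2 ht), mul_nonneg (sub_nonneg.2 hK) (mul_nonneg hKB hB)]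

lemma SK_rot {K a b c e1 e2 : ℝ} (h : SK K a b c) (he : e1 ^ 2 + e2 ^ 2 = 1) :
    SK K (a * e1 ^ 2 + 2 * b * e1 * e2 + c * e2 ^ 2) ((c - a) * e1 * e2 + b * (e1 ^ 2 - e2 ^ 2))
      (a * e2 ^ 2 - 2 * b * e1 * e2 + c * e1 ^ 2) := by
  unfold SK at *
  have e3 : (a * e1 ^ 2 + 2 * b * e1 * e2 + c * e2 ^ 2) ^ 2 + 2 * ((c - a) * e1 * e2 + b * (e1 ^ 2 - e2 ^ 2)) ^ 2
    + (a * e2 ^ 2 - 2 * b * e1 * e2 + c * e1 ^ 2) ^ 2 = (a ^ 2 + 2 * b ^ 2 + c ^ 2) * (e1 ^ 2 + e2 ^ 2) ^ 2 := by ring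
  have e4 : ((c - a) * e1 * e2 + b * (e1 ^ 2 - e2 ^ 2)) ^ 2 - (a * e1 ^ 2 + 2 * b * e1 * e2 + c * e2 ^ 2) * (a * e2 ^ 2 - 2 * b * e1 * e2 + c * e1 ^ 2)
    = (b ^ 2 - a * c) * (e1 ^ 2 + e2 ^ 2) ^ 2 := by ring
  rw [e3, e4, he]; simpa using h

lemma alg {K B a b c e1 e2 : ℝ} (hK : 1 ≤ K) (hB : 0 ≤ B) (h : SK K a b c) (he : e1 ^ 2 + e2 ^ 2 = 1)
    (hb : ∀ v1 v2 : ℝ, -B * (v1 ^ 2 + v2 ^ 2) ≤ a * v1 ^ 2 + 2 * b * v1 * v2 + c * v2 ^ 2)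
    (h2 : 2 * K * B < a * e1 ^ 2 + 2 * b * e1 * e2 + c * e2 ^ 2) : False := by
  refine alg_diag hK hB (SK_rot h he) ?_ h2
  set t := a * e1 ^ 2 + 2 * b * e1 * e2 + c * e2 ^ 2 with ht
  set r := (c - a) * e1 * e2 + b * (e1 ^ 2 - e2 ^ 2) with hr
  set s := a * e2 ^ 2 - 2 * b * e1 * e2 + c * e1 ^ 2 with hs
  have tp : 0 < t + B := by nlinarith [mul_nonneg (by linarith : 0 ≤ K) hB]
  have q := hb (-r * e1 - (t + B) * e2) (-r * e2 + (t + B) * e1)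
  have q1 : (-r * e1 - (t + B) * e2) ^ 2 + (-r * e2 + (t + B) * e1) ^ 2 = (r ^ 2 + (t + B) ^ 2) * (e1 ^ 2 + e2 ^ 2) := by ring
  have q2 : a * (-r * e1 - (t + B) * e2) ^ 2 + 2 * b * (-r * e1 - (t + B) * e2) * (-r * e2 + (t + B) * e1) + c * (-r * e2 + (t + B) * e1) ^ 2
    = r ^ 2 * t - 2 * r * (t + B) * r + (t + B) ^ 2 * s := by
    rw [ht, hr, hs]; ring
  rw [q1, q2, he] at q
  have : 0 ≤ (t + B) * ((t + B) * (s + B) - r ^ 2) := by nlinarith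
  have := nonneg_of_mul_nonneg_right this tp
  linarith

/-- comparison principle -/
theorem compare {K σ : ℝ} (hK : 1 ≤ K) (hσ : 0 < σ) {U D : Set (ℝ × ℝ)} (hD : IsOpen D) (hDb : Bornology.IsBounded D) (hDU : D ⊆ U)
    {w ψ p q a b c : ℝ × ℝ → ℝ} (hw : Good K U w) (cw : ContinuousOn w (closure D)) (cψ : ContinuousOn ψ (closure D))
    (J : JetOn D ψ p q a b c) (hs : ∀ X ∈ D, SubAt K σ (a X) (b X) (c X))
    (hb : ∀ X ∈ frontier D, ψ X ≤ w X) : ∀ X ∈ closure D, ψ X ≤ w X := by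
  by_contra hcon
  push Not at hcon
  obtain ⟨X1, hX1, h1⟩ := hcon
  have comp : IsCompact (closure D) := hDb.isCompact_closure
  obtain ⟨X0, hX0, hmin⟩ := comp.exists_isMinOn ⟨X1, hX1⟩ (cw.sub cψ)
  have hneg : w X0 - ψ X0 < 0 := by
    have := hmin hX1
    simp only [mem_setOf_eq, Pi.sub_apply] at this
    linarith
  have X0D : X0 ∈ D := by
    by_contra hnot
    have := hb X0 ⟨hX0, by rwa [hD.interior_eq]⟩
    linarith
  obtain ⟨r, r0, hr⟩ := nhds_basis_closedBall.mem_iff.1 (hD.mem_nhds X0D)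
  set ε := σ / (8 * K + 8) with hε
  have ε0 : 0 < ε := by positivity
  obtain ⟨V, hV, hCV, w', p', q', a', b', c', J', hs', hw'⟩ := hw (closedBall X0 r) (hr.trans hDU) (isCompact_closedBall X0 r) (ε * r ^ 2 / 4) (by positivity)
  set f : ℝ × ℝ → ℝ := fun X => 1 * (1 * w' X + (-1) * ψ X) + ε * (X0.1 ^ 2 + X0.2 ^ 2 + -2 * X0.1 * X.1 + -2 * X0.2 * X.2 + (2 * X.1 ^ 2 / 2 + 0 * X.1 * X.2 + 2 * X.2 ^ 2 / 2)) with hf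
  have Jf := ((J'.mono (inter_subset_left : V ∩ D ⊆ V)).lin (J.mono inter_subset_right) 1 (-1)).lin
    (JetOn.quad (V ∩ D) (X0.1 ^ 2 + X0.2 ^ 2) (-2 * X0.1) (-2 * X0.2) 2 0 2) 1 ε
  have sub : closedBall X0 r ⊆ V ∩ D := fun X hX => ⟨hCV hX, hr hX⟩
  have fval : ∀ X, f X = w' X - ψ X + ε * ((X.1 - X0.1) ^ 2 + (X.2 - X0.2) ^ 2) := by
    intro X; simp only [hf]; ring
  obtain ⟨Y, hY, hYm⟩ := (isCompact_closedBall X0 r).exists_isMinOn ⟨X0, mem_closedBall_self r0.le⟩ (Jf.contw.mono sub)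
  have f0 : f X0 < w X0 - ψ X0 + ε * r ^ 2 / 4 := by
    rw [fval]
    have := abs_lt.1 (hw' X0 (mem_closedBall_self r0.le))
    nlinarith
  have Yb : Y ∈ ball X0 r := by
    by_contra hnb
    have hd : dist Y X0 = r := le_antisymm hY (by simpa using hnb)
    have g1 : r ^ 2 ≤ (Y.1 - X0.1) ^ 2 + (Y.2 - X0.2) ^ 2 := by
      rw [dist_eq_norm, Prod.norm_def, Real.norm_eq_abs, Real.norm_eq_abs] at hd
      rcases max_choice |(Y - X0).1| |(Y - X0).2| with h | h <;> rw [h] at hd <;> rw [← hd, sq_abs]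
      · simp only [Prod.fst_sub]; nlinarith [sq_nonneg (Y.2 - X0.2)]
      · simp only [Prod.snd_sub]; nlinarith [sq_nonneg (Y.1 - X0.1)]
    have g2 := abs_lt.1 (hw' Y hY)
    have g3 := hmin (subset_closure (hr hY))
    simp only [mem_setOf_eq, Pi.sub_apply] at g3
    have g4 : f Y ≤ f X0 := hYm (mem_closedBall_self r0.le)
    rw [fval Y] at g4
    have : ε * r ^ 2 ≤ ε * ((Y.1 - X0.1) ^ 2 + (Y.2 - X0.2) ^ 2) := by gcongr
    nlinarith [mul_pos ε0 (pow_pos r0 2)]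
  have loc : IsLocalMin f Y := by
    filter_upwards [isOpen_ball.mem_nhds Yb] with Z hZ
    exact hYm (ball_subset_closedBall hZ)
  have YVD := sub hY
  have test := second_test (hV.inter hD) Jf YVD loc
  obtain ⟨B, e1, e2, hB, he, hBv, hBe⟩ := hs Y YVD.2
  refine alg (B := B + 2 * ε) hK (by positivity) (hs' Y YVD.1) he ?_ ?_
  · intro v1 v2
    have := test v1 v2
    have := hBv v1 v2
    nlinarith
  · have t1 := test e1 e2
    have t2 : 2 * ε * (e1 ^ 2 + e2 ^ 2) = 2 * ε := by rw [he]; ring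
    have t3 : ε * (8 * K + 8) = σ := by rw [hε]; field_simp
    nlinarith

lemma SubAt_x {K a : ℝ} (ha : 0 < a) : SubAt K a a 0 0 :=
  ⟨0, 1, 0, le_refl _, by norm_num, fun v1 v2 => by nlinarith [mul_nonneg ha.le (sq_nonneg v1)], by nlinarith⟩

/-- maximum principle -/
theorem max_principle {K : ℝ} (hK : 1 ≤ K) {U D : Set (ℝ × ℝ)} (hD : IsOpen D) (hDb : Bornology.IsBounded D) (hDU : D ⊆ U)
    {w : ℝ × ℝ → ℝ} (hw : Good K U w) (cw : ContinuousOn w (closure D)) {m : ℝ}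
    (hb : ∀ X ∈ frontier D, m ≤ w X) : ∀ X ∈ closure D, m ≤ w X := by
  obtain ⟨R, hR⟩ := hDb.closure.subset_closedBall 0
  have xb : ∀ X ∈ closure D, X.1 ^ 2 ≤ R ^ 2 := by
    intro X hX
    have := hR hX
    rw [mem_closedBall, dist_zero_right] at this
    have h2 := (abs_fst_le X).trans this
    exact sq_le_sq' (by linarith [abs_le.1 h2]) (abs_le.1 h2).2
  intro X hX
  refine le_of_forall_pos_le_add fun ε hε => ?_
  set η := ε / (R ^ 2 + 1) with hη
  have η0 : 0 < η := by positivity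
  have JQ := JetOn.quad D (m - η * R ^ 2) 0 0 (2 * η) 0 0
  have := compare (σ := 2 * η) hK (by positivity) hD hDb hDU hw cw (ψ := fun X => m - η * R ^ 2 + 0 * X.1 + 0 * X.2 + (2 * η * X.1 ^ 2 / 2 + 0 * X.1 * X.2 + 0 * X.2 ^ 2 / 2)) (by fun_prop) JQ
    (fun X _ => SubAt_x (by positivity)) (fun X hX => by
      have h1 := hb X hX
      have h2 := xb X (frontier_subset_closure hX)
      nlinarith) X hX
  have e : η * (R ^ 2 + 1) = ε := by rw [hη]; field_simp
  nlinarith [mul_nonneg η0.le (sq_nonneg X.1)]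

/-- interior Lipschitz estimate for good functions -/
theorem good_lip (K : ℝ) (hK : 1 ≤ K) : ∃ C : ℝ, 0 < C ∧ ∀ (U : Set (ℝ × ℝ)) (w : ℝ × ℝ → ℝ) (X0 : ℝ × ℝ) (ρ M : ℝ),
    Good K U w → 0 < ρ → 0 < M → closedBall X0 ρ ⊆ U → (∀ X ∈ closedBall X0 ρ, |w X| ≤ M) →
    ∀ X, ‖X - X0‖ ≤ ρ / 4 → |w X - w X0| ≤ C * M * (‖X - X0‖ / ρ) := by
  obtain ⟨γ, C, hγ, hγ2, hC, H⟩ := interior1 K hK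
  refine ⟨6 * C, by positivity, ?_⟩
  intro U w X0 ρ M hg hρ hM hU hw X hX
  refine le_of_forall_pos_le_add fun ε hε => ?_
  obtain ⟨V, hV, hCV, w', p', q', a', b', c', J', hs', hw'⟩ := hg _ hU (isCompact_closedBall X0 ρ) (min M (ε / 2)) (by positivity)
  have sub : ball X0 ρ ⊆ V := ball_subset_closedBall.trans hCV
  obtain ⟨g1, g2, g3⟩ := H w' p' q' a' b' c' X0 ρ (2 * M) hρ (by positivity) (J'.mono sub) (fun X hX => hs' X (sub hX)) (by
    intro Z hZ
    have h1 := hw Z (ball_subset_closedBall hZ)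
    have h2 := (hw' Z (ball_subset_closedBall hZ)).trans_le (min_le_left _ _)
    rw [abs_le] at *; rw [abs_lt] at h2
    constructor <;> linarith)
  have g4 := g3 X hX
  have mX : X ∈ closedBall X0 ρ := by rw [mem_closedBall, dist_eq_norm]; linarith
  have h1 := abs_lt.1 ((hw' X mX).trans_le (min_le_right _ _))
  have h2 := abs_lt.1 ((hw' X0 (mem_closedBall_self hρ.le)).trans_le (min_le_right _ _))
  set r := ‖X - X0‖ / ρ with hr
  have r0 : 0 ≤ r := by positivity
  have r1 : r ≤ 1 := by rw [hr, div_le_one hρ]; linarith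
  have rr : r ^ (1 + γ) ≤ r := by
    calc r ^ (1 + γ) ≤ r ^ (1:ℝ) := Real.rpow_le_rpow_of_exponent_ge' r0 r1 (by norm_num) (by linarith)
      _ = r := Real.rpow_one r
  have k1 : |p' X0 * (X.1 - X0.1)| ≤ C * (2 * M) / ρ * ‖X - X0‖ := by
    rw [abs_mul]; gcongr; exact abs_fst_le (X - X0)
  have k2 : |q' X0 * (X.2 - X0.2)| ≤ C * (2 * M) / ρ * ‖X - X0‖ := by
    rw [abs_mul]; gcongr; exact abs_snd_le (X - X0)
  have k3 : C * (2 * M) / ρ * ‖X - X0‖ = C * (2 * M) * r := by rw [hr]; ring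
  have k4 : C * (2 * M) * r ^ (1 + γ) ≤ C * (2 * M) * r := by gcongr
  rw [k3] at k1 k2
  rw [abs_le] at *
  constructor <;> linarith [k1.1, k1.2, k2.1, k2.2, g4.1, g4.2]

end PW

namespace PW
open Filter MeasureTheory
open scoped Topology

lemma compare' {K σ : ℝ} (hK : 1 ≤ K) (hσ : 0 < σ) {U D E : Set (ℝ × ℝ)} (hD : IsOpen D) (hDE : D ⊆ E) (hE : IsCompact E) (hDU : D ⊆ U)
    {w ψ p q a b c : ℝ × ℝ → ℝ} (hw : Good K U w) (cw : ContinuousOn w E) (cψ : ContinuousOn ψ E)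
    (J : JetOn D ψ p q a b c) (hs : ∀ X ∈ D, SubAt K σ (a X) (b X) (c X))
    (hb : ∀ X ∈ E, X ∉ D → ψ X ≤ w X) : ∀ X ∈ E, ψ X ≤ w X := by
  have hcl : closure D ⊆ E := closure_minimal hDE hE.isClosed
  intro X hX
  by_cases hXD : X ∈ D
  · refine compare hK hσ hD (hE.isBounded.subset hDE) hDU hw (cw.mono hcl) (cψ.mono hcl) J hs ?_ X (subset_closure hXD)
    intro Y hY
    exact hb Y (hcl hY.1) (by have := hY.2; rwa [hD.interior_eq] at this)
  · exact hb X hX hXD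

def Om : Set (ℝ × ℝ) := {X | X.1 ^ 2 + X.2 ^ 2 < 2 * X.2}
def Omc : Set (ℝ × ℝ) := {X | X.1 ^ 2 + X.2 ^ 2 ≤ 2 * X.2}

lemma Om_open : IsOpen Om := isOpen_lt (by fun_prop) (by fun_prop)
lemma Omc_closed : IsClosed Omc := isClosed_le (by fun_prop) (by fun_prop)
lemma Om_sub : Om ⊆ Omc := by
  intro X hX
  simp only [Om, Omc, mem_setOf_eq] at *
  exact hX.le

lemma Omc_bounds {X : ℝ × ℝ} (h : X ∈ Omc) : 0 ≤ X.2 ∧ X.2 ≤ 2 ∧ |X.1| ≤ 1 := by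
  simp only [Omc, mem_setOf_eq] at h
  refine ⟨by nlinarith [sq_nonneg X.1, sq_nonneg X.2], by nlinarith [sq_nonneg X.1, sq_nonneg X.2], ?_⟩
  exact abs_le_one_iff_mul_self_le_one.2 (by nlinarith [sq_nonneg (X.2 - 1)])

lemma Omc_compact : IsCompact Omc := by
  refine (isCompact_closedBall (0 : ℝ × ℝ) 2).of_isClosed_subset Omc_closed ?_
  intro X hX
  obtain ⟨h1, h2, h3⟩ := Omc_bounds hX
  simp only [mem_closedBall, dist_zero_right, Prod.norm_def, Real.norm_eq_abs, sup_le_iff]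
  exact ⟨by linarith, abs_le.2 ⟨by linarith, h2⟩⟩

lemma SubAt_diag {K A B : ℝ} (hA : 0 ≤ A) (hK : 0 ≤ K) {σ : ℝ} (hσ : 0 ≤ σ) (h : 2 * K * A + σ ≤ B) : SubAt K σ (-A) 0 B := by
  have hB : 0 ≤ B := le_trans (by positivity) h
  exact ⟨A, 0, 1, hA, by norm_num, fun v1 v2 => by nlinarith [mul_nonneg (add_nonneg hA hB) (sq_nonneg v2)], by nlinarith⟩

/-- first boundary barrier -/
lemma barrier0 {K : ℝ} (hK : 1 ≤ K) {w : ℝ × ℝ → ℝ} (hg : Good K Om w) (cw : ContinuousOn w Omc) {r η η' : ℝ}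
    (hr : 0 < r) (hη : 0 < η) (hη' : 0 ≤ η') (h1 : ∀ X ∈ Omc, |X.1| ≤ r → X.2 ≤ r → -η ≤ w X)
    (h2 : ∀ X ∈ Omc, X ∉ Om → |X.1| ≤ r → X.2 ≤ r → -η' ≤ w X) :
    ∀ X ∈ Omc, |X.1| ≤ r / 2 → X.2 ≤ r / 2 → -η' - (16 * K + 2) * (η / r) * X.2 ≤ w X := by
  intro X1 hX1 hx1 hy1
  set D : Set (ℝ × ℝ) := Om ∩ ({X | |X.1| < r} ∩ {X | X.2 < r}) with hD
  set E : Set (ℝ × ℝ) := Omc ∩ ({X | |X.1| ≤ r} ∩ {X | X.2 ≤ r}) with hE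
  have oD : IsOpen D := Om_open.inter ((isOpen_lt (by fun_prop) (by fun_prop)).inter (isOpen_lt (by fun_prop) (by fun_prop)))
  have cE : IsCompact E := Omc_compact.inter_right ((isClosed_le (by fun_prop) (by fun_prop)).inter (isClosed_le (by fun_prop) (by fun_prop)))
  have DE : D ⊆ E := fun X hX => ⟨Om_sub hX.1, (show |X.1| < r from hX.2.1).le, (show X.2 < r from hX.2.2).le⟩
  set ψ : ℝ × ℝ → ℝ := fun X => (-η' - η * 4 * X1.1 ^ 2 / r ^ 2) + (8 * η * X1.1 / r ^ 2) * X.1 + (-2 * (8 * K + 1) * η / r) * X.2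
     + (-(8 * η / r ^ 2) * X.1 ^ 2 / 2 + 0 * X.1 * X.2 + (2 * (8 * K + 1) * η / r ^ 2) * X.2 ^ 2 / 2) with hψ
  have JQ := JetOn.quad D (-η' - η * 4 * X1.1 ^ 2 / r ^ 2) (8 * η * X1.1 / r ^ 2) (-2 * (8 * K + 1) * η / r) (-(8 * η / r ^ 2)) 0 (2 * (8 * K + 1) * η / r ^ 2)
  have val : ∀ X, ψ X = -η' - η * (4 * ((X.1 - X1.1) / r) ^ 2 + (8 * K + 1) * (X.2 / r) * (2 - X.2 / r)) := by
    intro X; simp only [hψ]; field_simp; ring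
  have cψ : Continuous ψ := by simp only [hψ]; fun_prop
  have main := compare' (σ := 2 * η / r ^ 2) hK (by positivity) oD DE cE (fun X hX => hX.1) hg (cw.mono inter_subset_left) (ψ := ψ) cψ.continuousOn JQ (by
      intro X _
      exact SubAt_diag (by positivity) (by linarith) (by positivity) (le_of_eq (by ring))) (by
      intro X hX hXD
      obtain ⟨a1, a2, a3⟩ := hX
      simp only [mem_setOf_eq] at a2 a3
      obtain ⟨b1, b2, b3⟩ := Omc_bounds a1
      have y0 : 0 ≤ X.2 / r := by positivity
      have y1 : X.2 / r ≤ 1 := by rw [div_le_one hr]; exact a3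
      have n1 : 0 ≤ (8 * K + 1) * (X.2 / r) * (2 - X.2 / r) := by
        have : 0 ≤ 2 - X.2 / r := by linarith
        have : 0 ≤ 8 * K + 1 := by linarith
        positivity
      rw [val]
      by_cases c1 : X ∈ Om
      · by_cases c2 : |X.1| < r
        · have c3 : X.2 = r := by
            by_contra hne
            exact hXD ⟨c1, c2, lt_of_le_of_ne a3 hne⟩
          have e1 : X.2 / r = 1 := by rw [c3]; field_simp
          have := h1 X a1 a2 a3
          rw [e1]
          nlinarith [sq_nonneg ((X.1 - X1.1) / r), mul_nonneg hη.le (sq_nonneg ((X.1 - X1.1) / r)), mul_nonneg hη.le (sub_nonneg.2 hK)]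
        · have c3 : |X.1| = r := le_antisymm a2 (not_lt.1 c2)
          have : (1/2 : ℝ) ≤ |(X.1 - X1.1) / r| := by
            rw [abs_div, abs_of_pos hr, le_div_iff₀ hr]
            have := abs_sub_abs_le_abs_sub X.1 X1.1
            linarith
          have h4 : 1 ≤ 4 * ((X.1 - X1.1) / r) ^ 2 := by
            rw [← sq_abs]; nlinarith
          have := h1 X a1 a2 a3
          nlinarith [mul_nonneg hη.le n1]
      · have := h2 X a1 c1 a2 a3
        nlinarith [mul_nonneg hη.le n1, mul_nonneg hη.le (sq_nonneg ((X.1 - X1.1) / r))]) X1 ⟨hX1, by simp only [mem_setOf_eq]; linarith, by simp only [mem_setOf_eq]; linarith⟩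
  rw [val] at main
  refine le_trans ?_ main
  have y0 : 0 ≤ X1.2 / r := div_nonneg (Omc_bounds hX1).1 hr.le
  have : (16 * K + 2) * (η / r) * X1.2 = η * ((8 * K + 1) * (X1.2 / r) * 2) := by ring
  rw [this]
  simp only [sub_self, zero_div]
  have : 0 ≤ η * ((8 * K + 1) * (X1.2 / r) * (X1.2 / r)) := by
    have : 0 ≤ 8 * K + 1 := by linarith
    positivity
  nlinarith

/-- jets of a Gaussian -/
lemma JetOn.gauss (V : Set (ℝ × ℝ)) (k l A x1 y1 : ℝ) :
    JetOn V (fun X => k * Real.exp (-A * ((X.1 - x1) ^ 2 + (X.2 - y1) ^ 2)) + l)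
      (fun X => k * Real.exp (-A * ((X.1 - x1) ^ 2 + (X.2 - y1) ^ 2)) * (-2 * A * (X.1 - x1)))
      (fun X => k * Real.exp (-A * ((X.1 - x1) ^ 2 + (X.2 - y1) ^ 2)) * (-2 * A * (X.2 - y1)))
      (fun X => k * Real.exp (-A * ((X.1 - x1) ^ 2 + (X.2 - y1) ^ 2)) * (4 * A ^ 2 * (X.1 - x1) ^ 2 - 2 * A))
      (fun X => k * Real.exp (-A * ((X.1 - x1) ^ 2 + (X.2 - y1) ^ 2)) * (4 * A ^ 2 * (X.1 - x1) * (X.2 - y1)))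
      (fun X => k * Real.exp (-A * ((X.1 - x1) ^ 2 + (X.2 - y1) ^ 2)) * (4 * A ^ 2 * (X.2 - y1) ^ 2 - 2 * A)) := by
  have f1 : ∀ X : ℝ × ℝ, HasFDerivAt (fun X : ℝ × ℝ => X.1 - x1) (LL 1 0) X := fun X =>
    ((hasFDerivAt_fst (𝕜 := ℝ) (p := X)).sub_const x1).congr_fderiv (by apply LL_ext <;> simp)
  have f2 : ∀ X : ℝ × ℝ, HasFDerivAt (fun X : ℝ × ℝ => X.2 - y1) (LL 0 1) X := fun X =>
    ((hasFDerivAt_snd (𝕜 := ℝ) (p := X)).sub_const y1).congr_fderiv (by apply LL_ext <;> simp)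
  have g : ∀ X : ℝ × ℝ, HasFDerivAt (fun X : ℝ × ℝ => k * Real.exp (-A * ((X.1 - x1) ^ 2 + (X.2 - y1) ^ 2)))
     (LL (k * Real.exp (-A * ((X.1 - x1) ^ 2 + (X.2 - y1) ^ 2)) * (-2 * A * (X.1 - x1))) (k * Real.exp (-A * ((X.1 - x1) ^ 2 + (X.2 - y1) ^ 2)) * (-2 * A * (X.2 - y1)))) X := by
    intro X
    refine (((((f1 X).pow 2).add ((f2 X).pow 2)).const_mul (-A)).exp.const_mul k).congr_fderiv ?_
    apply LL_ext <;> simp <;> ring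
  refine ⟨fun X _ => (g X).add_const l, fun X _ => ?_, fun X _ => ?_, by fun_prop, by fun_prop, by fun_prop⟩
  · refine ((g X).mul ((f1 X).const_mul (-2 * A))).congr_fderiv ?_
    apply LL_ext <;> simp <;> ring
  · refine ((g X).mul ((f2 X).const_mul (-2 * A))).congr_fderiv ?_
    apply LL_ext <;> simp <;> ring

lemma SubAt_gauss {K k A g d1 d2 σ : ℝ} (hg : 0 < g) (hA : 0 < A) (hd : 2 * K + 2 ≤ 2 * A * (d1 ^ 2 + d2 ^ 2)) (hK : 0 ≤ K)
    (hσ : σ ≤ g * (2 * A)) : SubAt K σ (g * (4 * A ^ 2 * d1 ^ 2 - 2 * A)) (g * (4 * A ^ 2 * d1 * d2)) (g * (4 * A ^ 2 * d2 ^ 2 - 2 * A)) := by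
  set s := d1 ^ 2 + d2 ^ 2 with hs
  have s0 : 0 < s := by
    by_contra h
    push Not at h
    nlinarith
  refine ⟨g * (2 * A), d1 / √s, d2 / √s, by positivity, ?_, ?_, ?_⟩
  · rw [div_pow, div_pow, Real.sq_sqrt s0.le, ← add_div, ← hs, div_self s0.ne']
  · intro v1 v2
    have : 0 ≤ g * (4 * A ^ 2) * (d1 * v1 + d2 * v2) ^ 2 := by positivity
    nlinarith
  · have e : g * (4 * A ^ 2 * d1 ^ 2 - 2 * A) * (d1 / √s) ^ 2 + 2 * (g * (4 * A ^ 2 * d1 * d2)) * (d1 / √s) * (d2 / √s) + g * (4 * A ^ 2 * d2 ^ 2 - 2 * A) * (d2 / √s) ^ 2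
      = g * (2 * A) * (2 * A * s - 1) := by
      have e1 : (d1 / √s) ^ 2 = d1 ^ 2 / s := by rw [div_pow, Real.sq_sqrt s0.le]
      have e2 : (d2 / √s) ^ 2 = d2 ^ 2 / s := by rw [div_pow, Real.sq_sqrt s0.le]
      have e3 : 2 * (g * (4 * A ^ 2 * d1 * d2)) * (d1 / √s) * (d2 / √s) = 2 * (g * (4 * A ^ 2 * d1 * d2)) * (d1 * d2) / s := by
        rw [mul_assoc _ (d1 / √s), div_mul_div_comm, Real.mul_self_sqrt s0.le]; ring
      rw [e1, e2, e3]
      field_simp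
      rw [hs]; ring
    rw [e]
    nlinarith [mul_le_mul_of_nonneg_left hd (by positivity : 0 ≤ g * (2 * A))]

end PW

namespace PW
open Filter MeasureTheory
open scoped Topology


set_option maxHeartbeats 1000000 in
lemma barrier1 {K κ : ℝ} (hK : 1 ≤ K) (hκ : 0 < κ) (hκ8 : κ ≤ 1 / 8) {w : ℝ × ℝ → ℝ} (hg : Good K Om w) (cw : ContinuousOn w Omc) {r η η' μ A : ℝ}
    (hA : A = (K + 1) / (4 * κ ^ 2))
    (hr : 0 < r) (hr1 : r ≤ 1) (hη : 0 < η) (hη' : 0 ≤ η') (hμ : 0 < μ) (h1 : ∀ X ∈ Omc, |X.1| ≤ r → X.2 ≤ r → -η ≤ w X)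
    (h2 : ∀ X ∈ Omc, X ∉ Om → |X.1| ≤ r → X.2 ≤ r → -η' ≤ w X)
    (h3 : ∀ X : ℝ × ℝ, |X.1| ≤ κ * r → |X.2 - r / 4| ≤ κ * r → μ * r - η ≤ w X) :
    ∀ X ∈ Omc, |X.1| ≤ κ / 2 * r → X.2 ≤ κ / 2 * r →
      (4 * A * Real.exp (-A) * μ - (16 * K + 2) * (η / r)) * X.2 - η' - 2 * A * μ * r ^ 2 ≤ w X := by
  intro X1 hX1 hx1 hy1
  have A0 : 0 < A := by rw [hA]; positivity
  have b0 := barrier0 hK hg cw hr hη hη' h1 h2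
  have κr : κ * r ≤ r / 8 := by nlinarith
  set d2 : ℝ × ℝ → ℝ := fun X => (X.1 - X1.1) ^ 2 + (X.2 - r / 4) ^ 2 with hd2
  have cd : Continuous d2 := by simp only [hd2]; fun_prop
  set D : Set (ℝ × ℝ) := Om ∩ ({X | (κ * r / 2) ^ 2 < d2 X} ∩ {X | d2 X < (r / 4) ^ 2}) with hD
  set E : Set (ℝ × ℝ) := Omc ∩ ({X | (κ * r / 2) ^ 2 ≤ d2 X} ∩ {X | d2 X ≤ (r / 4) ^ 2}) with hE
  have oD : IsOpen D := Om_open.inter ((isOpen_lt (by fun_prop) (by fun_prop)).inter (isOpen_lt (by fun_prop) (by fun_prop)))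
  have cE : IsCompact E := Omc_compact.inter_right ((isClosed_le (by fun_prop) (by fun_prop)).inter (isClosed_le (by fun_prop) (by fun_prop)))
  have DE : D ⊆ E := fun X hX => ⟨Om_sub hX.1, (show (κ * r / 2) ^ 2 < d2 X from hX.2.1).le, (show d2 X < (r / 4) ^ 2 from hX.2.2).le⟩
  set p : ℝ × ℝ → ℝ := fun X => 1 * w X + (η' + 0 * X.1 + (16 * K + 2) * (η / r) * X.2) with hp
  have gp : Good K Om p := hg.affine 1 η' 0 ((16 * K + 2) * (η / r))
  have cp : ContinuousOn p Omc := by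
    simp only [hp]; fun_prop
  set ψ : ℝ × ℝ → ℝ := fun X => (μ * r) * Real.exp (-(16 * A / r ^ 2) * ((X.1 - X1.1) ^ 2 + (X.2 - r / 4) ^ 2)) + (-(μ * r * Real.exp (-A)) - 2 * A * μ * r ^ 2) with hψ
  have JG := JetOn.gauss D (μ * r) (-(μ * r * Real.exp (-A)) - 2 * A * μ * r ^ 2) (16 * A / r ^ 2) X1.1 (r / 4)
  have cψ : Continuous ψ := by simp only [hψ]; fun_prop
  have coef : 0 ≤ (16 * K + 2) * (η / r) := by
    have : 0 ≤ 16 * K + 2 := by linarith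
    positivity
  have ppos : ∀ X ∈ E, |X.1| ≤ r / 2 ∧ X.2 ≤ r / 2 ∧ 0 ≤ p X := by
    intro X hX
    obtain ⟨a1, a2, a3⟩ := hX
    simp only [mem_setOf_eq, hd2] at a2 a3
    have i1 : |X.1 - X1.1| ≤ r / 4 := abs_le_of_sq_le_sq (by nlinarith [sq_nonneg (X.2 - r / 4)]) (by positivity)
    have i2 : |X.2 - r / 4| ≤ r / 4 := abs_le_of_sq_le_sq (by nlinarith [sq_nonneg (X.1 - X1.1)]) (by positivity)
    have i3 : |X.1| ≤ r / 2 := by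
      rw [abs_le] at *; constructor <;> linarith
    have i4 : X.2 ≤ r / 2 := by rw [abs_le] at i2; linarith
    refine ⟨i3, i4, ?_⟩
    have := b0 X a1 i3 i4
    simp only [hp]; linarith
  have main := compare' (σ := μ * r * Real.exp (-A) * (2 * (16 * A / r ^ 2))) hK (by positivity) oD DE cE (fun X hX => hX.1) gp (cp.mono inter_subset_left) (ψ := ψ) cψ.continuousOn JG (by
      intro X hX
      have a2 : (κ * r / 2) ^ 2 < d2 X := hX.2.1
      have a3 : d2 X < (r / 4) ^ 2 := hX.2.2
      refine SubAt_gauss (k := 0) (by positivity) (by positivity) ?_ (by linarith) ?_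
      · have : 2 * (16 * A / r ^ 2) * (κ * r / 2) ^ 2 = 2 * K + 2 := by
          rw [hA]; field_simp; ring
        rw [← this]
        exact mul_le_mul_of_nonneg_left a2.le (by positivity)
      · have : Real.exp (-A) ≤ Real.exp (-(16 * A / r ^ 2) * ((X.1 - X1.1) ^ 2 + (X.2 - r / 4) ^ 2)) := by
          apply Real.exp_le_exp.2
          have : (16 * A / r ^ 2) * d2 X ≤ (16 * A / r ^ 2) * (r / 4) ^ 2 := by gcongr
          have e : (16 * A / r ^ 2) * (r / 4) ^ 2 = A := by field_simp; norm_num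
          rw [e] at this
          simp only [hd2] at this
          linarith
        gcongr) (by
      intro X hX hXD
      obtain ⟨i1, i2, i3⟩ := ppos X hX
      obtain ⟨a1, a2, a3⟩ := hX
      simp only [mem_setOf_eq] at a2 a3
      obtain ⟨y0, y2, -⟩ := Omc_bounds a1
      set s := d2 X / (r / 4) ^ 2 with hs
      have s1 : s ≤ 1 := by rw [hs, div_le_one (by positivity)]; exact a3
      have s0 : 0 ≤ s := by simp only [hs, hd2]; positivity
      have ψe : ψ X = μ * r * (Real.exp (-A * s) - Real.exp (-A)) - 2 * A * μ * r ^ 2 := by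
        have : -(16 * A / r ^ 2) * ((X.1 - X1.1) ^ 2 + (X.2 - r / 4) ^ 2) = -A * s := by
          simp only [hs, hd2]; field_simp; norm_num
        simp only [hψ]
        rw [this]; ring
      have es : Real.exp (-A * s) ≤ 1 := Real.exp_le_one_iff.2 (by nlinarith)
      have exA := Real.exp_pos (-A)
      have m0 : 0 < μ * r := by positivity
      have A2 : 0 ≤ 2 * A * μ * r ^ 2 := by positivity
      by_cases c1 : X ∈ Om
      · by_cases c2 : (κ * r / 2) ^ 2 < d2 X
        · have c3 : d2 X = (r / 4) ^ 2 := by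
            by_contra hne
            exact hXD ⟨c1, c2, lt_of_le_of_ne a3 hne⟩
          have : s = 1 := by rw [hs, c3]; field_simp
          rw [ψe, this]
          simp only [mul_one, sub_self, mul_zero, zero_sub]
          linarith
        · have c3 : d2 X ≤ (κ * r / 2) ^ 2 := not_lt.1 c2
          simp only [hd2] at c3
          have j1 : |X.1 - X1.1| ≤ κ * r / 2 := abs_le_of_sq_le_sq (by nlinarith [sq_nonneg (X.2 - r / 4)]) (by positivity)
          have j2 : |X.2 - r / 4| ≤ κ * r / 2 := abs_le_of_sq_le_sq (by nlinarith [sq_nonneg (X.1 - X1.1)]) (by positivity)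
          have j3 : |X.1| ≤ κ * r := by
            rw [abs_le] at *; constructor <;> linarith
          have := h3 X j3 (by linarith [mul_pos hκ hr])
          have j4 : r / 8 ≤ X.2 := by rw [abs_le] at j2; linarith
          have j5 : η ≤ (16 * K + 2) * (η / r) * X.2 := by
            calc η ≤ (16 * K + 2) * (η / r) * (r / 8) := by
                  have : (16 * K + 2) * (η / r) * (r / 8) = (16 * K + 2) / 8 * η := by field_simp
                  rw [this]; nlinarith
              _ ≤ _ := by gcongr
          have : μ * r * (Real.exp (-A * s) - Real.exp (-A)) ≤ μ * r * 1 := by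
            apply mul_le_mul_of_nonneg_left _ m0.le; linarith
          rw [ψe]; simp only [hp]; linarith
      · have k1 : 2 * X.2 ≤ X.1 ^ 2 + X.2 ^ 2 := by
          simpa [Om] using c1
        have k2 : X.2 ≤ X.1 ^ 2 := by nlinarith
        have k3 : X.1 ^ 2 ≤ (r / 2) ^ 2 := by rw [← sq_abs]; gcongr
        have k4 : X.2 ≤ r ^ 2 / 4 := by nlinarith
        have k5 : 1 - 2 * r ≤ s := by
          rw [hs, le_div_iff₀ (by positivity)]
          simp only [hd2]
          nlinarith [sq_nonneg (X.1 - X1.1), sq_nonneg X.2]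
        have k6 : Real.exp (-A * s) - Real.exp (-A) ≤ A * (1 - s) := by
          have e1 : Real.exp (-A) = Real.exp (-A * s) * Real.exp (-(A * (1 - s))) := by
            rw [← Real.exp_add]; ring_nf
          have e2 := Real.add_one_le_exp (-(A * (1 - s)))
          have e3 := Real.exp_pos (-A * s)
          have e4 : 0 ≤ A * (1 - s) := mul_nonneg A0.le (by linarith)
          rw [e1]
          nlinarith [mul_le_mul_of_nonneg_left e2 e3.le]
        have k7 : A * (1 - s) ≤ A * (2 * r) := by gcongr; linarith
        have k8 : μ * r * (Real.exp (-A * s) - Real.exp (-A)) ≤ μ * r * (A * (2 * r)) := by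
          gcongr; linarith
        rw [ψe]; nlinarith) X1 ?_
  · have z0 : 0 ≤ X1.2 := (Omc_bounds hX1).1
    set z := 4 * X1.2 / r with hz
    have z1 : 0 ≤ z := by positivity
    have z2 : z ≤ 1 := by
      rw [hz, div_le_one hr]; nlinarith
    have e1 : -(16 * A / r ^ 2) * ((X1.1 - X1.1) ^ 2 + (X1.2 - r / 4) ^ 2) = -A + A * (z * (2 - z)) := by
      rw [hz]; field_simp; ring
    have e2 : ψ X1 = μ * r * (Real.exp (-A) * Real.exp (A * (z * (2 - z))) - Real.exp (-A)) - 2 * A * μ * r ^ 2 := by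
      simp only [hψ]
      rw [e1, Real.exp_add]; ring
    have e3 := Real.add_one_le_exp (A * (z * (2 - z)))
    have e4 : z ≤ z * (2 - z) := by nlinarith
    have e5 : A * z ≤ A * (z * (2 - z)) := by gcongr
    have e6 : Real.exp (-A) * (A * z) ≤ Real.exp (-A) * Real.exp (A * (z * (2 - z))) - Real.exp (-A) := by
      have := mul_le_mul_of_nonneg_left (le_trans (add_le_add_left e5 1) e3) (Real.exp_pos (-A)).le
      linarith
    have e7 : μ * r * (Real.exp (-A) * (A * z)) ≤ μ * r * (Real.exp (-A) * Real.exp (A * (z * (2 - z))) - Real.exp (-A)) := by gcongr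
    have e8 : μ * r * (Real.exp (-A) * (A * z)) = 4 * A * Real.exp (-A) * μ * X1.2 := by
      rw [hz]; field_simp
    rw [e2] at main
    simp only [hp] at main
    linarith
  · refine ⟨hX1, ?_, ?_⟩
    · simp only [mem_setOf_eq, hd2, sub_self]
      have : κ * r / 2 ≤ r / 4 - X1.2 := by linarith
      have h0 : 0 ≤ κ * r / 2 := by positivity
      nlinarith
    · simp only [mem_setOf_eq, hd2, sub_self]
      have z0 : 0 ≤ X1.2 := (Omc_bounds hX1).1
      nlinarith

end PW

namespace PW
open Filter MeasureTheory
open scoped Topology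

lemma step_one {K κ C : ℝ} (hK : 1 ≤ K) (hκ : 0 < κ) (hκ32 : κ ≤ 1 / 32) (hC : 0 < C) (hκC : 8 * C * κ ≤ 1 / 16)
    (HL : ∀ (U : Set (ℝ × ℝ)) (w : ℝ × ℝ → ℝ) (X0 : ℝ × ℝ) (ρ M : ℝ),
    Good K U w → 0 < ρ → 0 < M → closedBall X0 ρ ⊆ U → (∀ X ∈ closedBall X0 ρ, |w X| ≤ M) →
    ∀ X, ‖X - X0‖ ≤ ρ / 4 → |w X - w X0| ≤ C * M * (‖X - X0‖ / ρ))
    {w : ℝ × ℝ → ℝ} (hg : Good K Om w) (cw : ContinuousOn w Omc) {r η η' G A : ℝ}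
    (hA : A = (K + 1) / (4 * κ ^ 2))
    (hr : 0 < r) (hr1 : r ≤ 1) (hη : 0 < η) (hη' : 0 ≤ η') (hG : 0 < G)
    (h1 : ∀ X ∈ Omc, |X.1| ≤ r → X.2 ≤ r → -η ≤ w X ∧ w X ≤ G * X.2 + η)
    (h2 : ∀ X ∈ Omc, X ∉ Om → |X.1| ≤ r → X.2 ≤ r → -η' ≤ w X)
    (h3 : G * r / 8 ≤ w (0, r / 4)) :
    ∀ X ∈ Omc, |X.1| ≤ κ / 2 * r → X.2 ≤ κ / 2 * r →
      (4 * A * Real.exp (-A) * (G / 16) - (16 * K + 2) * (η / r)) * X.2 - η' - 2 * A * (G / 16) * r ^ 2 ≤ w X := by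
  refine barrier1 hK hκ (by linarith) hg cw hA hr hr1 hη hη' (by positivity) (fun X a b c => (h1 X a b c).1) h2 ?_
  have ball_mem : ∀ X : ℝ × ℝ, X ∈ closedBall ((0, r / 4) : ℝ × ℝ) (r / 8) → |X.1| ≤ r / 8 ∧ r / 8 ≤ X.2 ∧ X.2 ≤ 3 * r / 8 := by
    intro X hX
    rw [mem_closedBall, dist_eq_norm] at hX
    have a1 := (abs_fst_le _).trans hX
    have a2 := (abs_snd_le _).trans hX
    simp only [Prod.fst_sub, Prod.snd_sub, sub_zero] at a1 a2
    rw [abs_le] at a2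
    exact ⟨a1, by linarith, by linarith⟩
  have ball_sub : closedBall ((0, r / 4) : ℝ × ℝ) (r / 8) ⊆ Om := by
    intro X hX
    obtain ⟨a1, a2, a3⟩ := ball_mem X hX
    simp only [Om, mem_setOf_eq]
    have : X.1 ^ 2 ≤ (r / 8) ^ 2 := by rw [← sq_abs]; gcongr
    nlinarith
  intro X hx hy
  have hn : ‖X - (0, r / 4)‖ ≤ κ * r := by
    simp only [Prod.norm_def, Real.norm_eq_abs, sup_le_iff, Prod.fst_sub, Prod.snd_sub, sub_zero]
    exact ⟨hx, hy⟩
  have := HL Om w (0, r / 4) (r / 8) (G * r + η) hg (by positivity) (by positivity) ball_sub (by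
    intro X hX
    obtain ⟨a1, a2, a3⟩ := ball_mem X hX
    obtain ⟨b1, b2⟩ := h1 X (Om_sub (ball_sub hX)) (by linarith) (by linarith)
    rw [abs_le]
    constructor <;> nlinarith [mul_pos hG hr]) X (by nlinarith)
  have e : C * (G * r + η) * (‖X - (0, r / 4)‖ / (r / 8)) ≤ (G * r + η) / 16 := by
    calc C * (G * r + η) * (‖X - (0, r / 4)‖ / (r / 8)) ≤ C * (G * r + η) * (κ * r / (r / 8)) := by gcongr
      _ = (8 * C * κ) * (G * r + η) := by field_simp
      _ ≤ 1 / 16 * (G * r + η) := by gcongr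
      _ = _ := by ring
  have := abs_le.1 (this.trans e)
  linarith [this.1]

lemma Good.neg {K : ℝ} {U : Set (ℝ × ℝ)} {w : ℝ × ℝ → ℝ} (h : Good K U w) (M : ℝ) : Good K U (fun X => M * X.2 - w X) :=
  (h.affine (-1) 0 0 M).congr fun X _ => by ring

lemma Good.subl {K : ℝ} {U : Set (ℝ × ℝ)} {w : ℝ × ℝ → ℝ} (h : Good K U w) (m : ℝ) : Good K U (fun X => w X - m * X.2) :=
  (h.affine 1 0 0 (-m)).congr fun X _ => by ring

lemma K_step (K : ℝ) (hK : 1 ≤ K) : ∃ δ c Ca : ℝ, 0 < δ ∧ δ ≤ 1 / 16 ∧ 0 < c ∧ c < 1 ∧ 0 < Ca ∧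
    ∀ w : ℝ × ℝ → ℝ, Good K Om w → ContinuousOn w Omc → ∀ r η η' m M : ℝ, 0 < r → r ≤ 1 → 0 < η → 0 ≤ η' → m < M →
    (∀ X ∈ Omc, |X.1| ≤ r → X.2 ≤ r → m * X.2 - η ≤ w X ∧ w X ≤ M * X.2 + η) →
    (∀ X ∈ Omc, X ∉ Om → |X.1| ≤ r → X.2 ≤ r → m * X.2 - η' ≤ w X ∧ w X ≤ M * X.2 + η') →
    ∃ m' M' : ℝ, m - (16 * K + 2) * (η / r) ≤ m' ∧ M' ≤ M + (16 * K + 2) * (η / r) ∧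
      |m' - m| ≤ (M - m) + (16 * K + 2) * (η / r) ∧ M' - m' = (1 - c) * (M - m) + 2 * ((16 * K + 2) * (η / r)) ∧
      ∀ X ∈ Omc, |X.1| ≤ δ * r → X.2 ≤ δ * r → m' * X.2 - (η' + Ca * (M - m) * r ^ 2) ≤ w X ∧
        w X ≤ M' * X.2 + (η' + Ca * (M - m) * r ^ 2) := by
  obtain ⟨C, hC, HL⟩ := good_lip K hK
  set κ := min (1 / 32) (1 / (128 * C)) with hκ
  have κ0 : 0 < κ := by positivity
  have κ1 : κ ≤ 1 / 32 := min_le_left _ _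
  have κ2 : 8 * C * κ ≤ 1 / 16 := by
    calc 8 * C * κ ≤ 8 * C * (1 / (128 * C)) := by gcongr; exact min_le_right _ _
      _ = 1 / 16 := by field_simp; norm_num
  set A := (K + 1) / (4 * κ ^ 2) with hA
  have A0 : 0 < A := by positivity
  have hAe : A * Real.exp (-A) ≤ 1 := by
    have := Real.add_one_le_exp A
    rw [Real.exp_neg, ← div_eq_mul_inv, div_le_one (Real.exp_pos A)]
    linarith
  refine ⟨κ / 2, A * Real.exp (-A) / 4, A / 8, by positivity, by linarith, by positivity, by linarith, by positivity, ?_⟩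
  intro w hg cw r η η' m M hr hr1 hη hη' hmM h1 h2
  set τ := (16 * K + 2) * (η / r) with hτ
  have τ0 : 0 ≤ τ := by
    have : 0 ≤ 16 * K + 2 := by linarith
    positivity
  set c := A * Real.exp (-A) / 4 with hc
  have c0 : 0 < c := by positivity
  have gp := hg.subl m
  have gq := hg.neg M
  have cp : ContinuousOn (fun X => w X - m * X.2) Omc := by fun_prop
  have cq : ContinuousOn (fun X => M * X.2 - w X) Omc := by fun_prop
  have G0 : 0 < M - m := by linarith
  have Ca0 : 0 ≤ A / 8 * (M - m) * r ^ 2 := by positivity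
  have dr : κ / 2 * r ≤ r / 2 := by nlinarith
  have cG : c * (M - m) ≤ M - m := by nlinarith
  have cG0 : 0 ≤ c * (M - m) := by positivity
  rcases le_total ((M - m) * r / 8) (w (0, r / 4) - m * (r / 4)) with hcase | hcase
  · refine ⟨m + c * (M - m) - τ, M + τ, by linarith, le_refl _, ?_, by ring, ?_⟩
    · rw [abs_le]; constructor <;> linarith
    · intro X hX hx hy
      have y0 := (Omc_bounds hX).1
      have s1 := step_one hK κ0 κ1 hC κ2 HL gp cp hA hr hr1 hη hη' G0 (fun X a b c => by
        have := h1 X a b c; constructor <;> linarith [this.1, this.2]) (fun X a b c d => by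
        have := h2 X a b c d; linarith [this.1]) hcase X hX hx hy
      have s2 := barrier0 hK gq cq hr hη hη' (fun X a b c => by
        have := h1 X a b c; linarith [this.1, this.2]) (fun X a b c d => by
        have := h2 X a b c d; linarith [this.2]) X hX (by linarith) (by linarith)
      have e : 4 * A * Real.exp (-A) * ((M - m) / 16) = c * (M - m) := by rw [hc]; ring
      rw [e, ← hτ] at s1
      rw [← hτ] at s2
      constructor
      · linarith
      · linarith
  · have hq : (M - m) * r / 8 ≤ M * (r / 4) - w (0, r / 4) := by linarith
    refine ⟨m - τ, M - c * (M - m) + τ, le_refl _, by linarith, ?_, by ring, ?_⟩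
    · rw [abs_le]; constructor <;> linarith
    · intro X hX hx hy
      have y0 := (Omc_bounds hX).1
      have s1 := step_one hK κ0 κ1 hC κ2 HL gq cq hA hr hr1 hη hη' G0 (fun X a b c => by
        have := h1 X a b c; constructor <;> linarith [this.1, this.2]) (fun X a b c d => by
        have := h2 X a b c d; linarith [this.2]) hq X hX hx hy
      have s2 := barrier0 hK gp cp hr hη hη' (fun X a b c => by
        have := h1 X a b c; linarith [this.1, this.2]) (fun X a b c d => by
        have := h2 X a b c d; linarith [this.1]) X hX (by linarith) (by linarith)
      have e : 4 * A * Real.exp (-A) * ((M - m) / 16) = c * (M - m) := by rw [hc]; ring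
      rw [e, ← hτ] at s1
      rw [← hτ] at s2
      constructor
      · linarith
      · linarith

lemma exists_seq_step {α : Type} (S : ℕ → α → Prop) (R : ℕ → α → α → Prop) (h0 : ∃ a, S 0 a)
    (hs : ∀ k a, S k a → ∃ b, S (k + 1) b ∧ R k a b) : ∃ f : ℕ → α, ∀ k, S k (f k) ∧ R k (f k) (f (k + 1)) := by
  choose! nxt hn using hs
  obtain ⟨a0, ha0⟩ := h0
  let f : ℕ → α := fun k => Nat.rec a0 (fun k a => nxt k a) k
  have hf : ∀ k, S k (f k) := by
    intro k
    induction k with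
    | zero => exact ha0
    | succ k ih => exact (hn k (f k) ih).1
  exact ⟨f, fun k => ⟨hf k, (hn k (f k) (hf k)).2⟩⟩

end PW

namespace PW
open Filter MeasureTheory
open scoped Topology

def StepProp (K δ c Ca : ℝ) : Prop :=
    ∀ w : ℝ × ℝ → ℝ, Good K Om w → ContinuousOn w Omc → ∀ r η η' m M : ℝ, 0 < r → r ≤ 1 → 0 < η → 0 ≤ η' → m < M →
    (∀ X ∈ Omc, |X.1| ≤ r → X.2 ≤ r → m * X.2 - η ≤ w X ∧ w X ≤ M * X.2 + η) →
    (∀ X ∈ Omc, X ∉ Om → |X.1| ≤ r → X.2 ≤ r → m * X.2 - η' ≤ w X ∧ w X ≤ M * X.2 + η') →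
    ∃ m' M' : ℝ, m - (16 * K + 2) * (η / r) ≤ m' ∧ M' ≤ M + (16 * K + 2) * (η / r) ∧
      |m' - m| ≤ (M - m) + (16 * K + 2) * (η / r) ∧ M' - m' = (1 - c) * (M - m) + 2 * ((16 * K + 2) * (η / r)) ∧
      ∀ X ∈ Omc, |X.1| ≤ δ * r → X.2 ≤ δ * r → m' * X.2 - (η' + Ca * (M - m) * r ^ 2) ≤ w X ∧
        w X ≤ M' * X.2 + (η' + Ca * (M - m) * r ^ 2)

lemma bdry_y {X : ℝ × ℝ} {r : ℝ} (hX : X ∈ Omc) (hn : X ∉ Om) (hr1 : r ≤ 1) (hx : |X.1| ≤ r) (hy : X.2 ≤ r) : X.2 ≤ r ^ 2 := by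
  simp only [Om, Omc, mem_setOf_eq, not_lt] at hX hn
  have : X.1 ^ 2 ≤ r ^ 2 := by rw [← sq_abs]; gcongr
  have y0 := (Omc_bounds (X := X) hX).1
  nlinarith

/-- one step of the iteration with all constants explicit -/
lemma K_next {K δ c Ca β L A r m M : ℝ} (hK : 1 ≤ K) (δ0 : 0 < δ) (δ1 : δ ≤ 1 / 16)
    (Ca0 : 0 < Ca) (HS : StepProp K δ c Ca) (β0 : 0 < β) (β1 : β ≤ 1) (hL : 1 ≤ L) (hA : A = (1 + L + 2 * Ca * L) / δ ^ 2)
    {w : ℝ × ℝ → ℝ} (hg : Good K Om w) (cw : ContinuousOn w Omc) (hb : ∀ X ∈ Omc, X ∉ Om → |w X| ≤ ‖X‖ ^ (1 + β))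
    (hr : 0 < r) (hr1 : r ≤ 1) (hmM : m < M) (hm : -L ≤ m) (hM : M ≤ L)
    (h1 : ∀ X ∈ Omc, |X.1| ≤ r → X.2 ≤ r → m * X.2 - A * r ^ (1 + β) ≤ w X ∧ w X ≤ M * X.2 + A * r ^ (1 + β)) :
    ∃ m' M' : ℝ, m - (16 * K + 2) * A * r ^ β ≤ m' ∧ M' ≤ M + (16 * K + 2) * A * r ^ β ∧
      |m' - m| ≤ (M - m) + (16 * K + 2) * A * r ^ β ∧ M' - m' = (1 - c) * (M - m) + 2 * ((16 * K + 2) * A * r ^ β) ∧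
      ∀ X ∈ Omc, |X.1| ≤ δ * r → X.2 ≤ δ * r → m' * X.2 - A * (δ * r) ^ (1 + β) ≤ w X ∧
        w X ≤ M' * X.2 + A * (δ * r) ^ (1 + β) := by
  have A0 : 0 < A := by rw [hA]; positivity
  have er : r ^ (1 + β) = r * r ^ β := by rw [Real.rpow_add hr, Real.rpow_one]
  have rp : 0 < r ^ (1 + β) := by positivity
  have r2 : r ^ 2 ≤ r ^ (1 + β) := by
    rw [← Real.rpow_natCast]
    exact Real.rpow_le_rpow_of_exponent_ge hr hr1 (by norm_num; linarith)
  have hd : δ ^ 2 ≤ δ ^ (1 + β) := by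
    rw [← Real.rpow_natCast]
    exact Real.rpow_le_rpow_of_exponent_ge δ0 (by linarith) (by norm_num; linarith)
  have et : (16 * K + 2) * (A * r ^ (1 + β) / r) = (16 * K + 2) * A * r ^ β := by rw [er]; field_simp
  obtain ⟨m', M', h1', h2', h3', h4', h5'⟩ := HS w hg cw r (A * r ^ (1 + β)) ((1 + L) * r ^ (1 + β)) m M hr hr1 (by positivity) (by positivity)
    hmM h1 (by
      intro X hX hn hx hy
      have y1 := bdry_y hX hn hr1 hx hy
      have y0 := (Omc_bounds hX).1
      have h := hb X hX hn
      have hX1 : ‖X‖ ≤ r := by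
        rw [Prod.norm_def, Real.norm_eq_abs, Real.norm_eq_abs, abs_of_nonneg y0]; exact max_le hx hy
      have h2 : ‖X‖ ^ (1 + β) ≤ r ^ (1 + β) := by gcongr
      have h3 := abs_le.1 (h.trans h2)
      have h4 : -(L * r ^ (1 + β)) ≤ m * X.2 → True := fun _ => trivial
      have : L * X.2 ≤ L * r ^ (1 + β) := by gcongr; linarith
      constructor
      · have : m * X.2 ≤ L * X.2 := by gcongr; linarith
        linarith [h3.1]
      · have : -L * X.2 ≤ M * X.2 := by gcongr; linarith
        linarith [h3.2])
  rw [et] at h1' h2' h3' h4'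
  refine ⟨m', M', h1', h2', h3', h4', fun X hX hx hy => ?_⟩
  obtain ⟨a1, a2⟩ := h5' X hX hx hy
  have key : (1 + L) * r ^ (1 + β) + Ca * (M - m) * r ^ 2 ≤ A * (δ * r) ^ (1 + β) := by
    rw [Real.mul_rpow δ0.le hr.le]
    have : Ca * (M - m) * r ^ 2 ≤ Ca * (2 * L) * r ^ (1 + β) := by
      gcongr; linarith
    calc _ ≤ (1 + L + 2 * Ca * L) * r ^ (1 + β) := by linarith
      _ = A * (δ ^ 2 * r ^ (1 + β)) := by rw [hA]; field_simp
      _ ≤ _ := by gcongr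
  constructor <;> linarith

set_option maxHeartbeats 1000000 in
lemma K_iter {K δ c Ca β L A r0 θ B : ℝ} (hK : 1 ≤ K) (δ0 : 0 < δ) (δ1 : δ ≤ 1 / 16) (c0 : 0 < c) (c1 : c < 1)
    (Ca0 : 0 < Ca) (HS : StepProp K δ c Ca) (β0 : 0 < β) (β1 : β ≤ 1) (hL : 1 ≤ L) (hA : A = (1 + L + 2 * Ca * L) / δ ^ 2)
    (hr0 : 0 < r0) (hr02 : r0 ≤ 1 / 2) (hLr : L = (16 * K + 2) / r0) (hθ : θ = δ ^ β) (θ1 : θ < 1) (θc : 1 - c / 2 ≤ θ)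
    (hB : B = (16 * K + 2) * A * r0 ^ β) (hBL : B / (1 - θ) ≤ L / 2)
    {w : ℝ × ℝ → ℝ} (hg : Good K Om w) (cw : ContinuousOn w Omc) (hw : ∀ X ∈ Omc, |w X| ≤ 1)
    (hb : ∀ X ∈ Omc, X ∉ Om → |w X| ≤ ‖X‖ ^ (1 + β)) :
    ∃ m : ℕ → ℝ, |m 0| ≤ L ∧ (∀ k, |m (k + 1) - m k| ≤ (L + 4 * B / c + B) * θ ^ k) ∧
      ∀ k, ∀ X ∈ Omc, |X.1| ≤ δ ^ k * r0 → X.2 ≤ δ ^ k * r0 →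
        |w X - m k * X.2| ≤ A * (δ ^ k * r0) ^ (1 + β) + (L + 4 * B / c) * θ ^ k * (δ ^ k * r0) := by
  have A0 : 0 < A := by rw [hA]; positivity
  have B0 : 0 < B := by rw [hB]; positivity
  have θ0 : 0 < θ := by rw [hθ]; positivity
  have hq : 0 < 1 - θ := by linarith
  let S : ℕ → ℝ × ℝ → Prop := fun k p => p.1 < p.2 ∧ -(L / 2 + B / (1 - θ) * (1 - θ ^ k)) ≤ p.1 ∧
    p.2 ≤ L / 2 + B / (1 - θ) * (1 - θ ^ k) ∧ p.2 - p.1 ≤ (L + 4 * B / c) * θ ^ k ∧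
    ∀ X ∈ Omc, |X.1| ≤ δ ^ k * r0 → X.2 ≤ δ ^ k * r0 → p.1 * X.2 - A * (δ ^ k * r0) ^ (1 + β) ≤ w X ∧
      w X ≤ p.2 * X.2 + A * (δ ^ k * r0) ^ (1 + β)
  let R : ℕ → ℝ × ℝ → ℝ × ℝ → Prop := fun k p q => |q.1 - p.1| ≤ (L + 4 * B / c + B) * θ ^ k
  have hS0 : ∃ a, S 0 a := by
    refine ⟨(-(L / 2), L / 2), ?_, ?_, ?_, ?_, ?_⟩
    · show -(L / 2) < L / 2; linarith
    · show -(L / 2 + B / (1 - θ) * (1 - θ ^ 0)) ≤ -(L / 2); simp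
    · show (L / 2) ≤ (L / 2 + B / (1 - θ) * (1 - θ ^ 0)); simp
    · show L / 2 - -(L / 2) ≤ (L + 4 * B / c) * θ ^ 0
      have : 0 < 4 * B / c := by positivity
      simp; linarith
    · intro X hX hx hy
      simp only [pow_zero, one_mul] at hx hy ⊢
      have hbb : ∀ X ∈ Omc, X ∉ Om → |X.1| ≤ 2 * r0 → X.2 ≤ 2 * r0 → |w X| ≤ (2 * r0) ^ (1 + β) := by
        intro X hX hn hx hy
        refine (hb X hX hn).trans ?_
        gcongr
        rw [Prod.norm_def, Real.norm_eq_abs, Real.norm_eq_abs, abs_of_nonneg (Omc_bounds hX).1]; exact max_le hx hy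
      have s1 := barrier0 hK hg cw (r := 2 * r0) (η := 1) (η' := (2 * r0) ^ (1 + β)) (by positivity) one_pos (by positivity)
        (fun X hX _ _ => (abs_le.1 (hw X hX)).1) (fun X hX hn hx hy => (abs_le.1 (hbb X hX hn hx hy)).1) X hX (by linarith) (by linarith)
      have s2 := barrier0 hK (hg.neg 0) (by fun_prop) (r := 2 * r0) (η := 1) (η' := (2 * r0) ^ (1 + β)) (by positivity) one_pos (by positivity)
        (fun X hX _ _ => by linarith [(abs_le.1 (hw X hX)).2]) (fun X hX hn hx hy => by linarith [(abs_le.1 (hbb X hX hn hx hy)).2]) X hX (by linarith) (by linarith)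
      have e1 : (16 * K + 2) * (1 / (2 * r0)) = L / 2 := by rw [hLr]; field_simp
      have e2 : (2 * r0) ^ (1 + β) ≤ A * r0 ^ (1 + β) := by
        rw [Real.mul_rpow (by norm_num) hr0.le]
        have : (2 : ℝ) ^ (1 + β) ≤ 2 ^ (2 : ℝ) := Real.rpow_le_rpow_of_exponent_le (by norm_num) (by linarith)
        have h4 : (2 : ℝ) ^ (2 : ℝ) = 4 := by norm_num
        have : 4 ≤ A := by
          rw [hA, le_div_iff₀ (by positivity)]
          nlinarith [mul_pos Ca0 (by linarith : 0 < L)]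
        gcongr; linarith
      rw [e1] at s1 s2
      constructor <;> linarith
  have hstep : ∀ k a, S k a → ∃ b, S (k + 1) b ∧ R k a b := by
    rintro k ⟨m, M⟩ ⟨a1, a2, a3, a4, a5⟩
    simp only at a1 a2 a3 a4 a5
    have dk : 0 < δ ^ k := by positivity
    have tk : 0 < θ ^ k := by positivity
    have dk1 : δ ^ k ≤ 1 := pow_le_one₀ δ0.le (by linarith)
    have hbd : B / (1 - θ) * (1 - θ ^ k) ≤ L / 2 := by
      refine le_trans ?_ hBL
      have : 0 < B / (1 - θ) := by positivity
      nlinarith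
    obtain ⟨m', M', b1, b2, b3, b4, b5⟩ := K_next hK δ0 δ1 Ca0 HS β0 β1 hL hA hg cw hb (r := δ ^ k * r0) (by positivity)
      (by nlinarith) a1 (by linarith) (by linarith) a5
    have e : (16 * K + 2) * A * (δ ^ k * r0) ^ β = B * θ ^ k := by
      rw [Real.mul_rpow (by positivity) hr0.le, hB, hθ, ← Real.rpow_natCast, ← Real.rpow_natCast, ← Real.rpow_mul δ0.le, ← Real.rpow_mul δ0.le, mul_comm β]
      ring
    rw [e] at b1 b2 b3 b4
    have e2 : B / (1 - θ) * (1 - θ ^ (k + 1)) = B / (1 - θ) * (1 - θ ^ k) + B * θ ^ k := by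
      rw [pow_succ]; field_simp; ring
    have Bt : 0 < B * θ ^ k := by positivity
    refine ⟨(m', M'), ⟨?_, ?_, ?_, ?_, ?_⟩, ?_⟩
    · show m' < M'; nlinarith
    · show -(L / 2 + B / (1 - θ) * (1 - θ ^ (k + 1))) ≤ m'; rw [e2]; linarith
    · show M' ≤ (L / 2 + B / (1 - θ) * (1 - θ ^ (k + 1))); rw [e2]; linarith
    · show M' - m' ≤ (L + 4 * B / c) * θ ^ (k + 1)
      rw [b4, pow_succ]
      have h1 : (1 - c) * (M - m) ≤ (1 - c) * ((L + 4 * B / c) * θ ^ k) := by gcongr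
      have h2 : (L + 4 * B / c) * θ ^ k * (1 - c / 2) ≤ (L + 4 * B / c) * θ ^ k * θ := by gcongr
      have h3 : (L + 4 * B / c) * θ ^ k * (c / 2) = L * θ ^ k * c / 2 + 2 * (B * θ ^ k) := by field_simp; ring
      have h4 : 0 ≤ L * θ ^ k * c / 2 := by positivity
      nlinarith
    · intro X hX hx hy
      rw [pow_succ', mul_assoc] at hx hy ⊢
      exact b5 X hX hx hy
    · show |m' - m| ≤ (L + 4 * B / c + B) * θ ^ k
      refine b3.trans ?_
      rw [add_mul (L + 4 * B / c)]; exact add_le_add a4 le_rfl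
  obtain ⟨f, hf⟩ := exists_seq_step S R hS0 hstep
  refine ⟨fun k => (f k).1, ?_, fun k => (hf k).2, ?_⟩
  · obtain ⟨a1, a2, a3, -⟩ := (hf 0).1
    rw [pow_zero, sub_self, mul_zero, add_zero] at a2 a3
    rw [abs_le]; constructor <;> linarith
  · intro k X hX hx hy
    obtain ⟨a1, a2, a3, a4, a5⟩ := (hf k).1
    obtain ⟨b1, b2⟩ := a5 X hX hx hy
    have y0 := (Omc_bounds hX).1
    have h : ((f k).2 - (f k).1) * X.2 ≤ (L + 4 * B / c) * θ ^ k * (δ ^ k * r0) :=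
      mul_le_mul a4 hy y0 (by linarith)
    have h' : 0 ≤ (L + 4 * B / c) * θ ^ k * (δ ^ k * r0) := by positivity
    rw [abs_le]; constructor <;> linarith

lemma K_thm (K : ℝ) (hK : 1 ≤ K) : ∃ αc : ℝ, 0 < αc ∧ αc ≤ 1 / 2 ∧ ∀ β, 0 < β → β ≤ αc → ∃ C > 0, ∀ w : ℝ × ℝ → ℝ,
    Good K Om w → ContinuousOn w Omc → (∀ X ∈ Omc, |w X| ≤ 1) → (∀ X ∈ Omc, X ∉ Om → |w X| ≤ ‖X‖ ^ (1 + β)) →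
    ∃ a, |a| ≤ C ∧ ∀ X ∈ Omc, |w X - a * X.2| ≤ C * ‖X‖ ^ (1 + β) := by
  obtain ⟨δ, c, Ca, δ0, δ1, c0, c1, Ca0, HS⟩ := K_step K hK
  have hlog : 0 < -Real.log δ := by
    have := Real.log_neg δ0 (by linarith); linarith
  refine ⟨min (1 / 2) (c / 2 / (-Real.log δ)), by positivity, min_le_left _ _, fun β β0 hβ => ?_⟩
  have β1 : β ≤ 1 / 2 := hβ.trans (min_le_left _ _)
  obtain ⟨θ, hθ⟩ : ∃ θ, θ = δ ^ β := ⟨_, rfl⟩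
  have θ0 : 0 < θ := by rw [hθ]; positivity
  have θ1 : θ < 1 := by rw [hθ]; exact Real.rpow_lt_one δ0.le (by linarith) β0
  have θc : 1 - c / 2 ≤ θ := by
    have h1 : β * (-Real.log δ) ≤ c / 2 := by
      have := hβ.trans (min_le_right _ _)
      rwa [le_div_iff₀ hlog] at this
    rw [hθ, Real.rpow_def_of_pos δ0]
    have := Real.add_one_le_exp (Real.log δ * β)
    nlinarith
  have hq : 0 < 1 - θ := by linarith
  have Cb0 : 0 < 16 * K + 2 := by linarith
  obtain ⟨z, hz⟩ : ∃ z, z = (1 - θ) * δ ^ 2 / (4 * (16 * K + 2) * (1 + Ca)) := ⟨_, rfl⟩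
  have z0 : 0 < z := by rw [hz]; positivity
  obtain ⟨r0, hr0⟩ : ∃ r0, r0 = min (1 / 2) (z ^ (1 / β)) := ⟨_, rfl⟩
  have r00 : 0 < r0 := by rw [hr0]; positivity
  have r01 : r0 ≤ 1 / 2 := by rw [hr0]; exact min_le_left _ _
  have r0z : r0 ^ β ≤ z := by
    calc r0 ^ β ≤ (z ^ (1 / β)) ^ β := by gcongr; rw [hr0]; exact min_le_right _ _
      _ = z := by rw [← Real.rpow_mul z0.le]; field_simp; simp
  obtain ⟨L, hL⟩ : ∃ L, L = (16 * K + 2) / r0 := ⟨_, rfl⟩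
  have L1 : 1 ≤ L := by rw [hL, le_div_iff₀ r00]; linarith
  obtain ⟨A, hA⟩ : ∃ A, A = (1 + L + 2 * Ca * L) / δ ^ 2 := ⟨_, rfl⟩
  have A0 : 0 < A := by rw [hA]; positivity
  obtain ⟨B, hB⟩ : ∃ B, B = (16 * K + 2) * A * r0 ^ β := ⟨_, rfl⟩
  have B0 : 0 < B := by rw [hB]; positivity
  have hBL : B / (1 - θ) ≤ L / 2 := by
    rw [div_le_iff₀ hq]
    have h1 : A ≤ (2 + 2 * Ca) * L / δ ^ 2 := by rw [hA]; gcongr; nlinarith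
    calc B ≤ (16 * K + 2) * ((2 + 2 * Ca) * L / δ ^ 2) * z := by rw [hB]; gcongr
      _ = L / 2 * (1 - θ) := by rw [hz]; field_simp; ring
  obtain ⟨C2, hC2⟩ : ∃ C2, C2 = L + 4 * B / c := ⟨_, rfl⟩
  have C20 : 0 < C2 := by rw [hC2]; positivity
  obtain ⟨C3, hC3⟩ : ∃ C3, C3 = (C2 + B) / (1 - θ) := ⟨_, rfl⟩
  have C30 : 0 < C3 := by rw [hC3]; positivity
  have hCb : 0 < L + C3 := by positivity
  have key : ∀ w : ℝ × ℝ → ℝ,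
    Good K Om w → ContinuousOn w Omc → (∀ X ∈ Omc, |w X| ≤ 1) → (∀ X ∈ Omc, X ∉ Om → |w X| ≤ ‖X‖ ^ (1 + β)) →
    ∃ a, |a| ≤ L + C3 ∧ ∀ k : ℕ, ∀ X ∈ Omc, |X.1| ≤ δ ^ k * r0 → X.2 ≤ δ ^ k * r0 → |w X - a * X.2| ≤ (A + (C2 + C3) / r0 ^ β) * (δ ^ k * r0) ^ (1 + β) := by
    intro w hg cw hw hb
    obtain ⟨m, m0, m1, m2⟩ := K_iter hK δ0 δ1 c0 c1 Ca0 HS β0 (by linarith) L1 hA r00 r01 hL hθ θ1 θc hB hBL hg cw hw hb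
    rw [← hC2] at m1 m2
    have hd : ∀ n, dist (m n) (m (n + 1)) ≤ (C2 + B) * θ ^ n := fun n => by rw [dist_comm]; exact m1 n
    obtain ⟨a, ha⟩ := cauchySeq_tendsto_of_complete (cauchySeq_of_le_geometric θ (C2 + B) θ1 hd)
    have hda := dist_le_of_le_geometric_of_tendsto θ (C2 + B) θ1 hd ha
    have hda' : ∀ n, |m n - a| ≤ C3 * θ ^ n := fun n => by
      have := hda n
      rw [Real.dist_eq] at this
      rw [hC3, div_mul_eq_mul_div]; exact this
    refine ⟨a, ?_, fun k X hX hx hy => ?_⟩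
    · have := hda' 0
      rw [pow_zero, mul_one] at this
      rw [abs_le] at *; constructor <;> linarith [this.1, this.2, m0.1, m0.2]
    · have h1 := m2 k X hX hx hy
      have y0 := (Omc_bounds hX).1
      have h2 : |(m k - a) * X.2| ≤ C3 * θ ^ k * (δ ^ k * r0) := by
        rw [abs_mul, abs_of_nonneg y0]; exact mul_le_mul (hda' k) hy y0 (by positivity)
      have e : θ ^ k * (δ ^ k * r0) = 1 / r0 ^ β * (δ ^ k * r0) ^ (1 + β) := by
        rw [Real.rpow_add (by positivity), Real.rpow_one, Real.mul_rpow (by positivity) r00.le, hθ, ← Real.rpow_natCast, ← Real.rpow_natCast, ← Real.rpow_mul δ0.le, ← Real.rpow_mul δ0.le, mul_comm β]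
        field_simp
      calc |w X - a * X.2| = |(w X - m k * X.2) + (m k - a) * X.2| := by ring_nf
        _ ≤ _ := abs_add_le _ _
        _ ≤ (A * (δ ^ k * r0) ^ (1 + β) + C2 * θ ^ k * (δ ^ k * r0)) + C3 * θ ^ k * (δ ^ k * r0) := add_le_add h1 h2
        _ = A * (δ ^ k * r0) ^ (1 + β) + (C2 + C3) * (θ ^ k * (δ ^ k * r0)) := by ring
        _ = _ := by rw [e]; ring
  obtain ⟨C4, hC4⟩ : ∃ C4, C4 = (A + (C2 + C3) / r0 ^ β) := ⟨_, rfl⟩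
  have C40 : 0 < C4 := by rw [hC4]; positivity
  rw [← hC4] at key
  refine ⟨(L + C3) + C4 / δ ^ (1 + β) + (1 + 2 * (L + C3)) / r0 ^ (1 + β), by positivity, fun w hg cw hw hb => ?_⟩
  obtain ⟨a, ha, hk⟩ := key w hg cw hw hb
  have t1 : 0 < C4 / δ ^ (1 + β) := by positivity
  have t2 : 0 < (1 + 2 * (L + C3)) / r0 ^ (1 + β) := by positivity
  refine ⟨a, by linarith, fun X hX => ?_⟩
  obtain ⟨y0, y2, x1⟩ := Omc_bounds hX
  rcases le_or_gt ‖X‖ r0 with h | h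
  · rcases eq_or_lt_of_le (norm_nonneg X) with h0 | h0
    · have hX0 : X = 0 := by rw [← norm_eq_zero]; exact h0.symm
      subst hX0
      have : (0 : ℝ × ℝ) ∉ Om := by simp [Om]
      have := hb 0 hX this
      rw [norm_zero, Real.zero_rpow (by linarith)] at *
      simpa using this
    · obtain ⟨k, hk1, hk2⟩ := exists_nat_pow_near_of_lt_one (x := ‖X‖ / r0) (y := δ) (by positivity) (by rw [div_le_one r00]; exact h) δ0 (by linarith)
      rw [div_le_iff₀ r00] at hk2
      rw [lt_div_iff₀ r00] at hk1
      refine (hk k X hX ((abs_fst_le X).trans hk2) (by have := (abs_snd_le X).trans hk2; rwa [abs_of_nonneg y0] at this)).trans ?_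
      have : δ ^ k * r0 ≤ ‖X‖ / δ := by rw [le_div_iff₀ δ0]; rw [pow_succ] at hk1; linarith
      calc C4 * (δ ^ k * r0) ^ (1 + β) ≤ C4 * (‖X‖ / δ) ^ (1 + β) := by gcongr
        _ = C4 / δ ^ (1 + β) * ‖X‖ ^ (1 + β) := by rw [Real.div_rpow (norm_nonneg X) δ0.le]; ring
        _ ≤ _ := by gcongr; linarith
  · have h1 : 1 ≤ ‖X‖ ^ (1 + β) / r0 ^ (1 + β) := by
      rw [one_le_div (by positivity)]; gcongr
    have h2 : |a * X.2| ≤ (L + C3) * 2 := by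
      rw [abs_mul, abs_of_nonneg y0]; exact mul_le_mul ha y2 y0 (by positivity)
    calc |w X - a * X.2| ≤ |w X| + |a * X.2| := abs_sub _ _
      _ ≤ (1 + 2 * (L + C3)) * 1 := by linarith [hw X hX]
      _ ≤ (1 + 2 * (L + C3)) * (‖X‖ ^ (1 + β) / r0 ^ (1 + β)) := by gcongr
      _ = (1 + 2 * (L + C3)) / r0 ^ (1 + β) * ‖X‖ ^ (1 + β) := by ring
      _ ≤ _ := by gcongr; linarith

end PW

namespace PW
open Filter MeasureTheory
open scoped Topology

lemma norm_eq_max {X : ℝ × ℝ} : ‖X‖ = max |X.1| |X.2| := rfl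

lemma Omc_norm {X : ℝ × ℝ} (h : X ∈ Omc) : ‖X‖ ≤ 2 := by
  obtain ⟨a, b, c⟩ := Omc_bounds h
  rw [norm_eq_max, abs_of_nonneg a]; exact max_le (by linarith) b

lemma bdry_snd {X : ℝ × ℝ} (h : X ∈ Omc) (hn : X ∉ Om) : X.2 ≤ ‖X‖ ^ 2 := by
  simp only [Om, Omc, mem_setOf_eq, not_lt] at h hn
  have h1 : X.1 ^ 2 ≤ ‖X‖ ^ 2 := by rw [← sq_abs]; gcongr; exact abs_fst_le X
  have h2 : X.2 ^ 2 ≤ ‖X‖ ^ 2 := by rw [← sq_abs]; gcongr; exact abs_snd_le X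
  linarith

lemma Omc_max {K : ℝ} (hK : 1 ≤ K) {w : ℝ × ℝ → ℝ} (hw : Good K Om w) (cw : ContinuousOn w Omc) {N : ℝ}
    (hb : ∀ X ∈ Omc, X ∉ Om → |w X| ≤ N) : ∀ X ∈ Omc, |w X| ≤ N := by
  have hcl : closure Om ⊆ Omc := closure_minimal Om_sub Omc_closed
  have hfr : ∀ X ∈ frontier Om, X ∈ Omc ∧ X ∉ Om := fun X hX => ⟨hcl hX.1, by
    have := hX.2; rwa [Om_open.interior_eq] at this⟩
  have hbd : Bornology.IsBounded Om := Omc_compact.isBounded.subset Om_sub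
  intro X hX
  by_cases h : X ∈ Om
  · have h1 := max_principle hK Om_open hbd subset_rfl hw (cw.mono hcl) (m := -N)
      (fun X hX => (abs_le.1 (hb X (hfr X hX).1 (hfr X hX).2)).1) X (subset_closure h)
    have cw2 : ContinuousOn (fun X : ℝ × ℝ => 0 * X.2 - w X) (closure Om) := by
      have := cw.mono hcl
      fun_prop
    have h2 := max_principle hK Om_open hbd subset_rfl (hw.neg 0) cw2 (m := -N)
      (fun X hX => by linarith [(abs_le.1 (hb X (hfr X hX).1 (hfr X hX).2)).2]) X (subset_closure h)
    rw [abs_le]; constructor <;> linarith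
  · exact hb X hX h

lemma Good.scale {K : ℝ} {U : Set (ℝ × ℝ)} {w : ℝ × ℝ → ℝ} (h : Good K U w) (s : ℝ) : Good K U (fun X => s * w X) :=
  (h.affine s 0 0 0).congr fun X _ => by ring

/-- Theorem K, scaled version -/
lemma K_thm2 (K : ℝ) (hK : 1 ≤ K) : ∃ αc : ℝ, 0 < αc ∧ αc ≤ 1 / 2 ∧ ∀ β, 0 < β → β ≤ αc → ∃ C > 0, ∀ (w : ℝ × ℝ → ℝ) (N : ℝ),
    0 < N → Good K Om w → ContinuousOn w Omc → (∀ X ∈ Omc, X ∉ Om → |w X| ≤ N * ‖X‖ ^ (1 + β)) →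
    ∃ a, |a| ≤ C * N ∧ ∀ X ∈ Omc, |w X - a * X.2| ≤ C * N * ‖X‖ ^ (1 + β) := by
  obtain ⟨αc, h0, h1, H⟩ := K_thm K hK
  refine ⟨αc, h0, h1, fun β β0 β1 => ?_⟩
  obtain ⟨C, C0, HC⟩ := H β β0 β1
  refine ⟨4 * C, by positivity, fun w N N0 hg cw hb => ?_⟩
  have hb4 : ∀ X ∈ Omc, X ∉ Om → |w X| ≤ 4 * N := by
    intro X hX hn
    have h2 : ‖X‖ ^ (1 + β) ≤ 4 := by
      calc ‖X‖ ^ (1 + β) ≤ 2 ^ (1 + β) := by gcongr; exact Omc_norm hX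
        _ ≤ 2 ^ (2 : ℝ) := Real.rpow_le_rpow_of_exponent_le (by norm_num) (by linarith)
        _ = 4 := by norm_num
    refine (hb X hX hn).trans ?_
    nlinarith
  have hm := Omc_max hK hg cw hb4
  have e : ∀ X, |1 / (4 * N) * w X| = |w X| / (4 * N) := fun X => by
    rw [abs_mul, abs_of_pos (by positivity)]; ring
  obtain ⟨a, ha, haX⟩ := HC (fun X => 1 / (4 * N) * w X) (hg.scale _) (by fun_prop) (by
    intro X hX
    show |1 / (4 * N) * w X| ≤ 1
    rw [e, div_le_one (by positivity)]; exact hm X hX) (by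
    intro X hX hn
    show |1 / (4 * N) * w X| ≤ _
    rw [e, div_le_iff₀ (by positivity)]
    have : 0 ≤ ‖X‖ ^ (1 + β) := by positivity
    nlinarith [hb X hX hn])
  refine ⟨4 * N * a, ?_, fun X hX => ?_⟩
  · rw [abs_mul, abs_of_pos (by positivity : 0 < 4 * N)]; nlinarith
  · have : w X - 4 * N * a * X.2 = 4 * N * (1 / (4 * N) * w X - a * X.2) := by field_simp
    rw [this, abs_mul, abs_of_pos (by positivity : 0 < 4 * N)]
    calc 4 * N * |1 / (4 * N) * w X - a * X.2| ≤ 4 * N * (C * ‖X‖ ^ (1 + β)) := by gcongr; exact haX X hX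
      _ = _ := by ring

/-- boundary curve -/
def bc (t : ℝ) : ℝ × ℝ := (Real.sin t, 1 - Real.cos t)

lemma bc_mem (t : ℝ) : bc t ∈ Omc ∧ bc t ∉ Om := by
  have := Real.sin_sq_add_cos_sq t
  simp only [bc, Om, Omc, mem_setOf_eq]
  constructor <;> nlinarith

lemma one_sub_cos_le (t : ℝ) : |1 - Real.cos t| ≤ |t| := by
  have h1 := Real.one_sub_sq_div_two_le_cos (x := t)
  have h2 := Real.cos_le_one t
  have h3 := Real.neg_one_le_cos t
  rw [abs_of_nonneg (by linarith)]
  rcases le_or_gt |t| 2 with h | h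
  · nlinarith [sq_abs t, abs_nonneg t]
  · linarith

lemma bc_norm (t : ℝ) : ‖bc t‖ ≤ |t| := by
  rw [norm_eq_max]
  exact max_le Real.abs_sin_le_abs (one_sub_cos_le t)

lemma exists_bc {X : ℝ × ℝ} (h : X ∈ Omc) (hn : X ∉ Om) : ∃ t, bc t = X ∧ |t| ≤ 4 * ‖X‖ := by
  obtain ⟨y0, y2, x1⟩ := Omc_bounds h
  have hy := bdry_snd h hn
  simp only [Om, Omc, mem_setOf_eq, not_lt] at h hn
  set s := Real.arccos (1 - X.2) with hs
  have hc : Real.cos s = 1 - X.2 := Real.cos_arccos (by linarith) (by linarith)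
  have hsin : Real.sin s = |X.1| := by
    rw [hs, Real.sin_arccos, ← Real.sqrt_sq_eq_abs]
    congr 1; nlinarith
  have s0 : 0 ≤ s := Real.arccos_nonneg _
  have sπ : s ≤ π := Real.arccos_le_pi _
  have bound : s ≤ 4 * ‖X‖ := by
    have h1 := Real.cos_le_one_sub_mul_cos_sq (x := s) (by rwa [abs_of_nonneg s0])
    rw [hc] at h1
    have h2 : 2 / π ^ 2 * s ^ 2 ≤ ‖X‖ ^ 2 := by linarith
    rw [div_mul_eq_mul_div, div_le_iff₀ (by positivity)] at h2
    have h3 : π ^ 2 ≤ 16 := by nlinarith [Real.pi_le_four, Real.pi_pos]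
    refine abs_le_of_sq_le_sq' ?_ (by positivity) |>.2
    nlinarith [sq_nonneg ‖X‖]
  rcases le_total 0 X.1 with hx | hx
  · refine ⟨s, ?_, by rwa [abs_of_nonneg s0]⟩
    ext
    · simp [bc, hsin, abs_of_nonneg hx]
    · simp [bc, hc]
  · refine ⟨-s, ?_, by rwa [abs_neg, abs_of_nonneg s0]⟩
    ext
    · simp [bc, hsin, abs_of_nonpos hx]
    · simp [bc, hc]

lemma exists_polar {X : ℝ × ℝ} (h : X ∈ Omc) : ∃ t r, 0 ≤ r ∧ r ≤ 1 ∧ X = (r * Real.sin t, 1 - r * Real.cos t) := by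
  set r := Real.sqrt (X.1 ^ 2 + (X.2 - 1) ^ 2) with hr
  have r2 : r ^ 2 = X.1 ^ 2 + (X.2 - 1) ^ 2 := Real.sq_sqrt (by positivity)
  have r0 : 0 ≤ r := Real.sqrt_nonneg _
  have r1 : r ≤ 1 := by
    simp only [Omc, mem_setOf_eq] at h
    nlinarith
  rcases eq_or_lt_of_le r0 with h0 | h0
  · refine ⟨0, 0, le_rfl, by norm_num, ?_⟩
    rw [← h0] at r2
    ext
    · simp; nlinarith [sq_nonneg X.1, sq_nonneg (X.2 - 1)]
    · simp; nlinarith [sq_nonneg X.1, sq_nonneg (X.2 - 1)]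
  · have e : (X.1 / r) ^ 2 + (1 + (X.2 - 1) / r) ^ 2 = 2 * (1 + (X.2 - 1) / r) := by
      field_simp
      nlinarith
    obtain ⟨t, ht, -⟩ := exists_bc (X := (X.1 / r, 1 + (X.2 - 1) / r)) (by simp only [Omc, mem_setOf_eq]; exact e.le)
      (by simp only [Om, mem_setOf_eq, not_lt]; exact e.ge)
    refine ⟨t, r, r0, r1, ?_⟩
    simp only [bc, Prod.mk.injEq] at ht
    ext
    · simp only [ht.1]; field_simp
    · have : Real.cos t = -((X.2 - 1) / r) := by linarith [ht.2]
      simp only [this]; field_simp; ring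

lemma mvt_pow {h h' : ℝ → ℝ} {A κ : ℝ} (hκ : 0 ≤ κ) (hA : 0 ≤ A) (hd : ∀ t, HasDerivAt h (h' t) t) (hb : ∀ t, |h' t| ≤ A * |t| ^ κ) (h0 : h 0 = 0) :
    ∀ t, |h t| ≤ A * |t| ^ (κ + 1) := by
  intro t
  have := Convex.norm_image_sub_le_of_norm_hasDerivWithin_le (s := Metric.closedBall (0 : ℝ) |t|) (f := h) (f' := h') (C := A * |t| ^ κ)
    (x := 0) (y := t) (fun x _ => (hd x).hasDerivWithinAt) (fun x hx => by
      rw [mem_closedBall, dist_zero_right, Real.norm_eq_abs] at hx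
      refine (hb x).trans ?_
      gcongr) (convex_closedBall _ _) (by simp) (by simp)
  rw [h0, sub_zero, sub_zero, Real.norm_eq_abs, Real.norm_eq_abs] at this
  rcases eq_or_ne t 0 with h1 | h1
  · subst h1; simp [h0]; positivity
  · rwa [Real.rpow_add (abs_pos.2 h1), Real.rpow_one, ← mul_assoc]

end PW

namespace PW
open Filter MeasureTheory
open scoped Topology

lemma axis_mem {y : ℝ} (h0 : 0 ≤ y) (h2 : y ≤ 2) : ((0 : ℝ), y) ∈ Omc := by
  simp only [Omc, mem_setOf_eq]; nlinarith

lemma half_step {K β A R s : ℝ} (hK : 1 ≤ K) (hβ : 0 < β) (hβ1 : β ≤ 1) (hA : 0 < A) (hR : R ^ 2 = 4 * K) (hR2 : 2 ≤ R)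
    {v : ℝ × ℝ → ℝ} (hg : Good K Om v) (cv : ContinuousOn v Omc)
    (h1 : ∀ X ∈ Omc, X ∉ Om → |v X| ≤ A * ‖X‖ ^ (2 + β)) (h2 : ∀ X ∈ Omc, |v X - v (0, X.2)| ≤ A * ‖X‖ ^ (2 + β))
    (h3 : ∀ y, 0 < y → y ≤ 2 → |v (0, y)| ≤ A * y ^ (1 + β)) (hs : 0 < s) (hs1 : R * s ≤ 1) :
    v (0, s / 2) - v (0, s) / 2 ≤ 3 * (2 * A * R ^ 3 * s ^ (2 + β)) := by
  obtain ⟨ε, hε⟩ : ∃ ε, ε = 2 * A * R ^ 3 * s ^ (2 + β) := ⟨_, rfl⟩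
  have ε0 : 0 < ε := by rw [hε]; positivity
  rw [← hε]
  have s12 : s ≤ 1 / 2 := by nlinarith
  set D : Set (ℝ × ℝ) := Om ∩ ({X | |X.1| < R * s} ∩ {X | X.2 < s}) with hD
  set E : Set (ℝ × ℝ) := Omc ∩ ({X | |X.1| ≤ R * s} ∩ {X | X.2 ≤ s}) with hE
  have oD : IsOpen D := Om_open.inter ((isOpen_lt (by fun_prop) (by fun_prop)).inter (isOpen_lt (by fun_prop) (by fun_prop)))
  have cE : IsCompact E := Omc_compact.inter_right ((isClosed_le (by fun_prop) (by fun_prop)).inter (isClosed_le (by fun_prop) (by fun_prop)))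
  have DE : D ⊆ E := fun X hX => ⟨Om_sub hX.1, (show |X.1| < R * s from hX.2.1).le, (show X.2 < s from hX.2.2).le⟩
  have nE : ∀ X ∈ E, A * ‖X‖ ^ (2 + β) ≤ ε / 2 := by
    rintro X ⟨a1, a2, a3⟩
    have a2 : |X.1| ≤ R * s := a2
    have a3 : X.2 ≤ s := a3
    have hn : ‖X‖ ≤ R * s := by
      rw [norm_eq_max, abs_of_nonneg (Omc_bounds a1).1]; exact max_le a2 (by nlinarith)
    have hR3 : R ^ (2 + β) ≤ R ^ 3 := by
      rw [← Real.rpow_natCast]; exact Real.rpow_le_rpow_of_exponent_le (by linarith) (by norm_num; linarith)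
    calc A * ‖X‖ ^ (2 + β) ≤ A * (R * s) ^ (2 + β) := by gcongr
      _ = A * (R ^ (2 + β) * s ^ (2 + β)) := by rw [Real.mul_rpow (by linarith) hs.le]
      _ ≤ A * (R ^ 3 * s ^ (2 + β)) := by gcongr
      _ = _ := by rw [hε]; ring
  set l := v (0, s) / s with hl
  have hls : l * s = v (0, s) := by rw [hl]; field_simp
  have caxis : ContinuousOn (fun y : ℝ => v (0, y) - l * y) (Icc 0 s) := by
    have : ContinuousOn (fun y : ℝ => v (0, y)) (Icc 0 s) :=
      cv.comp (f := fun y : ℝ => ((0 : ℝ), y)) (by fun_prop) (fun y hy => axis_mem hy.1 (by linarith [hy.2]))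
    exact this.sub (by fun_prop)
  obtain ⟨y1, hy1, hmax⟩ := isCompact_Icc.exists_isMaxOn ⟨0, by simp [hs.le]⟩ caxis
  obtain ⟨N, hN⟩ : ∃ N, N = v (0, y1) - l * y1 := ⟨_, rfl⟩
  have hNm : ∀ y, 0 ≤ y → y ≤ s → v (0, y) - l * y ≤ N := fun y a b => by rw [hN]; exact hmax ⟨a, b⟩
  have goal : N ≤ 3 * ε → v (0, s / 2) - v (0, s) / 2 ≤ 3 * ε := by
    intro h
    have := hNm (s / 2) (by linarith) (by linarith)
    nlinarith
  apply goal
  have N0 : 0 ≤ N := by have := hNm s hs.le le_rfl; linarith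
  rcases eq_or_lt_of_le N0 with h0 | h0
  · rw [← h0]; positivity
  have bE : ∀ X ∈ E, v X - l * X.2 ≤ ε + N := by
    intro X hX
    have a := (abs_le.1 (h2 X hX.1)).2
    have b := hNm X.2 (Omc_bounds hX.1).1 hX.2.2
    have := nE X hX
    linarith
  have Rs : (R * s) ^ 2 = 4 * K * s ^ 2 := by rw [mul_pow, hR]
  have cmp := compare' hK (σ := N / s ^ 2) (by positivity) oD DE cE (U := Om) (fun X hX => hX.1) (hg.neg l)
    (ψ := fun X => (-(2 * ε)) + 0 * X.1 + (-(N / s)) * X.2 + ((-(2 * N / (R * s) ^ 2)) * X.1 ^ 2 / 2 + 0 * X.1 * X.2 + (2 * N / s ^ 2) * X.2 ^ 2 / 2))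
    (by have := cv.mono (inter_subset_left : E ⊆ Omc); fun_prop) (by fun_prop) (JetOn.quad D _ _ _ _ _ _)
    (fun X hX => SubAt_diag (by positivity) (by linarith) (by positivity) (by
      rw [Rs]; apply le_of_eq; field_simp; ring)) (by
      intro X hX hXD
      have e : (-(2 * ε)) + 0 * X.1 + (-(N / s)) * X.2 + ((-(2 * N / (R * s) ^ 2)) * X.1 ^ 2 / 2 + 0 * X.1 * X.2 + (2 * N / s ^ 2) * X.2 ^ 2 / 2)
        = -(2 * ε) - N * (X.1 ^ 2 / (R * s) ^ 2) - N * (X.2 * (s - X.2) / s ^ 2) := by field_simp; ring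
      show _ ≤ l * X.2 - v X
      rw [e]
      have y0 := (Omc_bounds hX.1).1
      have ys : X.2 ≤ s := hX.2.2
      have xs : |X.1| ≤ R * s := hX.2.1
      have t1 : 0 ≤ N * (X.1 ^ 2 / (R * s) ^ 2) := by positivity
      have t2 : 0 ≤ N * (X.2 * (s - X.2) / s ^ 2) := by
        have : 0 ≤ s - X.2 := by linarith
        positivity
      have hnE := nE X hX
      by_cases c1 : X ∈ Om
      · by_cases c2 : |X.1| < R * s
        · have c3 : X.2 = s := by
            by_contra h
            exact hXD ⟨c1, c2, lt_of_le_of_ne ys h⟩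
          have := (abs_le.1 (h2 X hX.1)).2
          rw [c3] at this ⊢
          rw [c3] at t2
          linarith
        · have c4 : |X.1| = R * s := le_antisymm xs (not_lt.1 c2)
          have c5 : X.1 ^ 2 / (R * s) ^ 2 = 1 := by rw [← sq_abs, c4]; exact div_self (by positivity)
          have := bE X hX
          rw [c5] at t1 ⊢
          linarith
      · have b1 := (abs_le.1 (h1 X hX.1 c1)).2
        have b2 : X.2 ≤ (R * s) ^ 2 := bdry_y hX.1 c1 hs1 xs (by nlinarith)
        have b3 : |l * X.2| ≤ ε / 2 := by
          have : |l| ≤ A * s ^ β := by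
            rw [hl, abs_div, abs_of_pos hs, div_le_iff₀ hs]
            refine (h3 s hs (by linarith)).trans (le_of_eq ?_)
            rw [Real.rpow_add hs, Real.rpow_one]; ring
          rw [abs_mul, abs_of_nonneg y0]
          calc |l| * X.2 ≤ (A * s ^ β) * (R * s) ^ 2 := by gcongr
            _ = A * R ^ 2 * (s ^ (2 : ℝ) * s ^ β) := by norm_num; ring
            _ = A * R ^ 2 * s ^ (2 + β) := by rw [Real.rpow_add hs]
            _ ≤ A * R ^ 3 * s ^ (2 + β) := by gcongr <;> linarith
            _ = _ := by rw [hε]; ring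
        have := (abs_le.1 b3).1
        linarith)
  have q := cmp (0, y1) ⟨axis_mem hy1.1 (by linarith [hy1.2]), by simp; positivity, hy1.2⟩
  have e : (-(2 * ε)) + 0 * 0 + (-(N / s)) * y1 + ((-(2 * N / (R * s) ^ 2)) * 0 ^ 2 / 2 + 0 * 0 * y1 + (2 * N / s ^ 2) * y1 ^ 2 / 2)
        = -(2 * ε) - N * (y1 * (s - y1) / s ^ 2) := by field_simp; ring
  simp only at q
  rw [e] at q
  have t : y1 * (s - y1) / s ^ 2 ≤ 1 / 4 := by
    rw [div_le_iff₀ (by positivity)]; nlinarith [sq_nonneg (s - 2 * y1)]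
  nlinarith

lemma bdry_improve {K β : ℝ} (hK : 1 ≤ K) (hβ : 0 < β) (hβ1 : β ≤ 1) (A : ℝ) (hA : 0 < A) : ∃ C > 0, ∀ v : ℝ × ℝ → ℝ,
    Good K Om v → ContinuousOn v Omc →
    (∀ X ∈ Omc, X ∉ Om → |v X| ≤ A * ‖X‖ ^ (2 + β)) → (∀ X ∈ Omc, |v X - v (0, X.2)| ≤ A * ‖X‖ ^ (2 + β)) →
    (∀ y, 0 < y → y ≤ 2 → |v (0, y)| ≤ A * y ^ (1 + β)) → ∀ X ∈ Omc, |v X| ≤ C * ‖X‖ ^ (2 + β) := by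
  obtain ⟨R, hR⟩ : ∃ R, R = Real.sqrt (4 * K) := ⟨_, rfl⟩
  have R2 : R ^ 2 = 4 * K := by rw [hR]; exact Real.sq_sqrt (by linarith)
  have hR2 : 2 ≤ R := by rw [hR]; exact Real.le_sqrt_of_sq_le (by linarith)
  have R0 : 0 < R := by linarith
  obtain ⟨B, hB⟩ : ∃ B, B = (1 / (1 - (2 : ℝ) ^ (-(1 + β)))) * (12 * A * R ^ 3) := ⟨_, rfl⟩
  have B0 : 0 < B := by
    have : (2 : ℝ) ^ (-(1 + β)) < 1 := Real.rpow_lt_one_of_one_lt_of_neg (by norm_num) (by linarith)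
    have : 0 < 1 - (2 : ℝ) ^ (-(1 + β)) := by linarith
    rw [hB]; positivity
  refine ⟨A + B + A * R, by positivity, fun v hg cv h1 h2 h3 => ?_⟩
  have key : ∀ t, 0 < t → t ≤ 1 / R → |v (0, t)| ≤ B * t ^ (2 + β) := by
    have := doubling (φ := fun t => v (0, t)) (T := 1 / R) (A := 12 * A * R ^ 3) (γ := 1 + β) (by linarith) (by
      intro t t0 tT
      rw [le_div_iff₀ R0] at tT
      have a1 := half_step hK hβ hβ1 hA R2 hR2 hg cv h1 h2 h3 t0 (by linarith)
      have a2 := half_step hK hβ hβ1 hA R2 hR2 (hg.neg 0) (by fun_prop) (fun X hX hn => by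
        rw [zero_mul, zero_sub, abs_neg]; exact h1 X hX hn) (fun X hX => by
        rw [zero_mul, zero_sub, zero_sub, ← neg_sub', abs_neg]; exact h2 X hX) (fun y a b => by
        rw [zero_mul, zero_sub, abs_neg]; exact h3 y a b) t0 (by linarith)
      simp only [zero_mul, zero_sub] at a2
      have : 1 + (1 + β) = 2 + β := by ring
      rw [this, abs_le]
      constructor <;> linarith) (by
      refine squeeze_zero_norm' (a := fun t => A * t ^ β) ?_ ?_
      · have : Ioo (0 : ℝ) 2 ∈ 𝓝[>] (0 : ℝ) := Ioo_mem_nhdsGT (by norm_num)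
        filter_upwards [this] with t ht
        rw [norm_div, Real.norm_eq_abs, Real.norm_eq_abs, abs_of_pos ht.1, div_le_iff₀ ht.1]
        refine (h3 t ht.1 ht.2.le).trans (le_of_eq ?_)
        rw [Real.rpow_add ht.1, Real.rpow_one]; ring
      · have : Tendsto (fun t : ℝ => A * t ^ β) (𝓝 0) (𝓝 (A * 0 ^ β)) :=
          ((Real.continuousAt_rpow_const 0 β (Or.inr hβ.le)).tendsto).const_mul A
        rw [Real.zero_rpow hβ.ne', mul_zero] at this
        exact this.mono_left nhdsWithin_le_nhds)
    intro t t0 tT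
    have h := this t t0 tT
    rw [← hB] at h
    convert h using 3; ring
  intro X hX
  obtain ⟨y0, y2, -⟩ := Omc_bounds hX
  have hyn : X.2 ≤ ‖X‖ := (le_abs_self _).trans (abs_snd_le X)
  have p0 : 0 ≤ ‖X‖ ^ (2 + β) := by positivity
  have hax : |v (0, X.2)| ≤ (B + A * R) * ‖X‖ ^ (2 + β) := by
    rcases eq_or_lt_of_le y0 with h | h
    · have : ((0 : ℝ), (0 : ℝ)) ∉ Om := by simp [Om]
      have := h1 (0, 0) (axis_mem le_rfl (by norm_num)) this
      rw [show ((0 : ℝ), (0 : ℝ)) = 0 from rfl, norm_zero, Real.zero_rpow (by linarith), mul_zero] at this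
      rw [← h]; exact this.trans (by positivity)
    rcases le_or_gt X.2 (1 / R) with h' | h'
    · refine (key X.2 h h').trans ?_
      calc B * X.2 ^ (2 + β) ≤ B * ‖X‖ ^ (2 + β) := by gcongr
        _ ≤ _ := by gcongr; linarith [mul_pos hA R0]
    · rw [div_lt_iff₀ R0] at h'
      refine (h3 X.2 h y2).trans ?_
      calc A * X.2 ^ (1 + β) ≤ A * X.2 ^ (1 + β) * (X.2 * R) := by
            have : 0 < A * X.2 ^ (1 + β) := by positivity
            nlinarith
        _ = A * R * X.2 ^ (2 + β) := by
            rw [show 2 + β = 1 + (1 + β) by ring, Real.rpow_add h 1 (1 + β), Real.rpow_one]; ring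
        _ ≤ A * R * ‖X‖ ^ (2 + β) := by gcongr
        _ ≤ _ := by gcongr; linarith
  have h := h2 X hX
  calc |v X| = |(v X - v (0, X.2)) + v (0, X.2)| := by ring_nf
    _ ≤ _ := abs_add_le _ _
    _ ≤ A * ‖X‖ ^ (2 + β) + (B + A * R) * ‖X‖ ^ (2 + β) := add_le_add h hax
    _ = _ := by ring

end PW

namespace PW
open Filter MeasureTheory
open scoped Topology

/-- abstract properties of the zero set of F -/
structure EllZ (K : ℝ) (Z : ℝ → ℝ → ℝ → Prop) : Prop where
  sk : ∀ a b c a' b' c', Z a b c → Z a' b' c' → SK K (a - a') (b - b') (c - c')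
  z0 : Z 0 0 0
  zn : ∀ a b c n1 n2 : ℝ, n1 ^ 2 + n2 ^ 2 = 1 → ∃ t, Z (a + t * n1 ^ 2) (b + t * (n1 * n2)) (c + t * n2 ^ 2)

structure BdData (β : ℝ) (γ γ1 γ2 : ℝ → ℝ) : Prop where
  d : ∀ t, HasDerivAt γ (γ1 t) t
  d1 : ∀ t, HasDerivAt γ1 (γ2 t) t
  b : ∀ t, |γ t| ≤ 1
  b1 : ∀ t, |γ1 t| ≤ 1
  b2 : ∀ t, |γ2 t| ≤ 1
  hol : ∀ s t, |γ2 s - γ2 t| ≤ |s - t| ^ β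

structure Sol (K β : ℝ) (Z : ℝ → ℝ → ℝ → Prop) (U p q a b c : ℝ × ℝ → ℝ) (γ γ1 γ2 : ℝ → ℝ) : Prop where
  ell : EllZ K Z
  bd : BdData β γ γ1 γ2
  jet : JetOn Om U p q a b c
  wd : ∀ X ∈ Omc, HasFDerivWithinAt U (LL (p X) (q X)) Omc X
  cp : ContinuousOn p Omc
  cq : ContinuousOn q Omc
  eq : ∀ X ∈ Om, Z (a X) (b X) (c X)
  bv : ∀ t, U (bc t) = γ t

def rot (φ : ℝ) : ℝ × ℝ → ℝ × ℝ := aff (Real.sin φ) (1 - Real.cos φ) (Real.cos φ) (-Real.sin φ) (Real.sin φ) (Real.cos φ)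

def Zrot (φ : ℝ) (Z : ℝ → ℝ → ℝ → Prop) (a b c : ℝ) : Prop :=
  Z (Real.cos φ ^ 2 * a - 2 * Real.cos φ * Real.sin φ * b + Real.sin φ ^ 2 * c)
    (Real.cos φ * Real.sin φ * a + (Real.cos φ ^ 2 - Real.sin φ ^ 2) * b - Real.cos φ * Real.sin φ * c)
    (Real.sin φ ^ 2 * a + 2 * Real.cos φ * Real.sin φ * b + Real.cos φ ^ 2 * c)

lemma rot_inv (φ : ℝ) (X : ℝ × ℝ) : (rot φ X).1 ^ 2 + (rot φ X).2 ^ 2 - 2 * (rot φ X).2 = X.1 ^ 2 + X.2 ^ 2 - 2 * X.2 := by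
  have h := Real.sin_sq_add_cos_sq φ
  simp only [rot, aff]
  linear_combination (X.1 ^ 2 + X.2 ^ 2 - 2 * X.2 + 1) * h

lemma rot_Om (φ : ℝ) (X : ℝ × ℝ) : rot φ X ∈ Om ↔ X ∈ Om := by
  have := rot_inv φ X
  simp only [Om, mem_setOf_eq]
  constructor <;> intro h <;> linarith

lemma rot_Omc (φ : ℝ) (X : ℝ × ℝ) : rot φ X ∈ Omc ↔ X ∈ Omc := by
  have := rot_inv φ X
  simp only [Omc, mem_setOf_eq]
  constructor <;> intro h <;> linarith

lemma rot_bc (φ t : ℝ) : rot φ (bc t) = bc (t + φ) := by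
  ext
  · simp only [rot, aff, bc, Real.sin_add]; ring
  · simp only [rot, aff, bc, Real.cos_add]; ring

lemma rot_cont (φ : ℝ) : Continuous (rot φ) := aff_cont _ _ _ _ _ _

lemma rot_zero (φ : ℝ) : rot φ (0, 0) = bc φ := by simp [rot, aff, bc]

lemma rot_rot (φ : ℝ) (X : ℝ × ℝ) : rot φ (rot (-φ) X) = X := by
  have h := Real.sin_sq_add_cos_sq φ
  ext
  · simp only [rot, aff, Real.sin_neg, Real.cos_neg]; linear_combination X.1 * h
  · simp only [rot, aff, Real.sin_neg, Real.cos_neg]; linear_combination (X.2 - 1) * h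

lemma hasFDerivAt_affmap (e f m11 m12 m21 m22 : ℝ) (z : ℝ × ℝ) :
    HasFDerivAt (aff e f m11 m12 m21 m22) ((LL m11 m12).prod (LL m21 m22)) z := by
  have a1 : HasFDerivAt (fun z : ℝ × ℝ => e + m11 * z.1 + m12 * z.2) (LL m11 m12) z := by
    have := (((hasFDerivAt_fst (𝕜 := ℝ) (p := z)).const_mul m11).const_add e).add ((hasFDerivAt_snd (𝕜 := ℝ) (p := z)).const_mul m12)
    exact this
  have a2 : HasFDerivAt (fun z : ℝ × ℝ => f + m21 * z.1 + m22 * z.2) (LL m21 m22) z := by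
    have := (((hasFDerivAt_fst (𝕜 := ℝ) (p := z)).const_mul m21).const_add f).add ((hasFDerivAt_snd (𝕜 := ℝ) (p := z)).const_mul m22)
    exact this
  exact a1.prodMk a2

lemma EllZ.rot {K : ℝ} {Z : ℝ → ℝ → ℝ → Prop} (h : EllZ K Z) (φ : ℝ) : EllZ K (Zrot φ Z) := by
  have hφ := Real.cos_sq_add_sin_sq φ
  refine ⟨?_, ?_, ?_⟩
  · intro a b c a' b' c' h1 h2
    have := SK_rot (h.sk _ _ _ _ _ _ h1 h2) hφ
    generalize Real.cos φ = C at *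
    generalize Real.sin φ = S at *
    convert this using 1
    · linear_combination -(a - a') * (C ^ 2 + S ^ 2 + 1) * hφ
    · linear_combination -(b - b') * (C ^ 2 + S ^ 2 + 1) * hφ
    · linear_combination -(c - c') * (C ^ 2 + S ^ 2 + 1) * hφ
  · simpa [Zrot] using h.z0
  · intro a b c n1 n2 hn
    unfold Zrot
    generalize Real.cos φ = C at *
    generalize Real.sin φ = S at *
    obtain ⟨t, ht⟩ := h.zn (C ^ 2 * a - 2 * C * S * b + S ^ 2 * c)
      (C * S * a + (C ^ 2 - S ^ 2) * b - C * S * c)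
      (S ^ 2 * a + 2 * C * S * b + C ^ 2 * c)
      (C * n1 - S * n2) (S * n1 + C * n2)
      (by linear_combination (n1 ^ 2 + n2 ^ 2) * hφ + hn)
    refine ⟨t, ?_⟩
    convert ht using 1 <;> ring

lemma BdData.shift {β : ℝ} {γ γ1 γ2 : ℝ → ℝ} (h : BdData β γ γ1 γ2) (φ : ℝ) :
    BdData β (fun t => γ (t + φ)) (fun t => γ1 (t + φ)) (fun t => γ2 (t + φ)) :=
  ⟨fun t => (h.d (t + φ)).comp_add_const t φ, fun t => (h.d1 (t + φ)).comp_add_const t φ, fun t => h.b _, fun t => h.b1 _,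
    fun t => h.b2 _, fun s t => by have := h.hol (s + φ) (t + φ); rwa [add_sub_add_right_eq_sub] at this⟩

lemma Sol.rot {K β : ℝ} {Z : ℝ → ℝ → ℝ → Prop} {U p q a b c : ℝ × ℝ → ℝ} {γ γ1 γ2 : ℝ → ℝ}
    (S : Sol K β Z U p q a b c γ γ1 γ2) (φ : ℝ) : ∃ a' b' c', Sol K β (Zrot φ Z) (fun X => U (PW.rot φ X))
      (fun X => Real.cos φ * p (PW.rot φ X) + Real.sin φ * q (PW.rot φ X))
      (fun X => -Real.sin φ * p (PW.rot φ X) + Real.cos φ * q (PW.rot φ X)) a' b' c'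
      (fun t => γ (t + φ)) (fun t => γ1 (t + φ)) (fun t => γ2 (t + φ)) := by
  have hφ := Real.cos_sq_add_sin_sq φ
  have mp : MapsTo (PW.rot φ) Omc Omc := fun X hX => (rot_Omc φ X).2 hX
  have cp' : ContinuousOn (fun X => p (PW.rot φ X)) Omc := S.cp.comp (rot_cont φ).continuousOn mp
  have cq' : ContinuousOn (fun X => q (PW.rot φ X)) Omc := S.cq.comp (rot_cont φ).continuousOn mp
  refine ⟨_, _, _, S.ell.rot φ, S.bd.shift φ, (S.jet.aff _ _ _ _ _ _).mono (fun X hX => (rot_Om φ X).2 hX), ?_, (continuousOn_const.mul cp').add (continuousOn_const.mul cq'), (continuousOn_const.mul cp').add (continuousOn_const.mul cq'), ?_, ?_⟩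
  · intro X hX
    have h1 := (hasFDerivAt_affmap (Real.sin φ) (1 - Real.cos φ) (Real.cos φ) (-Real.sin φ) (Real.sin φ) (Real.cos φ) X).hasFDerivWithinAt (s := Omc)
    have := (S.wd _ (mp hX)).comp X h1 mp
    refine this.congr_fderiv ?_
    apply LL_ext <;> simp <;> ring
  · intro X hX
    have := S.eq _ ((rot_Om φ X).2 hX)
    unfold Zrot
    simp only [show ∀ X, PW.aff (Real.sin φ) (1 - Real.cos φ) (Real.cos φ) (-Real.sin φ) (Real.sin φ) (Real.cos φ) X = PW.rot φ X from fun _ => rfl]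
    generalize a (PW.rot φ X) = a1 at *
    generalize b (PW.rot φ X) = b1 at *
    generalize c (PW.rot φ X) = c1 at *
    generalize Real.cos φ = C at *
    generalize Real.sin φ = S at *
    convert this using 1
    · linear_combination a1 * (C ^ 2 + S ^ 2 + 1) * hφ
    · linear_combination b1 * (C ^ 2 + S ^ 2 + 1) * hφ
    · linear_combination c1 * (C ^ 2 + S ^ 2 + 1) * hφ
  · intro t
    simp only [rot_bc, S.bv]

end PW

namespace PW
open Filter MeasureTheory
open scoped Topology

variable {K β : ℝ} {Z : ℝ → ℝ → ℝ → Prop} {U p q a b c : ℝ × ℝ → ℝ} {γ γ1 γ2 : ℝ → ℝ}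

lemma Sol.contU (S : Sol K β Z U p q a b c γ γ1 γ2) : ContinuousOn U Omc :=
  fun X hX => (S.wd X hX).continuousWithinAt

lemma Sol.good_sub (S : Sol K β Z U p q a b c γ γ1 γ2) (k p0 q0 : ℝ) {a0 b0 c0 : ℝ} (h : Z a0 b0 c0) :
    Good K Om (fun X => U X - (k + p0 * X.1 + q0 * X.2 + (a0 * X.1 ^ 2 / 2 + b0 * X.1 * X.2 + c0 * X.2 ^ 2 / 2))) := by
  have J := S.jet.lin (JetOn.quad Om k p0 q0 a0 b0 c0) 1 (-1)
  refine (J.good (K := K) Om_open ?_).congr ?_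
  · intro X hX
    have := S.ell.sk _ _ _ _ _ _ (S.eq X hX) h
    convert this using 1 <;> ring
  · intro X hX
    ring

lemma Sol.good_p (S : Sol K β Z U p q a b c γ γ1 γ2) : Good K Om p := by
  intro C hC hCc ε hε
  obtain ⟨δ, δ0, hδ⟩ := hCc.exists_cthickening_subset_open Om_open hC
  have hcpt : IsCompact (cthickening δ C) := hCc.cthickening
  have huc := hcpt.uniformContinuousOn_of_continuous (S.cp.mono (hδ.trans Om_sub))
  rw [Metric.uniformContinuousOn_iff] at huc
  obtain ⟨η, η0, hη⟩ := huc ε hε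
  set h := min δ η / 2 with hh
  have h0 : 0 < h := by positivity
  have h1 : h < δ := by have := min_le_left δ η; have : 0 < min δ η := by positivity
                        linarith
  have h2 : h < η := by have := min_le_right δ η; have : 0 < min δ η := by positivity
                        linarith
  have J := ((S.jet.translate (h, 0)).mono (inter_subset_right (s := Om))).lin (S.jet.mono (inter_subset_left (t := (fun X => X + (h, 0)) ⁻¹' Om))) h⁻¹ (-h⁻¹)
  have hdist : ∀ X : ℝ × ℝ, ∀ t ∈ Icc (0:ℝ) 1, dist (X + t • (h, (0:ℝ))) X ≤ h := by
    intro X t ht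
    rw [dist_eq_norm, add_sub_cancel_left, norm_smul, norm_eq_max]
    simp [abs_of_nonneg ht.1, abs_of_pos h0]
    rw [max_eq_left h0.le]; nlinarith [ht.2]
  have hin : ∀ X ∈ C, ∀ t ∈ Icc (0:ℝ) 1, X + t • (h, (0:ℝ)) ∈ cthickening δ C := fun X hX t ht =>
    mem_cthickening_of_dist_le _ X δ C hX ((hdist X t ht).trans h1.le)
  refine ⟨_, Om_open.inter (Om_open.preimage (by fun_prop)), ?_, _, _, _, _, _, _, J, ?_, ?_⟩
  · intro X hX
    refine ⟨hC hX, ?_⟩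
    have := hδ (hin X hX 1 ⟨by norm_num, le_rfl⟩)
    simpa using this
  · intro X hX
    have := (S.ell.sk _ _ _ _ _ _ (S.eq _ hX.2) (S.eq X hX.1)).smul h⁻¹
    convert this using 1 <;> ring
  · intro X hX
    obtain ⟨t, ht, he⟩ := mvt_line (V := cthickening δ C) (fun X hX => S.jet.w X (hδ hX)) (hin X hX)
    have e : h⁻¹ * U (X + (h, 0)) + -h⁻¹ * U X = p (X + t • (h, (0:ℝ))) := by
      have : h⁻¹ * U (X + (h, 0)) + -h⁻¹ * U X = h⁻¹ * (U (X + (h, 0)) - U X) := by ring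
      rw [this, he]; field_simp; ring
    rw [e, abs_sub_comm, ← Real.dist_eq]
    refine hη _ (hin X hX t ⟨ht.1.le, ht.2.le⟩) X ?_ ((hdist X t ⟨ht.1.le, ht.2.le⟩).trans_lt h2)
    exact self_subset_cthickening C hX

/-- comparison of powers on a bounded range -/
lemma pow_cmp {n e1 e2 : ℝ} (h0 : 0 ≤ n) (h2 : n ≤ 2) (he : e2 ≤ e1) (he1 : e1 - e2 ≤ 1) (hp : 0 < e2) : n ^ e1 ≤ 2 * n ^ e2 := by
  rcases h0.eq_or_lt with h | h
  · rw [← h, Real.zero_rpow (by linarith), Real.zero_rpow hp.ne', mul_zero]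
  · have : n ^ e1 = n ^ (e1 - e2) * n ^ e2 := by rw [← Real.rpow_add h]; ring_nf
    rw [this]
    gcongr
    calc n ^ (e1 - e2) ≤ 2 ^ (e1 - e2) := by gcongr
      _ ≤ 2 ^ (1:ℝ) := Real.rpow_le_rpow_of_exponent_le (by norm_num) he1
      _ = 2 := by norm_num

lemma hasDerivAt_bc (t : ℝ) : HasDerivAt bc (Real.cos t, Real.sin t) t := by
  have h1 := Real.hasDerivAt_sin t
  have h2 : HasDerivAt (fun t => 1 - Real.cos t) (Real.sin t) t := by
    simpa using (Real.hasDerivAt_cos t).const_sub 1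
  exact h1.prodMk h2

/-- tangential derivative on the boundary -/
lemma deriv_bc {U : ℝ × ℝ → ℝ} {p q t : ℝ} (h : HasFDerivWithinAt U (LL p q) Omc (bc t)) :
    HasDerivAt (fun t => U (bc t)) (p * Real.cos t + q * Real.sin t) t := by
  have := h.comp_hasDerivWithinAt (s := univ) t (hasDerivAt_bc t).hasDerivWithinAt (fun s _ => (bc_mem s).1)
  rw [hasDerivWithinAt_univ] at this
  exact this.congr_deriv (by simp)

lemma Sol.tang (S : Sol K β Z U p q a b c γ γ1 γ2) (t : ℝ) : γ1 t = p (bc t) * Real.cos t + q (bc t) * Real.sin t := by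
  have h := deriv_bc (S.wd _ (bc_mem t).1)
  have e : (fun t => U (bc t)) = γ := funext S.bv
  rw [e] at h
  exact (S.bd.d t).unique h

lemma bc_zero : bc 0 = (0, 0) := by simp [bc]

lemma zero_mem : ((0:ℝ), (0:ℝ)) ∈ Omc := by simp [Omc]

lemma Sol.p0 (S : Sol K β Z U p q a b c γ γ1 γ2) : p (0, 0) = γ1 0 := by
  have := S.tang 0
  rw [bc_zero] at this
  simp at this; exact this.symm

lemma abs_one_sub_cos_sq (t : ℝ) : |1 - Real.cos t| ≤ t ^ 2 := by
  have h1 := Real.one_sub_sq_div_two_le_cos (x := t)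
  have h2 := Real.cos_le_one t
  rw [abs_of_nonneg (by linarith)]; nlinarith [sq_nonneg t]

/-- normal derivative at the origin -/
lemma normal_at_zero {w : ℝ × ℝ → ℝ} {P Q A C e : ℝ} (h : HasFDerivWithinAt w (LL P Q) Omc (0, 0)) (he : 0 < e) 
    (hb : ∀ X ∈ Omc, |w X - w (0,0) - P * X.1 - A * X.2| ≤ C * ‖X‖ ^ (1 + e)) : A = Q := by
  have h1 : HasDerivWithinAt (fun y : ℝ => ((0:ℝ), y)) (0, 1) (Icc 0 2) 0 :=
    ((hasDerivAt_const (0:ℝ) (0:ℝ)).prodMk (hasDerivAt_id (0:ℝ))).hasDerivWithinAt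
  have hm : MapsTo (fun y : ℝ => ((0:ℝ), y)) (Icc 0 2) Omc := by
    intro y hy
    simp only [Omc, mem_setOf_eq]; nlinarith [hy.1, hy.2]
  have h2 := h.comp_hasDerivWithinAt (0:ℝ) h1 hm
  simp at h2
  have h3 : HasDerivWithinAt (w ∘ fun y : ℝ => ((0:ℝ), y)) A (Icc 0 2) 0 := by
    rw [hasDerivWithinAt_iff_tendsto_slope]
    have hz : Tendsto (fun y : ℝ => A + -(C * |y| ^ e)) (𝓝[Icc 0 2 \ {0}] 0) (𝓝 A) := by
      have : Continuous (fun y : ℝ => A + -(C * |y| ^ e)) := by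
        have := Real.continuous_rpow_const he.le
        exact continuous_const.add (continuous_const.mul (this.comp continuous_abs)).neg
      have := this.tendsto 0
      simp [Real.zero_rpow he.ne'] at this
      exact this.mono_left nhdsWithin_le_nhds
    have hz' : Tendsto (fun y : ℝ => A + (C * |y| ^ e)) (𝓝[Icc 0 2 \ {0}] 0) (𝓝 A) := by
      have : Continuous (fun y : ℝ => A + (C * |y| ^ e)) := by
        have := Real.continuous_rpow_const he.le
        exact continuous_const.add (continuous_const.mul (this.comp continuous_abs))
      have := this.tendsto 0
      simp [Real.zero_rpow he.ne'] at this
      exact this.mono_left nhdsWithin_le_nhds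
    have key : ∀ y ∈ Icc (0:ℝ) 2 \ {0}, |slope (w ∘ fun y : ℝ => ((0:ℝ), y)) 0 y - A| ≤ C * |y| ^ e := by
      intro y hy
      have hy0 : 0 < y := lt_of_le_of_ne hy.1.1 (fun h => hy.2 h.symm)
      have := hb (0, y) (hm hy.1)
      have en : ‖((0:ℝ), y)‖ = |y| := by rw [norm_eq_max]; simp
      rw [en, abs_of_pos hy0, Real.rpow_add hy0, Real.rpow_one] at this
      rw [abs_of_pos hy0, slope_def_field]
      have e1 : ((w ∘ fun y : ℝ => ((0:ℝ), y)) y - (w ∘ fun y : ℝ => ((0:ℝ), y)) 0) / (y - 0) - A = (w (0, y) - w (0,0) - P * 0 - A * y) / y := by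
        simp only [Function.comp, sub_zero, mul_zero, sub_div, mul_div_cancel_right₀ A hy0.ne', zero_div]
      rw [e1, abs_div, abs_of_pos hy0, div_le_iff₀ hy0]
      calc _ ≤ _ := this
        _ = _ := by ring
    refine tendsto_of_tendsto_of_tendsto_of_le_of_le' hz hz' ?_ ?_
    · filter_upwards [self_mem_nhdsWithin] with y hy
      have := abs_le.1 (key y hy); linarith [this.1]
    · filter_upwards [self_mem_nhdsWithin] with y hy
      have := abs_le.1 (key y hy); linarith [this.2]
  have hu : UniqueDiffWithinAt ℝ (Icc (0:ℝ) 2) 0 := uniqueDiffOn_Icc (by norm_num) 0 ⟨le_rfl, by norm_num⟩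
  exact hu.eq_deriv _ h3 h2

end PW

namespace PW
open Filter MeasureTheory
open scoped Topology

/-- boundary `C^{1,β}` hypothesis -/
def KP (K β C : ℝ) : Prop := ∀ (w : ℝ × ℝ → ℝ) (N : ℝ),
    0 < N → Good K Om w → ContinuousOn w Omc → (∀ X ∈ Omc, X ∉ Om → |w X| ≤ N * ‖X‖ ^ (1 + β)) →
    ∃ a, |a| ≤ C * N ∧ ∀ X ∈ Omc, |w X - a * X.2| ≤ C * N * ‖X‖ ^ (1 + β)

lemma scale4 {n β : ℝ} (hn : 0 ≤ n) (h0 : 0 < β) (h1 : β ≤ 1) : (4 * n) ^ (1 + β) ≤ 16 * n ^ (1 + β) := by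
  rw [Real.mul_rpow (by norm_num) hn]
  gcongr
  calc (4:ℝ) ^ (1 + β) ≤ 4 ^ (2:ℝ) := Real.rpow_le_rpow_of_exponent_le (by norm_num) (by linarith)
    _ = 16 := by norm_num

lemma scale2 {n β : ℝ} (hn : 0 ≤ n) (h0 : 0 < β) (h1 : β ≤ 1) : (2 * n) ^ (1 + β) ≤ 4 * n ^ (1 + β) := by
  rw [Real.mul_rpow (by norm_num) hn]
  gcongr
  calc (2:ℝ) ^ (1 + β) ≤ 2 ^ (2:ℝ) := Real.rpow_le_rpow_of_exponent_le (by norm_num) (by linarith)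
    _ = 4 := by norm_num

lemma BdData.lip {β : ℝ} {γ γ1 γ2 : ℝ → ℝ} (h : BdData β γ γ1 γ2) (t : ℝ) : |γ1 t - γ1 0| ≤ |t| := by
  have := mvt_pow (h := fun t => γ1 t - γ1 0) (h' := γ2) (A := 1) (κ := 0) le_rfl (by norm_num) (fun t => (h.d1 t).sub_const _)
    (fun t => by simpa using h.b2 t) (by simp) t
  simpa using this

lemma BdData.e2 {β : ℝ} {γ γ1 γ2 : ℝ → ℝ} (h : BdData β γ γ1 γ2) (t : ℝ) : |γ t - γ 0 - γ1 0 * Real.sin t| ≤ 2 * |t| ^ 2 := by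
  have := mvt_pow (h := fun t => γ t - γ 0 - γ1 0 * Real.sin t) (h' := fun t => γ1 t - γ1 0 * Real.cos t) (A := 2) (κ := 1) (by norm_num) (by norm_num)
    (fun t => ((h.d t).sub_const _).sub ((Real.hasDerivAt_sin t).const_mul _))
    (fun t => ?_) (by simp) t
  · norm_num at this
    simpa using this
  · rw [Real.rpow_one]
    have e : γ1 t - γ1 0 * Real.cos t = (γ1 t - γ1 0) + γ1 0 * (1 - Real.cos t) := by ring
    rw [e]
    refine (abs_add_le _ _).trans ?_
    rw [abs_mul]
    have := h.lip t
    have := h.b1 0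
    have := one_sub_cos_le t
    nlinarith [abs_nonneg (γ1 0), abs_nonneg (1 - Real.cos t)]

lemma BdData.e3 {β : ℝ} {γ γ1 γ2 : ℝ → ℝ} (h : BdData β γ γ1 γ2) (hβ : 0 < β) (hβ1 : β ≤ 1) (t : ℝ) :
    |γ1 t - γ1 0 - γ2 0 * Real.sin t| ≤ 3 * |t| ^ (1 + β) := by
  have := mvt_pow (h := fun t => γ1 t - γ1 0 - γ2 0 * Real.sin t) (h' := fun t => γ2 t - γ2 0 * Real.cos t) (A := 3) (κ := β) hβ.le (by norm_num)
    (fun t => ((h.d1 t).sub_const _).sub ((Real.hasDerivAt_sin t).const_mul _))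
    (fun t => ?_) (by simp) t
  · rw [add_comm]; exact this
  · have e : γ2 t - γ2 0 * Real.cos t = (γ2 t - γ2 0) + γ2 0 * (1 - Real.cos t) := by ring
    rw [e]
    refine (abs_add_le _ _).trans ?_
    rw [abs_mul]
    have h1 := h.hol t 0
    rw [sub_zero] at h1
    have h2 := h.b2 0
    have h3 : |1 - Real.cos t| ≤ 2 * |t| ^ β := by
      rcases le_or_gt |t| 1 with h | h
      · have := Real.rpow_le_rpow_of_exponent_ge' (abs_nonneg t) h hβ.le hβ1
        rw [Real.rpow_one] at this
        have := one_sub_cos_le t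
        have := Real.rpow_nonneg (abs_nonneg t) β
        linarith
      · have := Real.one_le_rpow h.le hβ.le
        have h2 := Real.cos_le_one t
        have h3 := Real.neg_one_le_cos t
        rw [abs_of_nonneg (by linarith)]; linarith
    nlinarith [abs_nonneg (γ2 0), abs_nonneg (1 - Real.cos t)]

/-- first order expansion at the origin -/
lemma T1 {K β C : ℝ} (hβ : 0 < β) (hβ1 : β ≤ 1 / 2) (hC : 0 < C) (HK : KP K β C)
    {Z : ℝ → ℝ → ℝ → Prop} {U p q a b c : ℝ × ℝ → ℝ} {γ γ1 γ2 : ℝ → ℝ}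
    (S : Sol K β Z U p q a b c γ γ1 γ2) : |q (0, 0)| ≤ C * 64 ∧ 
      ∀ X ∈ Omc, |U X - U (0, 0) - p (0, 0) * X.1 - q (0, 0) * X.2| ≤ C * 64 * ‖X‖ ^ (1 + β) := by
  have hU0 : U (0, 0) = γ 0 := by rw [← bc_zero]; exact S.bv 0
  have hg : Good K Om (fun X => U X - U (0, 0) - p (0, 0) * X.1) := by
    refine (S.good_sub (U (0, 0)) (p (0, 0)) 0 S.ell.z0).congr ?_
    intro X hX
    simp; ring
  have hcont : ContinuousOn (fun X => U X - U (0, 0) - p (0, 0) * X.1) Omc := by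
    have := S.contU
    fun_prop
  have hbdry : ∀ X ∈ Omc, X ∉ Om → |U X - U (0, 0) - p (0, 0) * X.1| ≤ 64 * ‖X‖ ^ (1 + β) := by
    intro X hX hXn
    obtain ⟨t, rfl, ht⟩ := exists_bc hX hXn
    have h1 := S.bd.e2 t
    have e : U (bc t) - U (0, 0) - p (0, 0) * (bc t).1 = γ t - γ 0 - γ1 0 * Real.sin t := by
      rw [S.bv, hU0, S.p0]; rfl
    rw [e]
    have h2 := pow_cmp (n := ‖bc t‖) (e1 := 2) (e2 := 1 + β) (norm_nonneg _) (Omc_norm hX) (by linarith) (by linarith) (by linarith)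
    have h3 : |t| ^ 2 ≤ (4 * ‖bc t‖) ^ 2 := by gcongr
    rw [Real.rpow_two] at h2
    nlinarith
  obtain ⟨A, hA, hAb⟩ := HK _ 64 (by norm_num) hg hcont hbdry
  have hq := normal_at_zero (S.wd _ zero_mem) hβ hAb
  rw [hq] at hA hAb
  exact ⟨hA, hAb⟩

/-- first order expansion at boundary points -/
lemma T1b {K β C : ℝ} (hβ : 0 < β) (hβ1 : β ≤ 1 / 2) (hC : 0 < C) (HK : KP K β C) : ∃ C1 > 0, ∀ 
    {Z : ℝ → ℝ → ℝ → Prop} {U p q a b c : ℝ × ℝ → ℝ} {γ γ1 γ2 : ℝ → ℝ},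
    Sol K β Z U p q a b c γ γ1 γ2 → ∀ t, |p (bc t)| ≤ C1 ∧ |q (bc t)| ≤ C1 ∧ 
      ∀ X ∈ Omc, |U X - U (bc t) - p (bc t) * (X.1 - (bc t).1) - q (bc t) * (X.2 - (bc t).2)| ≤ C1 * ‖X - bc t‖ ^ (1 + β) := by
  refine ⟨C * 256 + 1, by positivity, ?_⟩
  intro Z U p q a b c γ γ1 γ2 S t
  obtain ⟨a', b', c', S'⟩ := S.rot t
  obtain ⟨h1, h2⟩ := T1 hβ hβ1 hC HK S'
  have h3 := S'.p0
  have h4 := S'.bd.b1 0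
  rw [← h3] at h4
  simp only [rot_zero] at h1 h2 h4
  have hcs := Real.cos_sq_add_sin_sq t
  have c1 := Real.abs_cos_le_one t
  have s1 := Real.abs_sin_le_one t
  set P := p (bc t)
  set Q := q (bc t)
  set co := Real.cos t with hco
  set si := Real.sin t with hsi
  have trig : ∀ A B : ℝ, ∀ a b : ℝ, |a| ≤ 1 → |b| ≤ 1 → |a * A + b * B| ≤ |A| + |B| := by
    intro A B a b ha hb
    refine (abs_add_le _ _).trans ?_
    rw [abs_mul, abs_mul]
    nlinarith [abs_nonneg A, abs_nonneg B]
  refine ⟨?_, ?_, ?_⟩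
  · have := trig (co * P + si * Q) (-si * P + co * Q) co (-si) c1 (by rwa [abs_neg])
    rw [show co * (co * P + si * Q) + -si * (-si * P + co * Q) = P by linear_combination P * hcs] at this
    linarith
  · have := trig (co * P + si * Q) (-si * P + co * Q) si co s1 c1
    rw [show si * (co * P + si * Q) + co * (-si * P + co * Q) = Q by linear_combination Q * hcs] at this
    linarith
  · intro X hX
    have hm : rot (-t) X ∈ Omc := (rot_Omc _ _).2 hX
    have := h2 _ hm
    rw [rot_rot] at this
    have e1 : (rot (-t) X).1 = co * (X.1 - si) + si * (X.2 - (1 - co)) := by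
      simp only [rot, aff, Real.sin_neg, Real.cos_neg, ← hco, ← hsi]; ring
    have e2 : (rot (-t) X).2 = -si * (X.1 - si) + co * (X.2 - (1 - co)) := by
      simp only [rot, aff, Real.sin_neg, Real.cos_neg, ← hco, ← hsi]; linear_combination - hcs
    have e3 : U X - U (bc t) - P * (X.1 - (bc t).1) - Q * (X.2 - (bc t).2) = U X - U (bc t) - (co * P + si * Q) * (rot (-t) X).1 - (-si * P + co * Q) * (rot (-t) X).2 := by
      rw [e1, e2]; simp only [bc, ← hco, ← hsi]
      linear_combination (P * (X.1 - si) + Q * (X.2 - (1 - co))) * hcs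
    rw [e3]
    refine this.trans ?_
    have n1 := abs_fst_le (X - bc t)
    have n2 := abs_snd_le (X - bc t)
    have hn : ‖rot (-t) X‖ ≤ 2 * ‖X - bc t‖ := by
      rw [norm_eq_max, e1, e2]
      refine max_le ((trig _ _ _ _ c1 s1).trans ?_) ((trig _ _ _ _ (by rwa [abs_neg]) c1).trans ?_)
      · simp only [bc, Prod.fst_sub, Prod.snd_sub] at n1 n2 ⊢; linarith
      · simp only [bc, Prod.fst_sub, Prod.snd_sub] at n1 n2 ⊢; linarith
    have h5 : ‖rot (-t) X‖ ^ (1 + β) ≤ (2 * ‖X - bc t‖) ^ (1 + β) := by gcongr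
    have h6 := scale2 (n := ‖X - bc t‖) (norm_nonneg _) hβ (by linarith)
    have h7 : 0 ≤ ‖X - bc t‖ ^ (1 + β) := by positivity
    nlinarith

lemma axis_mem' {y : ℝ} (h0 : 0 ≤ y) (h2 : y ≤ 2) : ((0:ℝ), y) ∈ Omc := by
  simp only [Omc, mem_setOf_eq]; nlinarith

/-- Hölder estimate of the normal derivative on the boundary -/
lemma osc_q {K β C1 : ℝ} (hβ : 0 < β) (hβ1 : β ≤ 1 / 2) (hC1 : 0 < C1)
    {Z : ℝ → ℝ → ℝ → Prop} {U p q a b c : ℝ × ℝ → ℝ} {γ γ1 γ2 : ℝ → ℝ}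
    (H : ∀ t, |p (bc t)| ≤ C1 ∧ |q (bc t)| ≤ C1 ∧ 
      ∀ X ∈ Omc, |U X - U (bc t) - p (bc t) * (X.1 - (bc t).1) - q (bc t) * (X.2 - (bc t).2)| ≤ C1 * ‖X - bc t‖ ^ (1 + β)) (t : ℝ) :
    |q (bc t) - q (0, 0)| ≤ 6 * C1 * ‖bc t‖ ^ β := by
  rcases (norm_nonneg (bc t)).eq_or_lt with h | h
  · have : bc t = (0, 0) := by rw [← Prod.zero_eq_mk]; exact norm_eq_zero.1 h.symm
    rw [this]; simp; positivity
  set ρ := ‖bc t‖ with hρ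
  have hρ2 : ρ ≤ 2 := Omc_norm (bc_mem t).1
  have h1 := (H t).2.2 (0, ρ) (axis_mem' h.le hρ2)
  have h2 := (H t).2.2 (0, 0) zero_mem
  have h3 := (H 0).2.2 (0, ρ) (axis_mem' h.le hρ2)
  rw [bc_zero] at h3
  have n3 : ‖((0:ℝ), ρ) - (0, 0)‖ = ρ := by rw [norm_eq_max]; simp [abs_of_pos h, h.le]
  have n2 : ‖((0:ℝ), (0:ℝ)) - bc t‖ = ρ := by rw [← Prod.zero_eq_mk, zero_sub, norm_neg]
  have n1 : ‖((0:ℝ), ρ) - bc t‖ ≤ 2 * ρ := by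
    have : ‖((0:ℝ), ρ)‖ = ρ := by rw [norm_eq_max]; simp [abs_of_pos h, h.le]
    refine (norm_sub_le _ _).trans ?_
    rw [this, ← hρ]; linarith
  have n1' : ‖((0:ℝ), ρ) - bc t‖ ^ (1 + β) ≤ 4 * ρ ^ (1 + β) := 
    (Real.rpow_le_rpow (norm_nonneg _) n1 (by linarith)).trans (scale2 h.le hβ (by linarith))
  rw [n3] at h3
  rw [n2] at h2
  have h1' := h1.trans (mul_le_mul_of_nonneg_left n1' hC1.le)
  have e : ρ ^ (1 + β) = ρ * ρ ^ β := by rw [Real.rpow_add h, Real.rpow_one]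
  rw [e] at h1' h2 h3
  simp only [] at h1' h2 h3
  have hk : |q (bc t) - q (0, 0)| * ρ ≤ (6 * C1 * ρ ^ β) * ρ := by
    rw [← abs_of_pos h, ← abs_mul, abs_of_pos h]
    rw [abs_le] at h1' h2 h3 ⊢
    constructor <;> linarith [h1'.1, h1'.2, h2.1, h2.2, h3.1, h3.2]
  exact le_of_mul_le_mul_right hk h

/-- second order expansion of the tangential derivative -/
lemma step3 {K β C : ℝ} (hβ : 0 < β) (hβ1 : β ≤ 1 / 2) (hC : 0 < C) (HK : KP K β C) : ∃ C1 > 0, ∀ 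
    {Z : ℝ → ℝ → ℝ → Prop} {U p q a b c : ℝ × ℝ → ℝ} {γ γ1 γ2 : ℝ → ℝ},
    Sol K β Z U p q a b c γ γ1 γ2 → |q (0, 0)| ≤ C1 ∧ 
      (∀ X ∈ Omc, |U X - U (0, 0) - p (0, 0) * X.1 - q (0, 0) * X.2| ≤ C1 * ‖X‖ ^ (1 + β)) ∧
      (∀ t, |q (bc t) - q (0, 0)| ≤ C1 * ‖bc t‖ ^ β) ∧ ∃ b0, |b0| ≤ C1 ∧
      ∀ X ∈ Omc, |p X - γ1 0 - (γ2 0 - q (0, 0)) * X.1 - b0 * X.2| ≤ C1 * ‖X‖ ^ (1 + β) := by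
  obtain ⟨C1, hC1, H⟩ := T1b hβ hβ1 hC HK
  set N := 48 + 8 * C1 with hN
  refine ⟨C1 + 6 * C1 + C * N, by positivity, ?_⟩
  intro Z U p q a b c γ γ1 γ2 S
  have H := H S
  have hq := osc_q hβ hβ1 hC1 (K := K) (Z := Z) (a := a) (b := b) (c := c) (γ := γ) (γ1 := γ1) (γ2 := γ2) H
  have hCN : 0 < C * N := by positivity
  have H0 := H 0
  rw [bc_zero] at H0
  simp only [sub_zero, ← Prod.zero_eq_mk] at H0
  simp only [← Prod.zero_eq_mk]
  have hg : Good K Om (fun X => p X - γ1 0 - (γ2 0 - q 0) * X.1) :=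
    (S.good_p.affine 1 (-γ1 0) (-(γ2 0 - q 0)) 0).congr (fun X _ => by ring)
  have hcont : ContinuousOn (fun X => p X - γ1 0 - (γ2 0 - q 0) * X.1) Omc := by
    have := S.cp
    fun_prop
  have hbdry : ∀ X ∈ Omc, X ∉ Om → |p X - γ1 0 - (γ2 0 - q 0) * X.1| ≤ N * ‖X‖ ^ (1 + β) := by
    intro X hX hXn
    obtain ⟨t, rfl, ht⟩ := exists_bc hX hXn
    have h1 := S.bd.e3 hβ (by linarith) t
    have h2 := hq t
    have h3 := (H t).1
    have h4 := bdry_snd hX hXn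
    have ht' := S.tang t
    have h5 := pow_cmp (n := ‖bc t‖) (e1 := 2) (e2 := 1 + β) (norm_nonneg _) (Omc_norm hX) (by linarith) (by linarith) (by linarith)
    rw [Real.rpow_two] at h5
    have h6 : |t| ^ (1 + β) ≤ 16 * ‖bc t‖ ^ (1 + β) := 
      (Real.rpow_le_rpow (abs_nonneg _) ht (by linarith)).trans (scale4 (norm_nonneg _) hβ (by linarith))
    have e : p (bc t) - γ1 0 - (γ2 0 - q 0) * (bc t).1 = (γ1 t - γ1 0 - γ2 0 * Real.sin t) - (q (bc t) - q (0,0)) * (bc t).1 + p (bc t) * (bc t).2 := by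
      rw [ht', Prod.zero_eq_mk]; simp only [bc]; ring
    rw [e]
    have h7 : |(q (bc t) - q (0,0)) * (bc t).1| ≤ 6 * C1 * ‖bc t‖ ^ (1 + β) := by
      rw [abs_mul]
      have e : ‖bc t‖ ^ (1 + β) = ‖bc t‖ ^ β * ‖bc t‖ := by
        rw [add_comm, Real.rpow_add_one' (norm_nonneg _) (by linarith)]
      rw [e, ← mul_assoc]
      exact mul_le_mul h2 (abs_fst_le _) (abs_nonneg _) (by positivity)
    have h8 : |p (bc t) * (bc t).2| ≤ C1 * (2 * ‖bc t‖ ^ (1 + β)) := by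
      rw [abs_mul, abs_of_nonneg (Omc_bounds hX).1]
      exact mul_le_mul h3 (h4.trans h5) (Omc_bounds hX).1 hC1.le
    refine (abs_add_le _ _).trans ((add_le_add (abs_sub _ _) le_rfl).trans ?_)
    rw [hN]
    linarith
  obtain ⟨b0, hb0, hb⟩ := HK _ N (by positivity) hg hcont hbdry
  refine ⟨H0.2.1.trans (by linarith), fun X hX => (H0.2.2 X hX).trans ?_, fun t => (hq t).trans ?_, b0, hb0.trans (by linarith), fun X hX => (hb X hX).trans ?_⟩
  · gcongr; linarith
  · gcongr; linarith
  · gcongr; linarith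

end PW

namespace PW
open Filter MeasureTheory
open scoped Topology

lemma SK_c_bound {K a b c A : ℝ} (hK : 1 ≤ K) (h : SK K a b c) (ha : |a| ≤ A) (hb : |b| ≤ A) : |c| ≤ 2 * K * A := by
  unfold SK at h
  by_contra hc
  push Not at hc
  have hA : 0 ≤ A := (abs_nonneg a).trans ha
  have h1 : -(a * c) ≤ A * |c| := by
    have := neg_abs_le (a * c); rw [abs_mul] at this
    nlinarith [abs_nonneg c]
  have h2 : b ^ 2 ≤ A ^ 2 := by rw [← sq_abs]; gcongr
  have h3 : c ^ 2 ≤ K * (A ^ 2 + A * |c|) := by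
    have : b ^ 2 - a * c ≤ A ^ 2 + A * |c| := by linarith
    nlinarith [sq_nonneg a, sq_nonneg b]
  rw [← sq_abs] at h3
  have h4 : A ≤ |c| := by nlinarith
  have h5 : 0 < |c| := lt_of_le_of_lt (by positivity) hc
  have h6 : K * (A ^ 2 + A * |c|) ≤ (2 * K * A) * |c| := by nlinarith [mul_nonneg (mul_nonneg (by linarith : 0 ≤ K) hA) (sub_nonneg.2 h4)]
  nlinarith

lemma scale4' {n β : ℝ} (hn : 0 ≤ n) (h1 : β ≤ 1) : (4 * n) ^ (2 + β) ≤ 64 * n ^ (2 + β) := by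
  rw [Real.mul_rpow (by norm_num) hn]
  gcongr
  calc (4:ℝ) ^ (2 + β) ≤ 4 ^ (3:ℝ) := Real.rpow_le_rpow_of_exponent_le (by norm_num) (by linarith)
    _ = 64 := by norm_num

lemma step4 {K β C : ℝ} (hK : 1 ≤ K) (hβ : 0 < β) (hβ1 : β ≤ 1 / 2) (hC : 0 < C) (HK : KP K β C) : ∃ C2 > 0, ∀ 
    {Z : ℝ → ℝ → ℝ → Prop} {U p q a b c : ℝ × ℝ → ℝ} {γ γ1 γ2 : ℝ → ℝ},
    Sol K β Z U p q a b c γ γ1 γ2 → ∃ k p0 q0 a0 b0 c0 : ℝ, |p0| ≤ C2 ∧ |q0| ≤ C2 ∧ |a0| ≤ C2 ∧ |b0| ≤ C2 ∧ |c0| ≤ C2 ∧ Z a0 b0 c0 ∧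
      ∀ X ∈ Omc, |U X - (k + p0 * X.1 + q0 * X.2 + (a0 * X.1 ^ 2 / 2 + b0 * X.1 * X.2 + c0 * X.2 ^ 2 / 2))| ≤ C2 * ‖X‖ ^ (2 + β) := by
  obtain ⟨C1, hC1, H⟩ := step3 hβ hβ1 hC HK
  set A1 := 1 + C1 with hA1
  set c2 := 2 * K * A1 with hc2
  have c20 : 0 < c2 := by positivity
  set D := C1 + 2 * (C1 + c2) with hD
  set A := 64 * (C1 + D) + C1 + c2 with hA
  have hD0 : 0 < D := by positivity
  have hA0 : 0 < A := by positivity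
  obtain ⟨C3, hC3, HI⟩ := bdry_improve hK hβ (by linarith : β ≤ 1) A hA0
  refine ⟨1 + C1 + c2 + C3, by positivity, ?_⟩
  intro Z U p q a b c γ γ1 γ2 S
  obtain ⟨hq0, hT, hosc, b0, hb0, hp⟩ := H S
  have hU0 : U (0, 0) = γ 0 := by rw [← bc_zero]; exact S.bv 0
  set q0 := q (0, 0) with hq0d
  set p0 := p (0, 0) with hp0d
  have hpg : p0 = γ1 0 := S.p0
  rw [← hpg] at hp
  have hp0 : |p0| ≤ 1 := by rw [hpg]; exact S.bd.b1 0
  set a0 := γ2 0 - q0 with ha0d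
  have ha0 : |a0| ≤ A1 := (abs_sub _ _).trans (by have := S.bd.b2 0; linarith)
  obtain ⟨c0, hZ⟩ := S.ell.zn a0 b0 0 0 1 (by norm_num)
  have hZ : Z a0 b0 c0 := by convert hZ using 1 <;> ring
  have hc0 : |c0| ≤ c2 := by
    have := S.ell.sk _ _ _ _ _ _ hZ S.ell.z0
    simp only [sub_zero] at this
    exact SK_c_bound hK this ha0 (by linarith)
  refine ⟨U (0, 0), p0, q0, a0, b0, c0, by linarith, by linarith, by linarith, by linarith, by linarith, hZ, ?_⟩
  set v : ℝ × ℝ → ℝ := fun X => U X - (U (0, 0) + p0 * X.1 + q0 * X.2 + (a0 * X.1 ^ 2 / 2 + b0 * X.1 * X.2 + c0 * X.2 ^ 2 / 2)) with hv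
  have hvd : ∀ X ∈ Omc, HasFDerivWithinAt v (LL (p X - (p0 + a0 * X.1 + b0 * X.2)) (q X - (q0 + b0 * X.1 + c0 * X.2))) Omc X := by
    intro X hX
    have h1 := (S.wd X hX).sub ((JetOn.quad univ (U (0, 0)) p0 q0 a0 b0 c0).w X trivial).hasFDerivWithinAt
    refine h1.congr_fderiv ?_
    apply LL_ext <;> simp
  have hvx : ∀ X ∈ Omc, |p X - (p0 + a0 * X.1 + b0 * X.2)| ≤ C1 * ‖X‖ ^ (1 + β) := by
    intro X hX
    have := hp X hX
    rwa [show p X - (p0 + a0 * X.1 + b0 * X.2) = p X - p0 - a0 * X.1 - b0 * X.2 by ring]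
  have hvy : ∀ t, |q (bc t) - (q0 + b0 * (bc t).1 + c0 * (bc t).2)| ≤ D * ‖bc t‖ ^ β := by
    intro t
    have h1 := hosc t
    have h2 := pow_cmp (n := ‖bc t‖) (e1 := 1) (e2 := β) (norm_nonneg _) (Omc_norm (bc_mem t).1) (by linarith) (by linarith) hβ
    rw [Real.rpow_one] at h2
    have h3 : |b0 * (bc t).1| ≤ C1 * ‖bc t‖ := by
      rw [abs_mul]; exact mul_le_mul hb0 (abs_fst_le _) (abs_nonneg _) hC1.le
    have h4 : |c0 * (bc t).2| ≤ c2 * ‖bc t‖ := by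
      rw [abs_mul]; exact mul_le_mul hc0 (abs_snd_le _) (abs_nonneg _) c20.le
    have h5 : (C1 + c2) * ‖bc t‖ ≤ (C1 + c2) * (2 * ‖bc t‖ ^ β) := by gcongr
    rw [abs_le] at *
    rw [hD]
    constructor <;> linarith [h1.1, h1.2, h3.1, h3.2, h4.1, h4.2]
  have hbd : ∀ t, |v (bc t)| ≤ (C1 + D) * |t| ^ (2 + β) := by
    intro t
    have := mvt_pow (h := fun t => v (bc t)) (κ := 1 + β) (A := C1 + D) (by linarith) (by positivity)
      (fun t => deriv_bc (hvd _ (bc_mem t).1)) (fun t => ?_) (by simp [bc_zero, hv]) t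
    · rwa [show 1 + β + 1 = 2 + β by ring] at this
    · refine (abs_add_le _ _).trans ?_
      rw [abs_mul, abs_mul]
      have h1 := hvx _ (bc_mem t).1
      have h2 := hvy t
      have h3 : |Real.sin t| ≤ ‖bc t‖ := abs_fst_le (bc t)
      have h4 := Real.abs_cos_le_one t
      have e : ‖bc t‖ ^ (1 + β) = ‖bc t‖ ^ β * ‖bc t‖ := by
        rw [add_comm, Real.rpow_add_one' (norm_nonneg _) (by linarith)]
      have h5 : ‖bc t‖ ^ (1 + β) ≤ |t| ^ (1 + β) := Real.rpow_le_rpow (norm_nonneg _) (bc_norm t) (by linarith)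
      have h6 := mul_le_mul h1 h4 (abs_nonneg _) (by positivity)
      have h7 := mul_le_mul h2 h3 (abs_nonneg _) (by positivity)
      have h8 : (C1 + D) * ‖bc t‖ ^ (1 + β) ≤ (C1 + D) * |t| ^ (1 + β) := by gcongr
      rw [mul_assoc, ← e] at h7
      linarith
  have hres := HI v ?_ ?_ ?_ ?_ ?_
  · intro X hX
    refine (hres X hX).trans ?_
    gcongr
    linarith
  · exact S.good_sub _ _ _ hZ
  · exact fun X hX => (hvd X hX).continuousWithinAt
  · intro X hX hXn
    obtain ⟨t, rfl, ht⟩ := exists_bc hX hXn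
    have h6 : |t| ^ (2 + β) ≤ 64 * ‖bc t‖ ^ (2 + β) := 
      (Real.rpow_le_rpow (abs_nonneg _) ht (by linarith)).trans (scale4' (norm_nonneg _) (by linarith))
    have h7 := hbd t
    have h8 : 0 ≤ ‖bc t‖ ^ (2 + β) := by positivity
    have h9 := mul_le_mul_of_nonneg_left h6 (by positivity : 0 ≤ C1 + D)
    have h10 : 0 ≤ (C1 + c2) * ‖bc t‖ ^ (2 + β) := by positivity
    rw [hA]; linarith
  · intro X hX
    obtain ⟨x, y⟩ := X
    have hm : MapsTo (fun s : ℝ => (s * x, y)) (Icc 0 1) Omc := by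
      intro s hs
      simp only [Omc, mem_setOf_eq] at hX ⊢
      have : s ^ 2 ≤ 1 := by nlinarith [hs.1, hs.2]
      nlinarith [sq_nonneg x]
    have hnn : ∀ s ∈ Icc (0:ℝ) 1, ‖(s * x, y)‖ ≤ ‖(x, y)‖ := by
      intro s hs
      rw [norm_eq_max, norm_eq_max]
      refine max_le_max ?_ le_rfl
      simp only []
      rw [abs_mul, abs_of_nonneg hs.1]; nlinarith [abs_nonneg x, hs.2]
    have hder : ∀ s ∈ Icc (0:ℝ) 1, HasDerivWithinAt (fun s => v (s * x, y)) ((p (s * x, y) - (p0 + a0 * (s * x) + b0 * y)) * x) (Icc 0 1) s := by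
      intro s hs
      have h1 : HasDerivWithinAt (fun s : ℝ => (s * x, y)) (x, 0) (Icc 0 1) s := by
        have := ((hasDerivAt_id s).mul_const x).prodMk (hasDerivAt_const s y)
        simpa using this.hasDerivWithinAt
      have := (hvd _ (hm hs)).comp_hasDerivWithinAt s h1 hm
      exact this.congr_deriv (by simp)
    have hbb : ∀ s ∈ Icc (0:ℝ) 1, ‖(p (s * x, y) - (p0 + a0 * (s * x) + b0 * y)) * x‖ ≤ C1 * ‖(x, y)‖ ^ (2 + β) := by
      intro s hs
      rw [norm_mul, Real.norm_eq_abs, Real.norm_eq_abs]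
      have h1 := hvx _ (hm hs)
      have h2 : ‖(s * x, y)‖ ^ (1 + β) ≤ ‖(x, y)‖ ^ (1 + β) := Real.rpow_le_rpow (norm_nonneg _) (hnn s hs) (by linarith)
      have h3 : |x| ≤ ‖(x, y)‖ := abs_fst_le (x, y)
      have e : ‖(x, y)‖ ^ (2 + β) = ‖(x, y)‖ ^ (1 + β) * ‖(x, y)‖ := by
        rw [show 2 + β = (1 + β) + 1 by ring, Real.rpow_add_one' (norm_nonneg _) (by linarith)]
      rw [e]
      have h4 : |p (s * x, y) - (p0 + a0 * (s * x) + b0 * y)| ≤ C1 * ‖(x, y)‖ ^ (1 + β) := h1.trans (mul_le_mul_of_nonneg_left h2 hC1.le)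
      calc _ ≤ (C1 * ‖(x, y)‖ ^ (1 + β)) * ‖(x, y)‖ := mul_le_mul h4 h3 (abs_nonneg _) (by positivity)
        _ = _ := by ring
    have := (convex_Icc (0:ℝ) 1).norm_image_sub_le_of_norm_hasDerivWithin_le hder hbb (left_mem_Icc.2 zero_le_one) (right_mem_Icc.2 zero_le_one)
    simp only [one_mul, zero_mul, sub_zero, norm_one, mul_one] at this
    refine this.trans ?_
    gcongr
    rw [hA]; linarith
  · intro y y0 y2
    have hn : ‖((0:ℝ), y)‖ = y := by rw [norm_eq_max]; simp [abs_of_pos y0, y0.le]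
    have h1 := hT (0, y) (axis_mem' y0.le y2)
    rw [hn] at h1
    have h2 := pow_cmp (n := y) (e1 := 2) (e2 := 1 + β) y0.le y2 (by linarith) (by linarith) (by linarith)
    rw [Real.rpow_two] at h2
    have h3 : |c0 * y ^ 2| ≤ c2 * (2 * y ^ (1 + β)) := by
      rw [abs_mul, abs_of_nonneg (sq_nonneg y)]
      exact mul_le_mul hc0 h2 (by positivity) c20.le
    have h4 : 0 ≤ 64 * (C1 + D) * y ^ (1 + β) := by positivity
    simp only [hv] at h1 ⊢
    rw [hA]
    rw [abs_le] at *
    constructor <;> linarith [h1.1, h1.2, h3.1, h3.2]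

end PW

namespace PW
open Filter MeasureTheory
open scoped Topology

lemma rpow_le_cube {s e : ℝ} (hs : 1 ≤ s) (he : e ≤ 3) : s ^ e ≤ s ^ 3 := by
  have := Real.rpow_le_rpow_of_exponent_le hs he
  rwa [show (3:ℝ) = ((3:ℕ):ℝ) by norm_num, Real.rpow_natCast] at this

set_option maxHeartbeats 1600000 in
lemma step6 (K : ℝ) (hK : 1 ≤ K) : ∃ β : ℝ, 0 < β ∧ β ≤ 1 / 2 ∧ ∃ C > 0, ∀ 
    {Z : ℝ → ℝ → ℝ → Prop} {U p q a b c : ℝ × ℝ → ℝ} {γ γ1 γ2 : ℝ → ℝ},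
    Sol K β Z U p q a b c γ γ1 γ2 → ∀ d, 0 ≤ d → d ≤ 1 → ∃ k p0 q0 a0 b0 c0 : ℝ, |p0| ≤ C ∧ |q0| ≤ C ∧ |a0| ≤ C ∧ |b0| ≤ C ∧ |c0| ≤ C ∧
      ∀ X ∈ Omc, |U X - (k + p0 * X.1 + q0 * (X.2 - d) + (a0 * X.1 ^ 2 / 2 + b0 * X.1 * (X.2 - d) + c0 * (X.2 - d) ^ 2 / 2))| ≤ C * ‖X - (0, d)‖ ^ (2 + β) := by
  obtain ⟨αc, α0, α1, HK⟩ := K_thm2 K hK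
  obtain ⟨g, CI, g0, g1, CI0, HI⟩ := interior2 K hK
  obtain ⟨β, hβd⟩ : ∃ β, β = min αc g := ⟨_, rfl⟩
  have hβ : 0 < β := by rw [hβd]; positivity
  have hβα : β ≤ αc := by rw [hβd]; exact min_le_left _ _
  have hβg : β ≤ g := by rw [hβd]; exact min_le_right _ _
  have hβ1 : β ≤ 1 / 2 := hβg.trans g1
  clear hβd
  refine ⟨β, hβ, hβ1, ?_⟩
  obtain ⟨Ck, Ck0, HKβ⟩ := HK β hβ hβα
  obtain ⟨C2, C20, H4⟩ := step4 hK hβ hβ1 Ck0 HKβ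
  set CF := 2 * C2 + CI * 32 * C2 + (CI * 64 * C2 + 33 ^ 3 * C2 + (1 + 4 * CI) * 4096 * (64 * C2)) with hCF
  have CF0 : 0 < CF := by positivity
  have CFa : 2 * C2 + CI * 32 * C2 ≤ CF := by
    have : 0 < (CI * 64 * C2 + 33 ^ 3 * C2 + (1 + 4 * CI) * 4096 * (64 * C2)) := by positivity
    linarith
  refine ⟨CF, CF0, ?_⟩
  intro Z U p q a b c γ γ1 γ2 S d d0 d1
  obtain ⟨k, p0, q0, a0, b0, c0, hp, hq, ha, hb, hc, hZ, hv⟩ := H4 S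
  rcases d0.eq_or_lt with hd | hd
  · subst hd
    have : 0 < CI * 32 * C2 := by positivity
    refine ⟨k, p0, q0, a0, b0, c0, by linarith, by linarith, by linarith, by linarith, by linarith, ?_⟩
    intro X hX
    have h := hv X hX
    simp only [sub_zero, ← Prod.zero_eq_mk]
    refine h.trans ?_
    gcongr
    linarith
  set v : ℝ × ℝ → ℝ := fun X => U X - (k + p0 * X.1 + q0 * X.2 + (a0 * X.1 ^ 2 / 2 + b0 * X.1 * X.2 + c0 * X.2 ^ 2 / 2)) with hvd
  set ρ := d / 2 with hρ
  have ρ0 : 0 < ρ := by positivity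
  set X0 : ℝ × ℝ := (0, d) with hX0
  have hball : ball X0 ρ ⊆ Om := by
    intro X hX
    rw [mem_ball, dist_eq_norm, norm_eq_max, max_lt_iff] at hX
    simp only [hX0, Prod.fst_sub, Prod.snd_sub, sub_zero, abs_lt] at hX
    simp only [Om, mem_setOf_eq]
    have : 0 < (X.2 - d / 2) * (2 - X.2 - d / 2) + d / 2 * (2 - X.2 - d/2) := by nlinarith
    have h2 : d / 2 * (2 - X.2) + (X.2 - d / 2) * (2 - X.2)= X.2 * (2 - X.2) := by ring
    nlinarith [hX.1.1, hX.1.2, hX.2.1, hX.2.2]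
  set M := 8 * C2 * d ^ (2 + β) with hM
  have M0 : 0 < M := by positivity
  have h2p : (2:ℝ) ^ (2 + β) ≤ 8 := by
    have := rpow_le_cube (s := 2) (e := 2 + β) (by norm_num) (by linarith)
    norm_num at this ⊢; exact this
  have J := (S.jet.lin (JetOn.quad Om k p0 q0 a0 b0 c0) 1 (-1)).mono hball
  have hMb : ∀ X ∈ ball X0 ρ, |1 * U X + -1 * (k + p0 * X.1 + q0 * X.2 + (a0 * X.1 ^ 2 / 2 + b0 * X.1 * X.2 + c0 * X.2 ^ 2 / 2))| ≤ M := by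
    intro X hX
    have h1 := hv X (Om_sub (hball hX))
    have h2 : ‖X‖ ≤ 2 * d := by
      rw [mem_ball, dist_eq_norm] at hX
      have h3 : ‖X0‖ = d := by rw [norm_eq_max]; simp [hX0, abs_of_pos hd, hd.le]
      have h4 : ‖X‖ ≤ ‖X - X0‖ + ‖X0‖ := by simpa using norm_add_le (X - X0) X0
      linarith
    have h3 : ‖X‖ ^ (2 + β) ≤ (2 * d) ^ (2 + β) := Real.rpow_le_rpow (norm_nonneg _) h2 (by linarith)
    rw [Real.mul_rpow (by norm_num) hd.le] at h3
    have h4 : (2:ℝ) ^ (2 + β) * d ^ (2 + β) ≤ 8 * d ^ (2 + β) := by gcongr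
    rw [one_mul, neg_one_mul, ← sub_eq_add_neg]
    refine h1.trans ?_
    calc C2 * ‖X‖ ^ (2 + β) ≤ C2 * (8 * d ^ (2 + β)) := by gcongr; linarith
      _ = M := by rw [hM]; ring
  obtain ⟨h1, h2, h3, h4, h5, h6⟩ := HI _ _ _ _ _ _ X0 ρ M ρ0 M0 J (fun X hX => by
      have := S.ell.sk _ _ _ _ _ _ (S.eq X (hball hX)) hZ
      convert this using 1 <;> ring) (fun X hX Y hY => by
      have := S.ell.sk _ _ _ _ _ _ (S.eq X (hball hX)) (S.eq Y (hball hY))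
      convert this using 1 <;> ring) hMb
  have hM0 : |1 * U X0 + -1 * (k + p0 * X0.1 + q0 * X0.2 + (a0 * X0.1 ^ 2 / 2 + b0 * X0.1 * X0.2 + c0 * X0.2 ^ 2 / 2))| ≤ M := hMb X0 (mem_ball_self ρ0)
  have hvX : ∀ X, 1 * U X + -1 * (k + p0 * X.1 + q0 * X.2 + (a0 * X.1 ^ 2 / 2 + b0 * X.1 * X.2 + c0 * X.2 ^ 2 / 2)) = v X := by
    intro X; simp only [hvd]; ring
  simp only [hvX] at h6 hM0
  generalize 1 * p X0 + -1 * (p0 + a0 * X0.1 + b0 * X0.2) = pv at *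
  generalize 1 * q X0 + -1 * (q0 + b0 * X0.1 + c0 * X0.2) = qv at *
  generalize 1 * a X0 + -1 * a0 = av at *
  generalize 1 * b X0 + -1 * b0 = bv at *
  generalize 1 * c X0 + -1 * c0 = cv at *
  clear HI J hMb HK H4
  -- size of the coefficients
  have hb2 : CI * M / ρ ^ 2 ≤ CI * 32 * C2 := by
    have e : d ^ (2 + β) = d ^ β * d ^ 2 := by rw [add_comm, Real.rpow_add hd, Real.rpow_two]
    have h : d ^ β ≤ 1 := Real.rpow_le_one hd.le d1 hβ.le
    rw [hM, e, hρ]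
    have : CI * (8 * C2 * (d ^ β * d ^ 2)) / (d / 2) ^ 2 = CI * 32 * C2 * d ^ β := by field_simp; norm_num
    rw [this]
    have : 0 < CI * 32 * C2 := by positivity
    nlinarith
  have hb1 : CI * M / ρ ≤ CI * 32 * C2 := by
    refine le_trans ?_ hb2
    have hρ1 : ρ ≤ 1 := by linarith
    apply div_le_div_of_nonneg_left (by positivity) (by positivity)
    nlinarith
  have dm : ∀ s t : ℝ, |s| ≤ C2 → |t| ≤ C2 → |s + t * d| ≤ 2 * C2 := by
    intro s t hs ht
    refine (abs_add_le _ _).trans ?_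
    rw [abs_mul, abs_of_pos hd]
    nlinarith [abs_nonneg t]
  refine ⟨k + q0 * d + c0 * d ^ 2 / 2 + v X0, p0 + b0 * d + pv, q0 + c0 * d + qv, a0 + av, b0 + bv, c0 + cv, ?_, ?_, ?_, ?_, ?_, ?_⟩
  · refine (abs_add_le _ _).trans ?_
    have := dm p0 b0 hp hb
    linarith
  · refine (abs_add_le _ _).trans ?_
    have := dm q0 c0 hq hc
    linarith
  · refine (abs_add_le _ _).trans ?_
    linarith
  · refine (abs_add_le _ _).trans ?_
    linarith
  · refine (abs_add_le _ _).trans ?_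
    linarith
  intro X hX
  have e : U X - (k + q0 * d + c0 * d ^ 2 / 2 + v X0 + (p0 + b0 * d + pv) * X.1 + (q0 + c0 * d + qv) * (X.2 - d) + ((a0 + av) * X.1 ^ 2 / 2 + (b0 + bv) * X.1 * (X.2 - d) + (c0 + cv) * (X.2 - d) ^ 2 / 2))
     = v X - (v X0 + (pv * (X.1 - X0.1) + qv * (X.2 - X0.2)) + (av * (X.1 - X0.1) ^ 2 / 2 + bv * (X.1 - X0.1) * (X.2 - X0.2) + cv * (X.2 - X0.2) ^ 2 / 2)) := by
    rw [show v X = U X - (k + p0 * X.1 + q0 * X.2 + (a0 * X.1 ^ 2 / 2 + b0 * X.1 * X.2 + c0 * X.2 ^ 2 / 2)) from rfl]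
    generalize v X0 = v0
    simp only [hX0]
    ring
  rw [e]
  set n := ‖X - X0‖ with hn
  have n0 : 0 ≤ n := norm_nonneg _
  set r := n / ρ with hr
  have r0 : 0 ≤ r := by positivity
  have hMr : M * r ^ (2 + β) ≤ 64 * C2 * n ^ (2 + β) := by
    rw [hr, hρ, show n / (d / 2) = (2 * n) / d by field_simp, Real.div_rpow (by positivity) hd.le, Real.mul_rpow (by norm_num) n0, hM]
    have : 8 * C2 * d ^ (2 + β) * (2 ^ (2 + β) * n ^ (2 + β) / d ^ (2 + β)) = 8 * C2 * (2 ^ (2 + β) * n ^ (2 + β)) := by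
      have : d ^ (2 + β) ≠ 0 := by positivity
      field_simp
    rw [this]
    have : (2:ℝ) ^ (2 + β) * n ^ (2 + β) ≤ 8 * n ^ (2 + β) := by gcongr
    nlinarith
  rcases le_or_gt n (ρ / 16) with hnr | hnr
  · have r1 : r ≤ 1 := by rw [hr, div_le_one ρ0]; linarith
    refine (h6 X hnr).trans ?_
    have h7 : r ^ (2 + g) ≤ r ^ (2 + β) := Real.rpow_le_rpow_of_exponent_ge' r0 r1 (by linarith) (by linarith)
    calc CI * M * r ^ (2 + g) ≤ CI * M * r ^ (2 + β) := by gcongr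
      _ = CI * (M * r ^ (2 + β)) := by ring
      _ ≤ CI * (64 * C2 * n ^ (2 + β)) := by gcongr
      _ = (CI * 64 * C2) * n ^ (2 + β) := by ring
      _ ≤ CF * n ^ (2 + β) := by
        gcongr
        have : 0 < 2 * C2 + CI * 32 * C2 + (33 ^ 3 * C2 + (1 + 4 * CI) * 4096 * (64 * C2)) := by positivity
        linarith
  · have r16 : 1 ≤ 16 * r := by
      have : ρ / 16 / ρ < r := by rw [hr]; gcongr
      rw [show ρ / 16 / ρ = 1 / 16 by field_simp] at this
      linarith
    have hnρ : n = r * ρ := by rw [hr]; field_simp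
    have big : ∀ j : ℕ, j ≤ 2 → r ^ j ≤ 4096 * r ^ (2 + β) := by
      intro j hj
      have t1 : r ^ j ≤ (16 * r) ^ j := by gcongr; linarith
      have t2 : (16 * r) ^ j ≤ (16 * r) ^ 2 := pow_le_pow_right₀ r16 hj
      have t3 : (16 * r) ^ (2:ℝ) ≤ (16 * r) ^ (2 + β) := Real.rpow_le_rpow_of_exponent_le r16 (by linarith)
      rw [Real.rpow_two, Real.mul_rpow (by norm_num) r0] at t3
      have t4 := rpow_le_cube (s := 16) (e := 2 + β) (by norm_num) (by linarith)
      have t5 : (16:ℝ) ^ (2 + β) * r ^ (2 + β) ≤ 16 ^ 3 * r ^ (2 + β) := by gcongr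
      norm_num at t5 ⊢
      linarith
    have hvb : |v X| ≤ 33 ^ 3 * C2 * n ^ (2 + β) := by
      have hx : ‖X‖ ≤ 33 * n := by
        have h3 : ‖X0‖ = d := by rw [norm_eq_max]; simp [hX0, abs_of_pos hd, hd.le]
        have h4 : ‖X‖ ≤ ‖X - X0‖ + ‖X0‖ := by simpa using norm_add_le (X - X0) X0
        linarith
      have h3 : ‖X‖ ^ (2 + β) ≤ (33 * n) ^ (2 + β) := Real.rpow_le_rpow (norm_nonneg _) hx (by linarith)
      rw [Real.mul_rpow (by norm_num) n0] at h3
      have t4 := rpow_le_cube (s := 33) (e := 2 + β) (by norm_num) (by linarith)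
      have t5 : (33:ℝ) ^ (2 + β) * n ^ (2 + β) ≤ 33 ^ 3 * n ^ (2 + β) := by gcongr
      refine (hv X hX).trans ?_
      calc C2 * ‖X‖ ^ (2 + β) ≤ C2 * (33 ^ 3 * n ^ (2 + β)) := by gcongr; linarith
        _ = _ := by ring
    have n1 : |X.1 - X0.1| ≤ r * ρ := by rw [← hnρ]; exact abs_fst_le (X - X0)
    have n2 : |X.2 - X0.2| ≤ r * ρ := by rw [← hnρ]; exact abs_snd_le (X - X0)
    have l1 : ∀ s x : ℝ, |s| ≤ CI * M / ρ → |x| ≤ r * ρ → |s * x| ≤ CI * M * r := by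
      intro s x hs hx
      rw [abs_mul]
      calc _ ≤ (CI * M / ρ) * (r * ρ) := mul_le_mul hs hx (abs_nonneg _) (by positivity)
        _ = _ := by field_simp
    have l2 : ∀ s x y : ℝ, |s| ≤ CI * M / ρ ^ 2 → |x| ≤ r * ρ → |y| ≤ r * ρ → |s * x * y| ≤ CI * M * r ^ 2 := by
      intro s x y hs hx hy
      rw [abs_mul, abs_mul]
      calc _ ≤ (CI * M / ρ ^ 2) * (r * ρ) * (r * ρ) := mul_le_mul (mul_le_mul hs hx (abs_nonneg _) (by positivity)) hy (abs_nonneg _) (by positivity)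
        _ = _ := by field_simp
    have m1 := l1 _ _ h1 n1
    have m2 := l1 _ _ h2 n2
    have m3 := l2 _ _ _ h3 n1 n1
    have m4 := l2 _ _ _ h4 n1 n2
    have m5 := l2 _ _ _ h5 n2 n2
    have B0 := big 0 (by norm_num)
    have B1 := big 1 (by norm_num)
    have B2 := big 2 (by norm_num)
    rw [pow_zero] at B0
    rw [pow_one] at B1
    have hT : |v X0 + (pv * (X.1 - X0.1) + qv * (X.2 - X0.2)) + (av * (X.1 - X0.1) ^ 2 / 2 + bv * (X.1 - X0.1) * (X.2 - X0.2) + cv * (X.2 - X0.2) ^ 2 / 2)|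
        ≤ M * 1 + 2 * (CI * M) * r + 2 * (CI * M) * r ^ 2 := by
      rw [abs_le] at *
      constructor <;> linarith [m1.1, m1.2, m2.1, m2.2, m3.1, m3.2, m4.1, m4.2, m5.1, m5.2, hM0.1, hM0.2]
    have hT2 : M * 1 + 2 * (CI * M) * r + 2 * (CI * M) * r ^ 2 ≤ (1 + 4 * CI) * 4096 * (64 * C2) * n ^ (2 + β) := by
      calc M * 1 + 2 * (CI * M) * r + 2 * (CI * M) * r ^ 2 ≤ M * (4096 * r ^ (2 + β)) + 2 * (CI * M) * (4096 * r ^ (2 + β)) + 2 * (CI * M) * (4096 * r ^ (2 + β)) := by gcongr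
        _ = (1 + 4 * CI) * 4096 * (M * r ^ (2 + β)) := by ring
        _ ≤ (1 + 4 * CI) * 4096 * (64 * C2 * n ^ (2 + β)) := by gcongr
        _ = _ := by ring
    refine (abs_sub _ _).trans ?_
    have hfin : (33 ^ 3 * C2 + (1 + 4 * CI) * 4096 * (64 * C2)) * n ^ (2 + β) ≤ CF * n ^ (2 + β) := by
      gcongr
      have : 0 < 2 * C2 + CI * 32 * C2 + CI * 64 * C2 := by positivity
      linarith
    linarith

end PW

namespace PW
open Filter MeasureTheory
open scoped Topology

theorem main_sol (K : ℝ) (hK : 1 ≤ K) : ∃ β : ℝ, 0 < β ∧ β ≤ 1 / 2 ∧ ∃ C > 0, ∀ 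
    {Z : ℝ → ℝ → ℝ → Prop} {U p q a b c : ℝ × ℝ → ℝ} {γ γ1 γ2 : ℝ → ℝ},
    Sol K β Z U p q a b c γ γ1 γ2 → ∀ X0 ∈ Omc, ∃ k p0 q0 a0 b0 c0 : ℝ, |p0| ≤ C ∧ |q0| ≤ C ∧ |a0| ≤ C ∧ |b0| ≤ C ∧ |c0| ≤ C ∧
      ∀ X ∈ Omc, |U X - (k + p0 * (X.1 - X0.1) + q0 * (X.2 - X0.2) + (a0 * (X.1 - X0.1) ^ 2 / 2 + b0 * (X.1 - X0.1) * (X.2 - X0.2) + c0 * (X.2 - X0.2) ^ 2 / 2))| ≤ C * ‖X - X0‖ ^ (2 + β) := by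
  obtain ⟨β, hβ, hβ1, C, hC, H⟩ := step6 K hK
  refine ⟨β, hβ, hβ1, 8 * C, by positivity, ?_⟩
  intro Z U p q a b c γ γ1 γ2 S X0 hX0
  obtain ⟨t, r, r0, r1, rfl⟩ := exists_polar hX0
  obtain ⟨a', b', c', S'⟩ := S.rot t
  obtain ⟨k, p1, q1, a1, b1, c1, hp, hq, ha, hb, hc, hv⟩ := H S' (1 - r) (by linarith) (by linarith)
  have hcs := Real.cos_sq_add_sin_sq t
  have cc := Real.abs_cos_le_one t
  have ss := Real.abs_sin_le_one t
  have e1 : ∀ X, (rot (-t) X).1 = Real.cos t * (X.1 - r * Real.sin t) + Real.sin t * (X.2 - (1 - r * Real.cos t)) := by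
    intro X; simp only [rot, aff, Real.sin_neg, Real.cos_neg]; ring
  have e2 : ∀ X, (rot (-t) X).2 - (1 - r) = -Real.sin t * (X.1 - r * Real.sin t) + Real.cos t * (X.2 - (1 - r * Real.cos t)) := by
    intro X; simp only [rot, aff, Real.sin_neg, Real.cos_neg]; linear_combination - r * hcs
  have hv' : ∀ X ∈ Omc, _ := fun X hX => hv (rot (-t) X) ((rot_Omc _ _).2 hX)
  simp only [rot_rot] at hv'
  have nrm : ∀ X : ℝ × ℝ, ‖rot (-t) X - (0, 1 - r)‖ = max |(rot (-t) X).1| |(rot (-t) X).2 - (1 - r)| := by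
    intro X; rw [norm_eq_max]; simp
  simp only [nrm, e1, e2] at hv'
  clear hv e1 e2 nrm S' H
  generalize Real.cos t = co at *
  generalize Real.sin t = si at *
  have trig : ∀ a A B : ℝ, |a| ≤ 1 → |A| ≤ B → |a * A| ≤ B := by
    intro a A B ha hA
    rw [abs_mul]
    nlinarith [abs_nonneg A, abs_nonneg a]
  have tri2 : ∀ x y B : ℝ, |x| ≤ B → |y| ≤ B → |x + y| ≤ 2 * B := fun x y B hx hy => (abs_add_le _ _).trans (by linarith)
  have nsi : |-si| ≤ 1 := by rwa [abs_neg]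
  have cc2 : |co ^ 2| ≤ 1 := by rw [abs_pow]; exact pow_le_one₀ (abs_nonneg _) cc
  have ss2 : |si ^ 2| ≤ 1 := by rw [abs_pow]; exact pow_le_one₀ (abs_nonneg _) ss
  have cs2 : |co * si| ≤ 1 := trig _ _ _ cc ss
  have t1 := trig _ _ _ cc hp
  have t2 := trig _ _ _ nsi hq
  have t3 := trig _ _ _ ss hp
  have t4 := trig _ _ _ cc hq
  have u1 := trig _ _ _ cc2 ha
  have u2 := trig _ _ _ ss2 ha
  have u3 := trig _ _ _ cs2 ha
  have u4 := trig _ _ _ cc2 hb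
  have u5 := trig _ _ _ ss2 hb
  have u6 := trig _ _ _ cs2 hb
  have u7 := trig _ _ _ cc2 hc
  have u8 := trig _ _ _ ss2 hc
  have u9 := trig _ _ _ cs2 hc
  refine ⟨k, co * p1 + -si * q1, si * p1 + co * q1, co ^ 2 * a1 - 2 * (co * si * b1) + si ^ 2 * c1,
    co * si * a1 + (co ^ 2 * b1 - si ^ 2 * b1) - co * si * c1, si ^ 2 * a1 + 2 * (co * si * b1) + co ^ 2 * c1, ?_, ?_, ?_, ?_, ?_, ?_⟩
  · exact (tri2 _ _ _ t1 t2).trans (by linarith)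
  · exact (tri2 _ _ _ t3 t4).trans (by linarith)
  · rw [abs_le] at *; constructor <;> linarith [u1.1, u1.2, u6.1, u6.2, u8.1, u8.2]
  · rw [abs_le] at *; constructor <;> linarith [u3.1, u3.2, u4.1, u4.2, u5.1, u5.2, u9.1, u9.2]
  · rw [abs_le] at *; constructor <;> linarith [u2.1, u2.2, u6.1, u6.2, u7.1, u7.2]
  · intro X hX
    have h := hv' X hX
    set n := ‖X - (r * si, 1 - r * co)‖ with hn
    have n1 : |X.1 - r * si| ≤ n := abs_fst_le (X - (r * si, 1 - r * co))
    have n2 : |X.2 - (1 - r * co)| ≤ n := abs_snd_le (X - (r * si, 1 - r * co))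
    have hm := max_le (tri2 _ _ _ (trig _ _ _ cc n1) (trig _ _ _ ss n2)) (tri2 _ _ _ (trig _ _ _ nsi n1) (trig _ _ _ cc n2))
    have n0 : 0 ≤ n := norm_nonneg _
    have h3 := Real.rpow_le_rpow (le_max_of_le_left (abs_nonneg _)) hm (by linarith : 0 ≤ 2 + β)
    rw [Real.mul_rpow (by norm_num) n0] at h3
    have t4 := rpow_le_cube (s := 2) (e := 2 + β) (by norm_num) (by linarith)
    have t5 : (2:ℝ) ^ (2 + β) * n ^ (2 + β) ≤ 2 ^ 3 * n ^ (2 + β) := by gcongr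
    have h4 := h.trans (mul_le_mul_of_nonneg_left (h3.trans t5) hC.le)
    refine le_trans (le_of_eq ?_) (h4.trans (le_of_eq (by ring)))
    congr 1
    simp only []
    ring

end PW

namespace PW
open Filter MeasureTheory
open scoped Topology

def Mx (a b c : ℝ) : Mat2 := !![a, b; b, c]

lemma Mx_herm (a b c : ℝ) : (Mx a b c).IsHermitian := by
  ext i j
  fin_cases i <;> fin_cases j <;> simp [Mx]

lemma Mx_sub (a b c a' b' c' : ℝ) : Mx a b c - Mx a' b' c' = Mx (a - a') (b - b') (c - c') := by
  ext i j
  fin_cases i <;> fin_cases j <;> simp [Mx]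

lemma Mx_eig (a b c : ℝ) : ∃ e0 e1 : ℝ, e0 + e1 = a + c ∧ e0 * e1 = a * c - b ^ 2 ∧
    posNorm (Mx a b c) = max e0 0 + max e1 0 ∧ negNorm (Mx a b c) = max (-e0) 0 + max (-e1) 0 := by
  have h := Mx_herm a b c
  refine ⟨h.eigenvalues 0, h.eigenvalues 1, ?_, ?_, ?_, ?_⟩
  · have := h.trace_eq_sum_eigenvalues
    simp [Fin.sum_univ_two, Matrix.trace, Mx] at this
    exact this.symm
  · have := h.det_eq_prod_eigenvalues
    simp [Fin.prod_univ_two, Mx, Matrix.det_fin_two] at this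
    have h2 : h.eigenvalues 0 * h.eigenvalues 1 = a * c - b * b := this.symm
    rw [h2]; ring
  · unfold posNorm; rw [dif_pos h, Fin.sum_univ_two]
  · unfold negNorm; rw [dif_pos h, Fin.sum_univ_two]

lemma Mx_neg (a b c : ℝ) : posNorm (Mx (-a) (-b) (-c)) = negNorm (Mx a b c) ∧ negNorm (Mx (-a) (-b) (-c)) = posNorm (Mx a b c) := by
  obtain ⟨e0, e1, h1, h2, h3, h4⟩ := Mx_eig a b c
  obtain ⟨f0, f1, g1, g2, g3, g4⟩ := Mx_eig (-a) (-b) (-c)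
  rw [h3, h4, g3, g4]
  have : (f0 + e0) * (f0 + e1) = 0 := by linear_combination f0 * h1 + h2 + f0 * g1 - g2
  rcases mul_eq_zero.1 this with h | h
  · have e : f0 = -e0 := by linarith
    have e' : f1 = -e1 := by linarith
    subst e e'; simp
  · have e : f0 = -e1 := by linarith
    have e' : f1 = -e0 := by linarith
    subst e e'; simp [add_comm]

lemma SK_of_eig {lam Lam e0 e1 : ℝ} (hlam : 0 < lam) (hLam : lam ≤ Lam) 
    (h1 : lam * (max (-e0) 0 + max (-e1) 0) ≤ Lam * (max e0 0 + max e1 0))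
    (h2 : lam * (max e0 0 + max e1 0) ≤ Lam * (max (-e0) 0 + max (-e1) 0)) :
    lam * (e0 ^ 2 + e1 ^ 2) ≤ 2 * Lam * (-(e0 * e1)) := by
  rcases le_total e0 0 with h0 | h0 <;> rcases le_total e1 0 with h3 | h3
  · rw [max_eq_right h0, max_eq_right h3, max_eq_left (by linarith), max_eq_left (by linarith)] at h1
    have : e0 = 0 := by nlinarith
    have : e1 = 0 := by nlinarith
    subst e0 e1; simp
  · rw [max_eq_right h0, max_eq_left h3, max_eq_left (by linarith), max_eq_right (by linarith)] at h1 h2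
    nlinarith
  · rw [max_eq_left h0, max_eq_right h3, max_eq_right (by linarith), max_eq_left (by linarith)] at h1 h2
    nlinarith
  · rw [max_eq_left h0, max_eq_left h3, max_eq_right (by linarith), max_eq_right (by linarith)] at h2
    have : e0 = 0 := by nlinarith
    have : e1 = 0 := by nlinarith
    subst e0 e1; simp

lemma Mx_rank1 {t n1 n2 : ℝ} (ht : 0 ≤ t) (hn : n1 ^ 2 + n2 ^ 2 = 1) : posNorm (Mx (-(t * n1 ^ 2)) (-(t * (n1 * n2))) (-(t * n2 ^ 2))) = 0 ∧
    negNorm (Mx (-(t * n1 ^ 2)) (-(t * (n1 * n2))) (-(t * n2 ^ 2))) = t := by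
  obtain ⟨e0, e1, h1, h2, h3, h4⟩ := Mx_eig (-(t * n1 ^ 2)) (-(t * (n1 * n2))) (-(t * n2 ^ 2))
  have h1 : e0 + e1 = -t := by rw [h1]; linear_combination -t * hn
  have h2 : e0 * e1 = 0 := by rw [h2]; ring
  rw [h3, h4]
  rcases mul_eq_zero.1 h2 with h | h
  · subst h
    have : e1 = -t := by linarith
    subst this
    simp [ht]
  · subst h
    have : e0 = -t := by linarith
    subst this
    simp [ht]

lemma ellZ_of {lam Lam : ℝ} (hlam : 0 < lam) (hLam : lam ≤ Lam) {F : Mat2 → ℝ}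
    (hF : ContDiff ℝ 1 (fun A : Fin 2 → Fin 2 → ℝ => F (Matrix.of A))) (hE : UniformlyElliptic lam Lam F) (hF0 : F 0 = 0) :
    EllZ (2 * Lam / lam) (fun a b c => F (Mx a b c) = 0) := by
  refine ⟨?_, ?_, ?_⟩
  · intro a b c a' b' c' h h'
    have h1 := hE (Mx a b c) (Mx a' b' c') (Mx_herm _ _ _) (Mx_herm _ _ _)
    have h2 := hE (Mx a' b' c') (Mx a b c) (Mx_herm _ _ _) (Mx_herm _ _ _)
    rw [h, h', Mx_sub] at h1 h2
    rw [← neg_sub a, ← neg_sub b, ← neg_sub c, (Mx_neg _ _ _).1, (Mx_neg _ _ _).2] at h2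
    obtain ⟨e0, e1, g1, g2, g3, g4⟩ := Mx_eig (a - a') (b - b') (c - c')
    rw [g3, g4] at h1 h2
    have := SK_of_eig (e0 := e0) (e1 := e1) hlam hLam (by linarith) (by linarith)
    unfold SK
    rw [div_mul_eq_mul_div, le_div_iff₀ hlam]
    have e : e0 ^ 2 + e1 ^ 2 = (a - a') ^ 2 + 2 * (b - b') ^ 2 + (c - c') ^ 2 := by
      have : e0 ^ 2 + e1 ^ 2 = (e0 + e1) ^ 2 - 2 * (e0 * e1) := by ring
      rw [this, g1, g2]; ring
    rw [e, g2] at this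
    linarith
  · have : Mx 0 0 0 = 0 := by ext i j; fin_cases i <;> fin_cases j <;> simp [Mx]
    simp only [this]; exact hF0
  · intro a b c n1 n2 hn
    have key : ∀ a b c t : ℝ, 0 ≤ t → F (Mx (a - t * n1 ^ 2) (b - t * (n1 * n2)) (c - t * n2 ^ 2)) ≤ F (Mx a b c) - lam * t := by
      intro a b c t ht
      have h1 := hE (Mx (a - t * n1 ^ 2) (b - t * (n1 * n2)) (c - t * n2 ^ 2)) (Mx a b c) (Mx_herm _ _ _) (Mx_herm _ _ _)
      rw [Mx_sub, sub_sub_cancel_left, sub_sub_cancel_left, sub_sub_cancel_left, (Mx_rank1 ht hn).1, (Mx_rank1 ht hn).2] at h1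
      linarith
    set f : ℝ → ℝ := fun t => F (Mx (a + t * n1 ^ 2) (b + t * (n1 * n2)) (c + t * n2 ^ 2)) with hf
    have cf : Continuous f := by
      have h1 := hF.continuous
      have h2 : Continuous (fun t : ℝ => (![![a + t * n1 ^ 2, b + t * (n1 * n2)], ![b + t * (n1 * n2), c + t * n2 ^ 2]] : Fin 2 → Fin 2 → ℝ)) := by
        refine continuous_pi fun i => continuous_pi fun j => ?_
        fin_cases i <;> fin_cases j <;> simp <;> fun_prop
      exact h1.comp h2
    set T := |F (Mx a b c)| / lam with hT
    have T0 : 0 ≤ T := by positivity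
    have hlT : lam * T = |F (Mx a b c)| := by rw [hT]; field_simp
    have l1 : f (-T) ≤ 0 := by
      have := key a b c T T0
      rw [hlT] at this
      have h2 := le_abs_self (F (Mx a b c))
      simp only [hf, neg_mul, ← sub_eq_add_neg]; linarith
    have l2 : 0 ≤ f T := by
      have := key (a + T * n1 ^ 2) (b + T * (n1 * n2)) (c + T * n2 ^ 2) T T0
      simp only [add_sub_cancel_right] at this
      rw [hlT] at this
      have h2 := neg_abs_le (F (Mx a b c))
      simp only [hf]; linarith
    obtain ⟨t, -, ht⟩ := intermediate_value_Icc (by linarith : -T ≤ T) cf.continuousOn ⟨l1, l2⟩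
    exact ⟨t, ht⟩

end PW

namespace PW
open Filter MeasureTheory
open scoped Topology

lemma circPt_per (t : ℝ) : circPt (t + 2 * π) = circPt t := by
  simp [circPt]

lemma bddAbove_per {f : ℝ → ℝ} (hp : Function.Periodic f (2 * π)) (hf : Continuous f) :
    BddAbove (Set.range fun t => |f t|) := by
  have := hp.isBounded_of_continuous (by positivity) hf
  obtain ⟨C, hC⟩ := this.exists_norm_le
  refine ⟨C, ?_⟩
  rintro _ ⟨t, rfl⟩
  exact hC _ ⟨t, rfl⟩

lemma deriv_per {f : ℝ → ℝ} {c : ℝ} (hp : Function.Periodic f c) : Function.Periodic (deriv f) c := by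
  intro t
  have : (fun x => f (x + c)) = f := funext hp
  rw [← deriv_comp_add_const, this]

lemma bdData_of {α : ℝ} {g : E2 → ℝ} (hα : 0 < α) (hg : MemHolderCircle α g) (hn : holderNormCircle α g ≤ 1) :
    BdData α (onCircle g) (deriv (onCircle g)) (deriv (deriv (onCircle g))) := by
  obtain ⟨hc, H, hH⟩ := hg
  set f := onCircle g with hf
  have p0 : Function.Periodic f (2 * π) := fun t => by simp only [hf, onCircle, circPt_per]
  have p1 := deriv_per p0
  have p2 := deriv_per p1
  have c1 : ContDiff ℝ 1 (deriv f) := ContDiff.deriv' (by norm_num; exact hc)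
  have c2 : Continuous (deriv (deriv f)) := c1.continuous_deriv le_rfl
  have b0 := bddAbove_per p0 hc.continuous
  have b1 := bddAbove_per p1 c1.continuous
  have b2 := bddAbove_per p2 c2
  have b3 : BddAbove (Set.range fun p : ℝ × ℝ => if p.1 ≠ p.2 then
        |deriv (deriv f) p.1 - deriv (deriv f) p.2| / |p.1 - p.2| ^ α else 0) := by
    refine ⟨max H 0, ?_⟩
    rintro _ ⟨p, rfl⟩
    by_cases h : p.1 ≠ p.2
    · simp only [if_pos h]
      refine le_trans ?_ (le_max_left _ _)
      have : 0 < |p.1 - p.2| := abs_pos.2 (sub_ne_zero.2 h)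
      rw [div_le_iff₀ (by positivity)]
      exact hH _ _
    · simp only [if_neg h]; exact le_max_right _ _
  have n0 : 0 ≤ ⨆ t : ℝ, |f t| := Real.iSup_nonneg fun t => abs_nonneg _
  have n1 : 0 ≤ ⨆ t : ℝ, |deriv f t| := Real.iSup_nonneg fun t => abs_nonneg _
  have n2 : 0 ≤ ⨆ t : ℝ, |deriv (deriv f) t| := Real.iSup_nonneg fun t => abs_nonneg _
  have n3 : 0 ≤ ⨆ p : ℝ × ℝ, if p.1 ≠ p.2 then
        |deriv (deriv f) p.1 - deriv (deriv f) p.2| / |p.1 - p.2| ^ α else 0 := by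
    refine Real.iSup_nonneg fun p => ?_
    split_ifs <;> positivity
  unfold holderNormCircle at hn
  rw [← hf] at hn
  refine ⟨?_, ?_, ?_, ?_, ?_, ?_⟩
  · intro t
    exact (hc.differentiable (by norm_num) t).hasDerivAt
  · intro t
    exact (c1.differentiable (by norm_num) t).hasDerivAt
  · intro t
    have := le_ciSup b0 t
    linarith
  · intro t
    have := le_ciSup b1 t
    linarith
  · intro t
    have := le_ciSup b2 t
    linarith
  · intro s t
    by_cases h : s = t
    · subst h; simp [hα.ne']
    · have := le_ciSup b3 (s, t)
      simp only [ne_eq, h, not_false_eq_true, if_true] at this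
      have h0 : 0 < |s - t| := abs_pos.2 (sub_ne_zero.2 h)
      have h2 : |deriv (deriv f) s - deriv (deriv f) t| / |s - t| ^ α ≤ 1 := le_trans this (by simp only [ne_eq] at hn n3; linarith)
      rwa [div_le_one (by positivity)] at h2

end PW

namespace PW
open Filter MeasureTheory
open scoped Topology

def Lm : ℝ × ℝ →L[ℝ] E2 :=
  (ContinuousLinearMap.fst ℝ ℝ ℝ).smulRight (EuclideanSpace.single (0 : Fin 2) (1 : ℝ)) +
    (ContinuousLinearMap.snd ℝ ℝ ℝ).smulRight (EuclideanSpace.single (1 : Fin 2) (1 : ℝ))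

def iot (X : ℝ × ℝ) : E2 := Lm X - EuclideanSpace.single (1 : Fin 2) (1 : ℝ)

lemma Lm1 : Lm (1, 0) = EuclideanSpace.single (0 : Fin 2) (1 : ℝ) := by simp [Lm]
lemma Lm2 : Lm (0, 1) = EuclideanSpace.single (1 : Fin 2) (1 : ℝ) := by simp [Lm]

lemma iot0 (X : ℝ × ℝ) : iot X 0 = X.1 := by simp [iot, Lm]
lemma iot1 (X : ℝ × ℝ) : iot X 1 = X.2 - 1 := by simp [iot, Lm]

lemma iot_surj (x : E2) : iot (x 0, x 1 + 1) = x := by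
  ext i; fin_cases i
  · exact iot0 _
  · refine (iot1 _).trans ?_; simp

lemma iot_deriv (X : ℝ × ℝ) : HasFDerivAt iot Lm X := Lm.hasFDerivAt.sub_const _

lemma iot_contDiff : ContDiff ℝ 2 iot := Lm.contDiff.sub contDiff_const

lemma iot_norm (X : ℝ × ℝ) : ‖iot X‖ ^ 2 = X.1 ^ 2 + (X.2 - 1) ^ 2 := by
  rw [EuclideanSpace.norm_sq_eq, Fin.sum_univ_two, iot0, iot1]; simp

lemma iot_ball (X : ℝ × ℝ) : iot X ∈ ball (0 : E2) 1 ↔ X ∈ Om := by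
  rw [mem_ball_zero_iff, ← sq_lt_one_iff₀ (norm_nonneg _), iot_norm]
  simp only [Om, mem_setOf_eq]
  constructor <;> intro h <;> nlinarith

lemma iot_cball (X : ℝ × ℝ) : iot X ∈ closedBall (0 : E2) 1 ↔ X ∈ Omc := by
  rw [mem_closedBall_zero_iff, ← sq_le_one_iff₀ (norm_nonneg _), iot_norm]
  simp only [Omc, mem_setOf_eq]
  constructor <;> intro h <;> nlinarith

lemma iot_bc (t : ℝ) : iot (bc t) = circPt (t + -(π / 2)) := by
  ext i; fin_cases i
  · refine (iot0 _).trans ?_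
    simp [bc, circPt, ← sub_eq_add_neg, Real.cos_sub_pi_div_two]
  · refine (iot1 _).trans ?_
    simp [bc, circPt, ← sub_eq_add_neg, Real.sin_sub_pi_div_two]

lemma Omc_convex : Convex ℝ Omc := by
  have h : Omc = Lm.toLinearMap ⁻¹' closedBall (EuclideanSpace.single (1 : Fin 2) (1 : ℝ)) 1 := by
    ext X
    rw [← iot_cball, mem_closedBall_zero_iff, mem_preimage, mem_closedBall, dist_eq_norm]
    rfl
  rw [h]
  exact (convex_closedBall _ _).linear_preimage _

lemma Omc_unique : UniqueDiffOn ℝ Omc := by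
  refine uniqueDiffOn_convex Omc_convex ⟨(0, 1), ?_⟩
  exact interior_maximal Om_sub Om_open (by simp [Om])

lemma chainF {G : E2 → ℝ} {W : ℝ × ℝ → ℝ} {X : ℝ × ℝ} (h : W =ᶠ[𝓝 X] fun Y => G (iot Y))
    (hd : DifferentiableAt ℝ G (iot X)) (v : ℝ × ℝ) : fderiv ℝ W X v = fderiv ℝ G (iot X) (Lm v) := by
  have h1 : HasFDerivAt (fun Y => G (iot Y)) ((fderiv ℝ G (iot X)).comp Lm) X := hd.hasFDerivAt.comp X (iot_deriv X)
  rw [h.fderiv_eq, h1.fderiv]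
  rfl

lemma JetOn.congr {V : Set (ℝ × ℝ)} (hV : IsOpen V) {w p q a b c p' q' : ℝ × ℝ → ℝ} (h : JetOn V w p q a b c)
    (hp : ∀ X ∈ V, p' X = p X) (hq : ∀ X ∈ V, q' X = q X) : JetOn V w p' q' a b c := by
  refine ⟨fun X hX => ?_, fun X hX => ?_, fun X hX => ?_, h.ca, h.cb, h.cc⟩
  · rw [hp X hX, hq X hX]; exact h.w X hX
  · exact (h.p X hX).congr_of_eventuallyEq (Filter.eventually_of_mem (hV.mem_nhds hX) hp)
  · exact (h.q X hX).congr_of_eventuallyEq (Filter.eventually_of_mem (hV.mem_nhds hX) hq)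

lemma hess_eq {u : E2 → ℝ} (hu : ContDiffOn ℝ 2 u (ball (0 : E2) 1)) {X : ℝ × ℝ} (hX : X ∈ Om) :
    hess u (iot X) = Mx (P1 (P1 fun Y => u (iot Y)) X) (P2 (P1 fun Y => u (iot Y)) X) (P2 (P2 fun Y => u (iot Y)) X) := by
  have hU : ContDiffOn ℝ 2 (fun Y => u (iot Y)) Om :=
    hu.comp iot_contDiff.contDiffOn fun Y hY => (iot_ball Y).2 hY
  have J := JetOn.of_contDiffOn Om_open hU
  have du : ∀ Y ∈ Om, DifferentiableAt ℝ u (iot Y) := fun Y hY =>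
    (hu.contDiffAt (isOpen_ball.mem_nhds ((iot_ball Y).2 hY))).differentiableAt (by norm_num)
  have h1 : ∀ Y ∈ Om, P1 (fun Y => u (iot Y)) Y = fderiv ℝ u (iot Y) (EuclideanSpace.single 0 1) := fun Y hY => by
    rw [P1, chainF (Filter.EventuallyEq.rfl) (du Y hY), Lm1]
  have h2 : ∀ Y ∈ Om, P2 (fun Y => u (iot Y)) Y = fderiv ℝ u (iot Y) (EuclideanSpace.single 1 1) := fun Y hY => by
    rw [P2, chainF (Filter.EventuallyEq.rfl) (du Y hY), Lm2]
  have dd : ∀ e : E2, DifferentiableAt ℝ (fun y => fderiv ℝ u y e) (iot X) := by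
    intro e
    have := (hu.contDiffAt (isOpen_ball.mem_nhds ((iot_ball X).2 hX))).fderiv_right (m := 1) (by norm_num)
    exact (this.differentiableAt (by norm_num)).clm_apply (differentiableAt_const e)
  have e1 : P1 (fun Y => u (iot Y)) =ᶠ[𝓝 X] fun Y => (fun y => fderiv ℝ u y (EuclideanSpace.single 0 1)) (iot Y) :=
    Filter.eventually_of_mem (Om_open.mem_nhds hX) h1
  have e2 : P2 (fun Y => u (iot Y)) =ᶠ[𝓝 X] fun Y => (fun y => fderiv ℝ u y (EuclideanSpace.single 1 1)) (iot Y) :=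
    Filter.eventually_of_mem (Om_open.mem_nhds hX) h2
  have sy : P1 (P2 fun Y => u (iot Y)) X = P2 (P1 fun Y => u (iot Y)) X := by
    rw [P1, (J.q X hX).fderiv]; simp
  have k11 : P1 (P1 fun Y => u (iot Y)) X = _ := chainF e1 (dd _) (1, 0)
  have k21 : P2 (P1 fun Y => u (iot Y)) X = _ := chainF e1 (dd _) (0, 1)
  have k12 : P1 (P2 fun Y => u (iot Y)) X = _ := chainF e2 (dd _) (1, 0)
  have k22 : P2 (P2 fun Y => u (iot Y)) X = _ := chainF e2 (dd _) (0, 1)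
  rw [Lm1] at k11 k12
  rw [Lm2] at k21 k22
  ext i j
  fin_cases i <;> fin_cases j
  · exact k11.symm
  · exact k12.symm.trans sy
  · exact k21.symm
  · exact k22.symm

lemma sol_of {lam Lam α : ℝ} (hlam : 0 < lam) (hLam : lam ≤ Lam) (hα : 0 < α) {F : Mat2 → ℝ} {u g : E2 → ℝ}
    (hF : ContDiff ℝ 1 (fun A : Fin 2 → Fin 2 → ℝ => F (Matrix.of A))) (hE : UniformlyElliptic lam Lam F) (hF0 : F 0 = 0)
    (hu : ContDiffOn ℝ 2 u (closedBall (0 : E2) 1)) (he : ∀ x ∈ ball (0 : E2) 1, F (hess u x) = 0)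
    (hg : ∀ x ∈ sphere (0 : E2) 1, u x = g x) (hm : MemHolderCircle α g) (hn : holderNormCircle α g ≤ 1) :
    ∃ p q a b c γ γ1 γ2, Sol (2 * Lam / lam) α (fun a b c => F (Mx a b c) = 0) (fun Y => u (iot Y)) p q a b c γ γ1 γ2 := by
  have hU : ContDiffOn ℝ 2 (fun Y => u (iot Y)) Omc :=
    hu.comp iot_contDiff.contDiffOn fun Y hY => (iot_cball Y).2 hY
  have cD := hU.continuousOn_fderivWithin Omc_unique (by norm_num)
  have hpo : ∀ X ∈ Om, fderivWithin ℝ (fun Y => u (iot Y)) Omc X = fderiv ℝ (fun Y => u (iot Y)) X := fun X hX =>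
    fderivWithin_of_mem_nhds (Filter.mem_of_superset (Om_open.mem_nhds hX) Om_sub)
  refine ⟨fun X => fderivWithin ℝ (fun Y => u (iot Y)) Omc X (1, 0), fun X => fderivWithin ℝ (fun Y => u (iot Y)) Omc X (0, 1),
    P1 (P1 fun Y => u (iot Y)), P2 (P1 fun Y => u (iot Y)), P2 (P2 fun Y => u (iot Y)), _, _, _,
    ellZ_of hlam hLam hF hE hF0, (bdData_of hα hm hn).shift (-(π / 2)), ?_, ?_, ?_, ?_, ?_, ?_⟩
  · refine (JetOn.of_contDiffOn Om_open (hU.mono Om_sub)).congr Om_open ?_ ?_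
    · intro X hX; simp only [hpo X hX]; rfl
    · intro X hX; simp only [hpo X hX]; rfl
  · intro X hX
    have := (hU.differentiableOn (by norm_num) X hX).hasFDerivWithinAt
    rwa [LL_ext (f := fderivWithin ℝ (fun Y => u (iot Y)) Omc X) rfl rfl] at this
  · exact cD.clm_apply continuousOn_const
  · exact cD.clm_apply continuousOn_const
  · intro X hX
    have := he _ ((iot_ball X).2 hX)
    rwa [hess_eq (hu.mono ball_subset_closedBall) hX] at this
  · intro t
    rw [iot_bc]
    refine hg _ ?_
    rw [mem_sphere_zero_iff_norm, ← sq_eq_sq₀ (norm_nonneg _) zero_le_one, EuclideanSpace.norm_sq_eq, Fin.sum_univ_two]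
    simp [circPt]

end PW

/-- Pointwise `C^{2,ᾱ}` expansion at every point of `B̄₁`: there are universal constants
`ᾱ ∈ (0,1)` and `C > 0` depending only on `lam, Lam` such that for any `C¹` uniformly
elliptic `F` with `F(0) = 0` and any classical solution `u ∈ C²(B̄₁)` of `F(D²u) = 0` in
`B₁` with `u = g` on `∂B₁` and `‖g‖_{C^{2,ᾱ}(∂B₁)} ≤ 1`, for every `x₀ ∈ B̄₁` there is a
quadratic polynomial `P_{x₀}` with `|u(x) − P_{x₀}(x)| ≤ C|x−x₀|^{2+ᾱ}` on `B̄₁` and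
`|DP_{x₀}(x₀)| + |D²P_{x₀}| ≤ C`. -/
theorem pointwise_C2alpha_expansion (lam Lam : ℝ) (hlam : 0 < lam) (hLam : lam ≤ Lam) :
    ∃ α C : ℝ, α ∈ Set.Ioo (0 : ℝ) 1 ∧ 0 < C ∧
      ∀ (F : Mat2 → ℝ) (u g : E2 → ℝ),
        ContDiff ℝ 1 (fun A : Fin 2 → Fin 2 → ℝ => F (Matrix.of A)) →
        UniformlyElliptic lam Lam F → F 0 = 0 →
        ContDiffOn ℝ 2 u (closedBall (0 : E2) 1) →
        (∀ x ∈ ball (0 : E2) 1, F (hess u x) = 0) →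
        (∀ x ∈ sphere (0 : E2) 1, u x = g x) →
        MemHolderCircle α g →
        holderNormCircle α g ≤ 1 →
        ∀ x₀ ∈ closedBall (0 : E2) 1,
          ∃ P : QuadPoly,
            (∀ x ∈ closedBall (0 : E2) 1, |u x - P.eval x| ≤ C * ‖x - x₀‖ ^ (2 + α)) ∧
            vecNorm (P.grad x₀) + matNorm P.Q ≤ C := by
  have hK : 1 ≤ 2 * Lam / lam := by rw [one_le_div hlam]; linarith
  obtain ⟨β, hβ, hβ2, C, hC, H⟩ := PW.main_sol _ hK
  refine ⟨β, 6 * C, ⟨hβ, by linarith⟩, by positivity, ?_⟩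
  intro F u g hF hE hF0 hu he hg hm hn x₀ hx₀
  obtain ⟨p, q, a, b, c, γ, γ1, γ2, S⟩ := PW.sol_of hlam hLam hβ hF hE hF0 hu he hg hm hn
  have mem : ∀ x ∈ closedBall (0 : E2) 1, ((x 0, x 1 + 1) : ℝ × ℝ) ∈ PW.Omc := fun x hx => by
    rw [← PW.iot_cball, PW.iot_surj]; exact hx
  obtain ⟨k, p0, q0, a0, b0, c0, hp, hq, ha, hb, hc, hX⟩ := H S _ (mem x₀ hx₀)
  refine ⟨⟨k - p0 * x₀ 0 - q0 * x₀ 1 + (a0 * x₀ 0 ^ 2 + 2 * b0 * x₀ 0 * x₀ 1 + c0 * x₀ 1 ^ 2) / 2,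
    ![p0 - a0 * x₀ 0 - b0 * x₀ 1, q0 - b0 * x₀ 0 - c0 * x₀ 1], PW.Mx a0 b0 c0, PW.Mx_herm _ _ _⟩, ?_, ?_⟩
  · intro x hx
    have h := hX _ (mem x hx)
    simp only [PW.iot_surj] at h
    have hnorm : ‖((x 0, x 1 + 1) : ℝ × ℝ) - (x₀ 0, x₀ 1 + 1)‖ ≤ ‖x - x₀‖ := by
      rw [Prod.norm_def]
      refine max_le ?_ ?_
      · simpa using PiLp.norm_apply_le (x - x₀) 0
      · simpa using PiLp.norm_apply_le (x - x₀) 1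
    have e : ∀ P : QuadPoly, P = ⟨k - p0 * x₀ 0 - q0 * x₀ 1 + (a0 * x₀ 0 ^ 2 + 2 * b0 * x₀ 0 * x₀ 1 + c0 * x₀ 1 ^ 2) / 2,
        ![p0 - a0 * x₀ 0 - b0 * x₀ 1, q0 - b0 * x₀ 0 - c0 * x₀ 1], PW.Mx a0 b0 c0, PW.Mx_herm _ _ _⟩ →
        P.eval x = k + p0 * (x 0 - x₀ 0) + q0 * (x 1 + 1 - (x₀ 1 + 1)) + (a0 * (x 0 - x₀ 0) ^ 2 / 2 +
          b0 * (x 0 - x₀ 0) * (x 1 + 1 - (x₀ 1 + 1)) + c0 * (x 1 + 1 - (x₀ 1 + 1)) ^ 2 / 2) := by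
      rintro _ rfl
      simp [QuadPoly.eval, Fin.sum_univ_two, PW.Mx]
      ring
    rw [e _ rfl]
    refine h.trans ?_
    have h1 : ‖((x 0, x 1 + 1) : ℝ × ℝ) - (x₀ 0, x₀ 1 + 1)‖ ^ (2 + β) ≤ ‖x - x₀‖ ^ (2 + β) :=
      Real.rpow_le_rpow (norm_nonneg _) hnorm (by linarith)
    have h2 : 0 ≤ ‖x - x₀‖ ^ (2 + β) := by positivity
    nlinarith
  · have hv : ∀ P : QuadPoly, P = ⟨k - p0 * x₀ 0 - q0 * x₀ 1 + (a0 * x₀ 0 ^ 2 + 2 * b0 * x₀ 0 * x₀ 1 + c0 * x₀ 1 ^ 2) / 2,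
        ![p0 - a0 * x₀ 0 - b0 * x₀ 1, q0 - b0 * x₀ 0 - c0 * x₀ 1], PW.Mx a0 b0 c0, PW.Mx_herm _ _ _⟩ →
        P.grad x₀ 0 = p0 ∧ P.grad x₀ 1 = q0 := by
      rintro _ rfl
      simp [QuadPoly.grad, Fin.sum_univ_two, PW.Mx]
    obtain ⟨v0, v1⟩ := hv _ rfl
    have h1 : vecNorm (QuadPoly.grad ⟨k - p0 * x₀ 0 - q0 * x₀ 1 + (a0 * x₀ 0 ^ 2 + 2 * b0 * x₀ 0 * x₀ 1 + c0 * x₀ 1 ^ 2) / 2,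
        ![p0 - a0 * x₀ 0 - b0 * x₀ 1, q0 - b0 * x₀ 0 - c0 * x₀ 1], PW.Mx a0 b0 c0, PW.Mx_herm _ _ _⟩ x₀) ≤ 2 * C := by
      unfold vecNorm
      rw [Fin.sum_univ_two, v0, v1]
      refine Real.sqrt_le_iff.2 ⟨by positivity, ?_⟩
      have := sq_le_sq' (abs_le.1 hp).1 (abs_le.1 hp).2
      have := sq_le_sq' (abs_le.1 hq).1 (abs_le.1 hq).2
      nlinarith
    have h2 : matNorm (PW.Mx a0 b0 c0) ≤ 4 * C := by
      simp only [matNorm, Fin.sum_univ_two, PW.Mx]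
      simp
      linarith
    linarith
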